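/- Let (W, S) be a Coxeter system with Bruhat order ≤ and let J ⊆ S, with the J-twisted Bruhat order ^J≤ on W defined as follows: writing w = w_J · ^Jw for the unique parabolic factorization with w_J ∈ W_J, ^Jw ∈ ^JW and lengths adding, set w' ^J≤ w iff there exists u ∈ W_J with w_J ≤ w'_J · u⁻¹ and u · ^Jw' ≤ ^Jw. Define the poset ^JQ := {(v, w) ∈ W × W : v ^J≤ w} with partial order (v', w') ⪯ (v, w) iff v ^J≤ v' ^J≤ w' ^J≤ w, and let ^JQ̂ := ^JQ ⊔ {0̂} be obtained by adjoining a new minimum element 0̂. Then every closed interval of ^JQ̂ is graded, thin, and shellable. -/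

import Mathlib

section PosetCombinatorics

variable {α : Type*} (r : α → α → Prop)

/-- A chain of the subposet `s` with respect to the relation `r`. -/
def ChainIn (s c : Set α) : Prop := c ⊆ s ∧ IsChain r c

/-- A maximal chain of the subposet `s` with respect to the relation `r`. -/
def MaxChainIn (s c : Set α) : Prop :=
  ChainIn r s c ∧ ∀ c' : Set α, ChainIn r s c' → c ⊆ c' → c = c'

/-- The closed interval `[a, b]` inside the subposet `s`. -/
def intervalIn (s : Set α) (a b : α) : Set α := {x ∈ s | r a x ∧ r x b}

/-- The subposet `s` is graded: all its maximal chains have the same cardinality. -/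
def GradedIn (s : Set α) : Prop := ∃ n : ℕ, ∀ c : Set α, MaxChainIn r s c → c.ncard = n

/-- The subposet `s` is thin: every closed interval of rank 2 (i.e. in which all maximal
chains have 3 elements) contains exactly four elements. -/
def ThinIn (s : Set α) : Prop :=
  ∀ a ∈ s, ∀ b ∈ s, r a b →
    (∀ c : Set α, MaxChainIn r (intervalIn r s a b) c → c.ncard = 3) →
      (intervalIn r s a b).ncard = 4

/-- The subposet `s` is shellable: its maximal chains can be enumerated `c_1, …, c_t`
such that for all `i < j` there exists `k < j` with `c_i ∩ c_j ⊆ c_k ∩ c_j` and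
`|c_k ∩ c_j| = |c_j| − 1`. -/
def ShellableIn (s : Set α) : Prop :=
  ∃ (t : ℕ) (c : Fin t → Set α), Function.Injective c ∧
    (∀ i, MaxChainIn r s (c i)) ∧ (∀ d : Set α, MaxChainIn r s d → ∃ i, d = c i) ∧
    ∀ i j : Fin t, i < j → ∃ k : Fin t, k < j ∧
      c i ∩ c j ⊆ c k ∩ c j ∧ (c k ∩ c j).ncard = (c j).ncard - 1

end PosetCombinatorics

section Coxeter

variable {B : Type*} {M : CoxeterMatrix B} {W : Type*} [Group W]

/-- The Bruhat order on a Coxeter group: `v ≤ w` iff some reduced word for `w` contains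
a subword that is a reduced word for `v`. -/
def bruhatLE (cs : CoxeterSystem M W) (v w : W) : Prop :=
  ∃ ω : List B, cs.IsReduced ω ∧ cs.wordProd ω = w ∧
    ∃ ω' : List B, ω'.Sublist ω ∧ cs.IsReduced ω' ∧ cs.wordProd ω' = v

/-- The `J`-twisted Bruhat order on `W`: given the parabolic factorization data
`w = wJ w * Jw w` (with `wJ w ∈ W_J` and `Jw w ∈ ᴶW`), we set `w' ᴶ≤ w` iff there
exists `u ∈ W_J` with `wJ w ≤ wJ w' * u⁻¹` and `u * Jw w' ≤ Jw w` in Bruhat order. -/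
def twistedLE (cs : CoxeterSystem M W) (J : Set B) (wJ Jw : W → W) (w' w : W) : Prop :=
  ∃ u ∈ Subgroup.closure (cs.simple '' J),
    bruhatLE cs (wJ w) (wJ w' * u⁻¹) ∧ bruhatLE cs (u * Jw w') (Jw w)

end Coxeter

section JQhat

variable {W : Type*}

/-- Given the `J`-twisted Bruhat order `tle` on `W`, this is the order relation of the
poset `ᴶQ̂ = ᴶQ ⊔ {0̂}`, realized on `Option (W × W)` with `none` the adjoined minimum
`0̂` and `some (v, w)` the element `(v, w)` of `ᴶQ`:
`(v', w') ⪯ (v, w)` iff `v ᴶ≤ v' ᴶ≤ w' ᴶ≤ w`, and `0̂` is below everything. -/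
def hatRel (tle : W → W → Prop) : Option (W × W) → Option (W × W) → Prop
  | none, _ => True
  | some _, none => False
  | some p, some q => tle q.1 p.1 ∧ tle p.1 p.2 ∧ tle p.2 q.2

/-- The underlying set of the poset `ᴶQ̂ = ᴶQ ⊔ {0̂}` inside `Option (W × W)`:
the adjoined minimum `none = 0̂` together with the pairs `(v, w)` with `v ᴶ≤ w`. -/
def hatCarrier (tle : W → W → Prop) : Set (Option (W × W)) :=
  {x : Option (W × W) | x = none ∨ ∃ v w : W, x = some (v, w) ∧ tle v w}

end JQhat

/-- A ranked directed graph whose edges carry root labels and on which involutions act,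
abstracting the (twisted) Bruhat graph of a Coxeter group. -/
structure EdgeSystem (ι W V Λ : Type*) [AddCommGroup V] [Module ℝ V] [LinearOrder Λ] where
  act : ι → W → W
  rk : W → ℤ
  edge : W → V → W → Prop
  form : LinearMap.BilinForm ℝ V
  label : V → Λ
  act_act : ∀ i p, act i (act i p) = p
  rk_act : ∀ i p, rk (act i p) = rk p + 1 ∨ rk (act i p) = rk p - 1
  rk_lt : ∀ {p a q}, edge p a q → rk p < rk q
  edge_fun : ∀ {p a q q'}, edge p a q → edge p a q' → q = q'
  edge_cofun : ∀ {p p' a q}, edge p a q → edge p' a q → p = p'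
  edge_root : ∀ {p a b q}, edge p a q → edge p b q → a = b
  edge_simple : ∀ {i p}, rk p < rk (act i p) → ∃ a, edge p a (act i p)
  edge_act : ∀ {p a q} (i), edge p a q → q ≠ act i p → edge (act i p) a (act i q)
  form_comm : ∀ a b, form a b = form b a
  form_self : ∀ {p a q}, edge p a q → form a a = 2
  simple_up : ∀ {i p a q b b'}, edge p a q → edge p b (act i p) → edge q b' (act i q) →
    b' = b - form b a • a
  simple_down : ∀ {i p a q b b'}, edge (act i p) b p → edge p a q → edge q b' (act i q) →
    b' = form b a • a - b
  label_inj : ∀ {p a q p' b q'}, edge p a q → edge p' b q' → label a = label b → a = b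
  label_orient : ∀ {u v u' v'}, (∃ p q, edge p u q) → (∃ p q, edge p v q) →
    (∃ p q, edge p u' q) → (∃ p q, edge p v' q) → ∀ x y z w : ℝ,
    u' = x • u + y • v → v' = z • u + w • v → 0 < x * w - y * z → label u < label v →
    label u' < label v'

namespace EdgeSystem

open Relation

variable {ι W V Λ : Type*} [AddCommGroup V] [Module ℝ V] [LinearOrder Λ]

section Dual

/-- The edge system with all edges reversed. -/
def dual (E : EdgeSystem ι W V Λ) : EdgeSystem ι W V Λᵒᵈ where
  act := E.act
  rk p := - E.rk p
  edge p a q := E.edge q (-a) p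
  form := E.form
  label v := OrderDual.toDual (E.label (-v))
  act_act := E.act_act
  rk_act i p := by have := E.rk_act i p; omega
  rk_lt h := by have := E.rk_lt h; omega
  edge_fun h h' := E.edge_cofun h h'
  edge_cofun h h' := E.edge_fun h h'
  edge_root h h' := neg_injective (E.edge_root h h')
  edge_simple {i p} h := by
    have h1 : E.rk (E.act i p) < E.rk (E.act i (E.act i p)) := by rw [E.act_act]; omega
    obtain ⟨a, ha⟩ := E.edge_simple h1
    rw [E.act_act] at ha
    exact ⟨-a, by simpa using ha⟩
  edge_act {p a q} i h hne := by
    refine E.edge_act i h ?_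
    rintro rfl
    exact hne (E.act_act i q).symm
  form_comm := E.form_comm
  form_self h := by simpa using E.form_self h
  simple_up {i p a q b b'} h1 h2 h3 := by
    have hne : p ≠ E.act i q := by
      rintro rfl
      have := E.rk_lt h1
      have := E.rk_lt h3
      omega
    have h4 := E.edge_act i h1 hne
    have h5 := E.simple_up (i := i) h4 (by rwa [E.act_act]) (by rwa [E.act_act])
    have h6 : b = b' - E.form b' a • a := by
      have := congrArg Neg.neg h5
      simp only [neg_neg, map_neg, LinearMap.neg_apply, smul_neg] at this
      rw [this]; abel
    have h7 : E.form a a = 2 := by simpa using E.form_self h1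
    have h8 : E.form b a = - E.form b' a := by
      rw [h6]; simp [h7]; ring
    rw [h8, h6]; module
  simple_down {i p a q b b'} h1 h2 h3 := by
    have h5 := E.simple_down (i := i) h3 h2 h1
    have h6 : b = E.form b' a • a - b' := by
      have := congrArg Neg.neg h5
      simp only [neg_neg, map_neg, LinearMap.neg_apply, smul_neg] at this
      rw [this]; abel
    have h7 : E.form a a = 2 := by simpa using E.form_self h2
    have h8 : E.form b a = E.form b' a := by
      rw [h6]; simp [h7]; ring
    rw [h8, h6]; module
  label_inj h h' e := neg_injective (E.label_inj h h' (OrderDual.toDual.injective e))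
  label_orient {u v u' v'} := by
    rintro ⟨p, q, h1⟩ ⟨p', q', h2⟩ ⟨p₁, q₁, h3⟩ ⟨p₂, q₂, h4⟩ x y z w e1 e2 hd hl
    refine OrderDual.toDual_lt_toDual.2 (E.label_orient ⟨_, _, h2⟩ ⟨_, _, h1⟩ ⟨_, _, h4⟩ ⟨_, _, h3⟩
      w z y x ?_ ?_ ?_ (OrderDual.toDual_lt_toDual.1 hl))
    · rw [e2]; module
    · rw [e1]; module
    · linarith

end Dual

variable (E : EdgeSystem ι W V Λ)

/-- The reachability order. -/
def le : W → W → Prop := ReflTransGen fun p q => ∃ a, E.edge p a q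

/-- Edges between elements of consecutive rank. -/
def Cover (p : W) (a : V) (q : W) : Prop := E.edge p a q ∧ E.rk q = E.rk p + 1

variable {E}

lemma le_refl (p : W) : E.le p p := ReflTransGen.refl

lemma le_trans {p q s : W} (h : E.le p q) (h' : E.le q s) : E.le p s := ReflTransGen.trans h h'

lemma le_of_edge {p a q} (h : E.edge p a q) : E.le p q := ReflTransGen.single ⟨a, h⟩

lemma Cover.le {p a q} (h : E.Cover p a q) : E.le p q := le_of_edge h.1

lemma rk_le {p q : W} (h : E.le p q) : E.rk p ≤ E.rk q := by
  induction h with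
  | refl => exact _root_.le_refl _
  | tail _ h ih => obtain ⟨a, ha⟩ := h; exact ih.trans (E.rk_lt ha).le

lemma rk_lt_of_le_ne {p q : W} (h : E.le p q) (hne : p ≠ q) : E.rk p < E.rk q := by
  rcases ReflTransGen.cases_tail h with h | ⟨b, hb, a, ha⟩
  · exact absurd h.symm hne
  · exact (rk_le hb).trans_lt (E.rk_lt ha)

lemma eq_of_le_of_rk {p q : W} (h : E.le p q) (hr : E.rk q ≤ E.rk p) : p = q := by
  by_contra hne
  have := rk_lt_of_le_ne h hne
  omega

lemma le_antisymm {p q : W} (h : E.le p q) (h' : E.le q p) : p = q :=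
  eq_of_le_of_rk h (rk_le h')

lemma exists_edge_of_le {p q : W} (h : E.le p q) (hr : E.rk q = E.rk p + 1) :
    ∃ a, E.Cover p a q := by
  rcases ReflTransGen.cases_head h with h | ⟨b, ⟨a, ha⟩, hb⟩
  · subst h; omega
  · have h1 := E.rk_lt ha
    have h2 : b = q := eq_of_le_of_rk hb (by omega)
    subst h2
    exact ⟨a, ha, hr⟩

variable (E) in
/-- `i` is a descent of `p`. -/
def Desc (i : ι) (p : W) : Prop := E.rk (E.act i p) < E.rk p

lemma rk_act_of_desc {i p} (h : E.Desc i p) : E.rk (E.act i p) = E.rk p - 1 := by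
  have := E.rk_act i p; unfold Desc at h; omega

lemma rk_act_of_not_desc {i p} (h : ¬ E.Desc i p) : E.rk (E.act i p) = E.rk p + 1 := by
  have := E.rk_act i p; unfold Desc at h; omega

lemma not_desc_act {i p} (h : E.Desc i p) : ¬ E.Desc i (E.act i p) := by
  unfold Desc at *; rw [E.act_act]; omega

lemma act_injective (i : ι) : Function.Injective (E.act i) := fun p q h => by
  rw [← E.act_act i p, h, E.act_act]

lemma cover_act_of_not_desc {i p} (h : ¬ E.Desc i p) : ∃ a, E.Cover p a (E.act i p) := by
  have := rk_act_of_not_desc h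
  obtain ⟨a, ha⟩ := E.edge_simple (i := i) (p := p) (by omega)
  exact ⟨a, ha, this⟩

lemma cover_act_of_desc {i p} (h : E.Desc i p) : ∃ a, E.Cover (E.act i p) a p := by
  simpa [E.act_act] using cover_act_of_not_desc (not_desc_act h)

lemma le_act {i p} (h : ¬ E.Desc i p) : E.le p (E.act i p) := (cover_act_of_not_desc h).choose_spec.le

lemma act_le {i p} (h : E.Desc i p) : E.le (E.act i p) p := (cover_act_of_desc h).choose_spec.le

lemma lift_left {i p q} (h : E.le p q) : E.le (E.act i p) q ∨ E.le (E.act i p) (E.act i q) := by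
  induction h with
  | refl => exact Or.inr (le_refl _)
  | @tail b c _ h ih =>
    obtain ⟨a, ha⟩ := h
    rcases ih with ih | ih
    · exact Or.inl (le_trans ih (le_of_edge ha))
    · by_cases hc : c = E.act i b
      · exact Or.inl (hc ▸ ih)
      · exact Or.inr (le_trans ih (le_of_edge (E.edge_act i ha hc)))

lemma lift_right {i p q} (h : E.le p q) : E.le p (E.act i q) ∨ E.le (E.act i p) (E.act i q) := by
  induction h using ReflTransGen.head_induction_on with
  | refl => exact Or.inr (le_refl _)
  | @head b c h _ ih =>
    obtain ⟨a, ha⟩ := h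
    rcases ih with ih | ih
    · exact Or.inl (le_trans (le_of_edge ha) ih)
    · by_cases hc : c = E.act i b
      · left; rw [hc, E.act_act] at ih; exact ih
      · exact Or.inr (le_trans (le_of_edge (E.edge_act i ha hc)) ih)

lemma act_le_of_desc {i p q} (h : E.le p q) (hq : E.Desc i q) : E.le (E.act i p) q :=
  (lift_left h).elim id fun h => le_trans h (act_le hq)

lemma le_act_of_not_desc {i p q} (h : E.le p q) (hp : ¬ E.Desc i p) : E.le p (E.act i q) :=
  (lift_right h).elim id fun h => le_trans (le_act hp) h

lemma act_le_act_of_desc {i p q} (h : E.le p q) (hp : E.Desc i p) :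
    E.le (E.act i p) (E.act i q) :=
  (lift_right h).elim (fun h => le_trans (act_le hp) h) id

lemma Cover.eq_act {i p a q} (h : E.Cover p a q) (hp : ¬ E.Desc i p) (hq : E.Desc i q) :
    q = E.act i p := by
  by_contra hne
  have h1 := E.rk_lt (E.edge_act i h.1 hne)
  have := rk_act_of_not_desc hp
  have := rk_act_of_desc hq
  have := h.2
  omega

lemma Cover.act {i p a q} (h : E.Cover p a q) (hne : q ≠ E.act i p) (hpq : E.Desc i p ↔ E.Desc i q) :
    E.Cover (E.act i p) a (E.act i q) := by
  refine ⟨E.edge_act i h.1 hne, ?_⟩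
  have := h.2
  by_cases hp : E.Desc i p
  · have := rk_act_of_desc hp
    have := rk_act_of_desc (hpq.1 hp)
    omega
  · have := rk_act_of_not_desc hp
    have := rk_act_of_not_desc (fun h => hp (hpq.2 h))
    omega

variable (E) in
/-- The relation between the root labels of the two maximal chains of an interval of length two. -/
def Rel (a₁ a₂ b₁ b₂ : V) : Prop :=
  ∃ x y : ℝ, b₁ = x • a₁ + y • a₂ ∧ b₂ = y • a₁ - (x + E.form a₁ a₂ * y) • a₂

variable (E) in
/-- The interval `[p, w]` of length two has exactly two intermediate elements, with related
labels. -/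
def Diamond (p w : W) : Prop :=
  ∃ c d a₁ a₂ b₁ b₂, c ≠ d ∧ E.Cover p a₁ c ∧ E.Cover c a₂ w ∧ E.Cover p b₁ d ∧ E.Cover d b₂ w ∧
    E.Rel a₁ a₂ b₁ b₂ ∧ ∀ e a a', E.Cover p a e → E.Cover e a' w → e = c ∨ e = d

lemma Rel.sq {p q p' q' p'' q'' a₁ a₂ b₁} (h1 : E.edge p a₁ q) (h2 : E.edge p' a₂ q')
    (h3 : E.edge p'' b₁ q'') {x y : ℝ} (hb : b₁ = x • a₁ + y • a₂) :
    x * x + y * y + E.form a₁ a₂ * x * y = 1 := by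
  have e1 := E.form_self h1
  have e2 := E.form_self h2
  have e3 := E.form_self h3
  have e4 := E.form_comm a₂ a₁
  rw [hb] at e3
  simp [e1, e2, e4] at e3
  linarith

lemma Rel.symm {p q p' q' p'' q'' a₁ a₂ b₁ b₂} (h : E.Rel a₁ a₂ b₁ b₂) (h1 : E.edge p a₁ q)
    (h2 : E.edge p' a₂ q') (h3 : E.edge p'' b₁ q'') : E.Rel b₁ b₂ a₁ a₂ := by
  obtain ⟨x, y, hb, hb'⟩ := h
  have hs := Rel.sq h1 h2 h3 hb
  have e1 := E.form_self h1
  have e2 := E.form_self h2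
  have e4 := E.form_comm a₂ a₁
  have e5 : E.form b₁ b₂ = - E.form a₁ a₂ := by
    rw [hb, hb']
    simp [e1, e2, e4]
    linear_combination (- E.form a₁ a₂) * hs
  refine ⟨x + E.form a₁ a₂ * y, y, ?_, ?_⟩
  · rw [hb, hb']
    have : a₁ = (x * x + y * y + E.form a₁ a₂ * x * y) • a₁ := by rw [hs, one_smul]
    nth_rw 1 [this]
    module
  · rw [e5, hb, hb']
    have : a₂ = (x * x + y * y + E.form a₁ a₂ * x * y) • a₂ := by rw [hs, one_smul]
    nth_rw 1 [this]
    module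

/-- In a diamond, a chain with decreasing labels is complemented by one with increasing labels. -/
lemma Rel.of_gt {p w c d a₁ a₂ b₁ b₂} (hcd : c ≠ d) (h1 : E.Cover p a₁ c) (h2 : E.Cover c a₂ w)
    (h3 : E.Cover p b₁ d) (h4 : E.Cover d b₂ w) (h : E.Rel a₁ a₂ b₁ b₂)
    (hl : E.label a₂ < E.label a₁) : E.label b₁ < E.label b₂ ∧ E.label b₁ < E.label a₁ ∧
      E.label a₂ < E.label b₂ := by
  obtain ⟨x, y, hb, hb'⟩ := h
  have hs := Rel.sq h1.1 h2.1 h3.1 hb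
  have hy : y ≠ 0 := by
    rintro rfl
    have hx : x * x = 1 := by linarith
    rcases mul_self_eq_one_iff.1 hx with rfl | rfl
    · apply hcd
      have : b₁ = a₁ := by rw [hb]; module
      exact E.edge_fun h1.1 (this ▸ h3.1)
    · apply hcd
      have : b₂ = a₂ := by rw [hb']; module
      exact E.edge_cofun h2.1 (this ▸ h4.1)
  have r1 : ∃ p q, E.edge p a₁ q := ⟨_, _, h1.1⟩
  have r2 : ∃ p q, E.edge p a₂ q := ⟨_, _, h2.1⟩
  have r3 : ∃ p q, E.edge p b₁ q := ⟨_, _, h3.1⟩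
  have r4 : ∃ p q, E.edge p b₂ q := ⟨_, _, h4.1⟩
  have main : E.label b₁ < E.label b₂ := by
    refine E.label_orient r2 r1 r3 r4 y x (-(x + E.form a₁ a₂ * y)) y ?_ ?_ ?_ hl
    · rw [hb]; module
    · rw [hb']; module
    · nlinarith
  have hy' : 0 < y := by
    by_contra hn
    have hn' : y < 0 := lt_of_le_of_ne (not_lt.1 hn) hy
    have i1 : E.label a₁ < E.label b₁ := by
      refine E.label_orient r2 r1 r1 r3 0 1 y x ?_ ?_ ?_ hl
      · module
      · rw [hb]; module
      · linarith
    have i2 : E.label b₂ < E.label a₂ := by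
      refine E.label_orient r2 r1 r4 r2 (-(x + E.form a₁ a₂ * y)) y 1 0 ?_ ?_ ?_ hl
      · rw [hb']; module
      · module
      · linarith
    exact lt_irrefl _ (hl.trans (i1.trans (main.trans i2)))
  refine ⟨main, ?_, ?_⟩
  · refine E.label_orient r2 r1 r3 r1 y x 0 1 ?_ ?_ ?_ hl
    · rw [hb]; module
    · module
    · linarith
  · refine E.label_orient r2 r1 r2 r4 1 0 (-(x + E.form a₁ a₂ * y)) y ?_ ?_ ?_ hl
    · module
    · rw [hb']; module
    · linarith

lemma Rel.dual {a₁ a₂ b₁ b₂} (h : E.Rel a₁ a₂ b₁ b₂) :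
    E.dual.Rel (-a₂) (-a₁) (-b₂) (-b₁) := by
  obtain ⟨x, y, hb, hb'⟩ := h
  refine ⟨-(x + E.form a₁ a₂ * y), y, ?_, ?_⟩
  · rw [hb']; module
  · have : E.dual.form (-a₂) (-a₁) = E.form a₁ a₂ := by
      show E.form (-a₂) (-a₁) = _
      simp [E.form_comm a₂ a₁]
    rw [this, hb]; module

end EdgeSystem

namespace EdgeSystem
open Relation
variable {ι W V Λ : Type*} [AddCommGroup V] [Module ℝ V] [LinearOrder Λ]

variable (E : EdgeSystem ι W V Λ)

/-- The atoms of `[p, q]` with non-minimal label are not lower ends of increasing continuations. -/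
def AtomSwap (p q : W) : Prop :=
  ∀ c τ a α, E.Cover p τ c → E.le c q → E.Cover p α a → E.le a q → E.label α < E.label τ →
    ∃ ω w, E.Cover c ω w ∧ E.le w q ∧ E.label ω < E.label τ

/-- The dual of `AtomSwap`. -/
def CoatomSwap (p q : W) : Prop :=
  ∀ c τ a α, E.Cover c τ q → E.le p c → E.Cover a α q → E.le p a → E.label τ < E.label α →
    ∃ ω w, E.Cover w ω c ∧ E.le p w ∧ E.label τ < E.label ω

/-- The interval properties except for `AtomSwap`. -/
structure Basic (p q : W) : Prop where
  finite : {z | E.le p z ∧ E.le z q}.Finite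
  sat : E.le p q → ReflTransGen (fun p q => ∃ a, E.Cover p a q) p q
  diamond : E.le p q → E.rk q = E.rk p + 2 → E.Diamond p q

/-- The interval properties propagated along the order. -/
structure Good (p q : W) : Prop extends E.Basic p q where
  atomSwap : E.AtomSwap p q

variable {E}

lemma finite_step {i : ι} {p q : W}
    (h1 : {z | E.le p z ∧ E.le z (E.act i q)}.Finite)
    (h2 : {z | E.le (E.act i p) z ∧ E.le z (E.act i q)}.Finite) :
    {z | E.le p z ∧ E.le z q}.Finite := by
  refine ((h1.union ((h1.union h2).image (E.act i)))).subset ?_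
  rintro z ⟨hpz, hzq⟩
  by_cases hz : E.Desc i z
  · right
    refine ⟨E.act i z, ?_, E.act_act i z⟩
    have h3 := act_le_act_of_desc hzq hz
    by_cases hp : E.Desc i p
    · exact Or.inr ⟨act_le_act_of_desc hpz hp, h3⟩
    · exact Or.inl ⟨le_act_of_not_desc hpz hp, h3⟩
  · exact Or.inl ⟨hpz, le_act_of_not_desc hzq hz⟩

lemma sat_step_aux {i : ι} {q z : W} (hq : E.Desc i q)
    (h : ReflTransGen (fun p q => ∃ a, E.Cover p a q) z (E.act i q)) (hz : ¬ E.Desc i z) :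
    ReflTransGen (fun p q => ∃ a, E.Cover p a q) (E.act i z) q := by
  induction h using ReflTransGen.head_induction_on with
  | refl => rw [E.act_act]
  | @head b c hbc hc ih =>
    obtain ⟨a, ha⟩ := hbc
    by_cases hcb : c = E.act i b
    · rw [← hcb]
      exact hc.tail (cover_act_of_desc hq)
    · have hc' : ¬ E.Desc i c := fun hd => hcb (ha.eq_act hz hd)
      exact ReflTransGen.head ⟨a, ha.act hcb (by simp [hz, hc'])⟩ (ih hc')

lemma diamond_step_asc {i : ι} {p q : W} (hq : E.Desc i q) (hp : ¬ E.Desc i p) (h : E.le p q)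
    (hr : E.rk q = E.rk p + 2) : E.Diamond p q := by
  have h1 := le_act_of_not_desc h hp
  have hrq := rk_act_of_desc hq
  obtain ⟨τ, hτ⟩ := exists_edge_of_le h1 (by omega)
  obtain ⟨ρ, hρ⟩ := cover_act_of_not_desc hp
  obtain ⟨σ, hσ⟩ := cover_act_of_desc hq
  have hne : E.act i p ≠ E.act i q := fun h => by
    have := act_injective i h
    subst this; omega
  have h2 := E.edge_act i hτ.1 (Ne.symm hne)
  rw [E.act_act] at h2
  have hrp := rk_act_of_not_desc hp
  have h3 := E.simple_up (i := i) hτ.1 hρ.1 (by rw [E.act_act]; exact hσ.1)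
  refine ⟨E.act i p, E.act i q, ρ, τ, τ, σ, hne, hρ, ⟨h2, by omega⟩, hτ, hσ, ?_, ?_⟩
  · exact ⟨0, 1, by module, by rw [h3]; module⟩
  · intro e a a' h4 h5
    by_cases he : E.Desc i e
    · exact Or.inl (h4.eq_act hp he)
    · right; rw [h5.eq_act he hq, E.act_act]

lemma diamond_step_desc {i : ι} {p q : W} (hq : E.Desc i q) (hp : E.Desc i p)
    (hr : E.rk q = E.rk p + 2) (hd : E.Diamond (E.act i p) (E.act i q)) : E.Diamond p q := by
  have hrq := rk_act_of_desc hq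
  have hrp := rk_act_of_desc hp
  have transport : ∀ e a a', E.Cover (E.act i p) a e → E.Cover e a' (E.act i q) → e ≠ p →
      E.Cover p a (E.act i e) ∧ E.Cover (E.act i e) a' q := by
    intro e a a' h1 h2 hne
    have h3 := E.edge_act i h1.1 (by rwa [E.act_act])
    have h4 := E.edge_act i h2.1 (by
      intro h
      have := act_injective i h
      have := h1.2
      subst q
      omega)
    rw [E.act_act] at h3 h4
    have := E.rk_lt h3
    have := E.rk_lt h4
    exact ⟨⟨h3, by omega⟩, ⟨h4, by omega⟩⟩
  have back : ∀ e a a', E.Cover p a e → E.Cover e a' q → e ≠ E.act i q →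
      E.Cover (E.act i p) a (E.act i e) ∧ E.Cover (E.act i e) a' (E.act i q) := by
    intro e a a' h1 h2 hne
    have h3 := E.edge_act i h1.1 (by
      rintro rfl
      have := h1.2
      omega)
    have h4 := E.edge_act i h2.1 (by
      rintro rfl
      exact hne (E.act_act i e).symm)
    have := E.rk_lt h3
    have := E.rk_lt h4
    exact ⟨⟨h3, by omega⟩, ⟨h4, by omega⟩⟩
  have key : ∀ c d a₁ a₂ b₁ b₂, c ≠ d → E.Cover (E.act i p) a₁ c → E.Cover c a₂ (E.act i q) →
      E.Cover (E.act i p) b₁ d → E.Cover d b₂ (E.act i q) → E.Rel a₁ a₂ b₁ b₂ →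
      (∀ e a a', E.Cover (E.act i p) a e → E.Cover e a' (E.act i q) → e = c ∨ e = d) →
      p = c → E.Diamond p q := by
    rintro c d a₁ a₂ b₁ b₂ hcd h1 h2 h3 h4 hrel hall rfl
    obtain ⟨σ, hσ⟩ := cover_act_of_desc hq
    obtain ⟨t1, t2⟩ := transport d b₁ b₂ h3 h4 (Ne.symm hcd)
    have hs := E.simple_down (i := i) h1.1 h2.1 (by rw [E.act_act]; exact hσ.1)
    refine ⟨E.act i q, E.act i d, a₂, σ, b₁, b₂, ?_, h2, hσ, t1, t2, ?_, ?_⟩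
    · intro h
      have := act_injective i h
      have := h3.2
      subst q
      omega
    · obtain ⟨x, y, e1, e2⟩ := hrel
      have f1 := E.form_self h2.1
      have f2 : E.form a₂ σ = E.form a₁ a₂ := by
        rw [hs]; simp [f1, E.form_comm a₂ a₁]; ring
      refine ⟨x * E.form a₁ a₂ + y, -x, ?_, ?_⟩
      · rw [e1, hs, E.form_comm a₁ a₂, E.form_comm a₂ a₁]; module
      · rw [f2, e2, hs]; module
    · intro e a a' g1 g2
      by_cases he : e = E.act i q
      · exact Or.inl he
      · right
        obtain ⟨k1, k2⟩ := back e a a' g1 g2 he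
        rcases hall _ _ _ k1 k2 with h | h
        · have hrk := g1.2
          have he' : e = E.act i p := by rw [← h, E.act_act]
          rw [he'] at hrk
          omega
        · rw [← h, E.act_act]
  obtain ⟨c, d, a₁, a₂, b₁, b₂, hcd, h1, h2, h3, h4, hrel, hall⟩ := hd
  by_cases hc : p = c
  · exact key c d a₁ a₂ b₁ b₂ hcd h1 h2 h3 h4 hrel hall hc
  by_cases hd : p = d
  · exact key d c b₁ b₂ a₁ a₂ (Ne.symm hcd) h3 h4 h1 h2 (hrel.symm h1.1 h2.1 h3.1)
      (fun e a a' k1 k2 => (hall e a a' k1 k2).symm) hd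
  obtain ⟨s1, s2⟩ := transport c a₁ a₂ h1 h2 (Ne.symm hc)
  obtain ⟨t1, t2⟩ := transport d b₁ b₂ h3 h4 (Ne.symm hd)
  refine ⟨E.act i c, E.act i d, a₁, a₂, b₁, b₂, fun h => hcd (act_injective i h), s1, s2, t1, t2,
    hrel, ?_⟩
  intro e a a' g1 g2
  have he : e ≠ E.act i q := by
    rintro rfl
    obtain ⟨x, hx⟩ := cover_act_of_desc hp
    rcases hall p x a hx g1 with h | h
    · exact hc h
    · exact hd h
  obtain ⟨k1, k2⟩ := back e a a' g1 g2 he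
  rcases hall _ _ _ k1 k2 with h | h
  · left; rw [← h, E.act_act]
  · right; rw [← h, E.act_act]

lemma basic_step {i : ι} {p q : W} (hq : E.Desc i q) (h1 : E.Basic p (E.act i q))
    (h2 : E.Basic (E.act i p) (E.act i q)) : E.Basic p q where
  finite := finite_step h1.finite h2.finite
  sat h := by
    by_cases hp : E.Desc i p
    · have := sat_step_aux hq (h2.sat (act_le_act_of_desc h hp)) (not_desc_act hp)
      rwa [E.act_act] at this
    · exact (h1.sat (le_act_of_not_desc h hp)).tail (cover_act_of_desc hq)
  diamond h hr := by
    by_cases hp : E.Desc i p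
    · have := rk_act_of_desc hq
      have := rk_act_of_desc hp
      exact diamond_step_desc hq hp hr (h2.diamond (act_le_act_of_desc h hp) (by omega))
    · exact diamond_step_asc hq hp h hr

end EdgeSystem

namespace EdgeSystem
open Relation
variable {ι W V Λ : Type*} [AddCommGroup V] [Module ℝ V] [LinearOrder Λ]
variable (E : EdgeSystem ι W V Λ)

/-- An atom `c` of `[p, q]` all of whose continuations have larger labels. -/
def GoodAtom (p q c : W) (τ : V) : Prop :=
  E.Cover p τ c ∧ E.le c q ∧ ∀ ω w, E.Cover c ω w → E.le w q → E.label τ ≤ E.label ω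

variable {E}

lemma AtomSwap.min {p q c a : W} {τ α : V} (h : E.AtomSwap p q) (hc : E.GoodAtom p q c τ)
    (ha : E.Cover p α a) (haq : E.le a q) : E.label τ ≤ E.label α := by
  by_contra hn
  obtain ⟨ω, w, h1, h2, h3⟩ := h c τ a α hc.1 hc.2.1 ha haq (not_le.1 hn)
  exact absurd h3 (not_lt.2 (hc.2.2 ω w h1 h2))

lemma Cover.eq_of_label {p c a : W} {τ α : V} (h1 : E.Cover p τ c) (h2 : E.Cover p α a)
    (h : E.label τ = E.label α) : c = a := by
  have := E.label_inj h1.1 h2.1 h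
  subst this
  exact E.edge_fun h1.1 h2.1

lemma exists_min_atom {p q a : W} {α : V} (hf : {z | E.le p z ∧ E.le z q}.Finite)
    (ha : E.Cover p α a) (haq : E.le a q) :
    ∃ m μ, E.Cover p μ m ∧ E.le m q ∧ ∀ b β, E.Cover p β b → E.le b q → E.label μ ≤ E.label β := by
  classical
  let s := {z | E.le z q ∧ ∃ α, E.Cover p α z}
  have hs : s.Finite := hf.subset fun z ⟨h1, α, h2⟩ => ⟨h2.le, h1⟩
  let f : W → Λ := fun z => if h : ∃ α, E.Cover p α z then E.label h.choose else E.label α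
  have hfe : ∀ b β, E.Cover p β b → f b = E.label β := by
    intro b β hb
    have h : ∃ α, E.Cover p α b := ⟨β, hb⟩
    simp only [f, dif_pos h]
    rw [E.edge_root h.choose_spec.1 hb.1]
  obtain ⟨m, ⟨hm1, μ, hm2⟩, hm3⟩ := Set.exists_min_image s f hs ⟨a, haq, α, ha⟩
  refine ⟨m, μ, hm2, hm1, fun b β hb hbq => ?_⟩
  rw [← hfe _ _ hm2, ← hfe _ _ hb]
  exact hm3 b ⟨hbq, β, hb⟩

lemma goodAtom_of_min {p q m : W} {μ : V} (hd : ∀ w, E.le w q → E.Basic p w) (hm : E.Cover p μ m)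
    (hmq : E.le m q) (hmin : ∀ b β, E.Cover p β b → E.le b q → E.label μ ≤ E.label β) :
    E.GoodAtom p q m μ := by
  refine ⟨hm, hmq, fun ω w hw hwq => not_lt.1 fun hlt => ?_⟩
  obtain ⟨c, d, a₁, a₂, b₁, b₂, hcd, h1, h2, h3, h4, hrel, hall⟩ :=
    (hd w hwq).diamond (le_trans hm.le hw.le) (by rw [hw.2, hm.2]; ring)
  rcases hall m μ ω hm hw with rfl | rfl
  · rw [E.edge_root hm.1 h1.1, E.edge_root hw.1 h2.1] at hlt
    have := (hrel.of_gt hcd h1 h2 h3 h4 hlt).2.1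
    rw [← E.edge_root hm.1 h1.1] at this
    exact absurd this (not_lt.2 (hmin _ _ h3 (le_trans h4.le hwq)))
  · rw [E.edge_root hm.1 h3.1, E.edge_root hw.1 h4.1] at hlt
    have := ((hrel.symm h1.1 h2.1 h3.1).of_gt (Ne.symm hcd) h3 h4 h1 h2 hlt).2.1
    rw [← E.edge_root hm.1 h3.1] at this
    exact absurd this (not_lt.2 (hmin _ _ h1 (le_trans h2.le hwq)))

lemma label_simple_up_lt {i : ι} {p a q b b'} (h1 : E.edge p a q) (h2 : E.edge p b (E.act i p))
    (h3 : E.edge q b' (E.act i q)) (hlt : E.label b < E.label a) : E.label b' < E.label a := by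
  have e := E.simple_up h1 h2 h3
  refine E.label_orient ⟨_, _, h2⟩ ⟨_, _, h1⟩ ⟨_, _, h3⟩ ⟨_, _, h1⟩ 1 (-E.form b a) 0 1 ?_ ?_ ?_ hlt
  · rw [e]; module
  · module
  · norm_num

lemma label_simple_up_gt {i : ι} {p a q b b'} (h1 : E.edge p a q) (h2 : E.edge p b (E.act i p))
    (h3 : E.edge q b' (E.act i q)) (hlt : E.label a < E.label b) : E.label a < E.label b' := by
  have e := E.simple_up h1 h2 h3
  refine E.label_orient ⟨_, _, h1⟩ ⟨_, _, h2⟩ ⟨_, _, h1⟩ ⟨_, _, h3⟩ 1 0 (-E.form b a) 1 ?_ ?_ ?_ hlt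
  · module
  · rw [e]; module
  · norm_num

lemma label_simple_down_lt {i : ι} {p a q b b'} (h1 : E.edge p a q) (h2 : E.edge (E.act i p) b p)
    (h3 : E.edge q b' (E.act i q)) (hlt : E.label a < E.label b) : E.label b' < E.label a := by
  have e := E.simple_down h2 h1 h3
  refine E.label_orient ⟨_, _, h1⟩ ⟨_, _, h2⟩ ⟨_, _, h3⟩ ⟨_, _, h1⟩ (E.form b a) (-1) 1 0 ?_ ?_ ?_ hlt
  · rw [e]; module
  · module
  · norm_num

lemma atomSwap_step_asc {i : ι} {p q : W} (hq : E.Desc i q) (hp : ¬ E.Desc i p)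
    (h1 : E.AtomSwap p (E.act i q)) : E.AtomSwap p q := by
  intro c τ a α hc hcq ha haq hlt
  obtain ⟨ρ, hρ⟩ := cover_act_of_not_desc hp
  have hca : c ≠ a := by
    rintro rfl
    rw [E.edge_root hc.1 ha.1] at hlt
    exact lt_irrefl _ hlt
  by_cases hcs : c = E.act i p
  · subst hcs
    have had : ¬ E.Desc i a := fun hd => hca (ha.eq_act hp hd).symm
    exact ⟨α, E.act i a, ha.act (Ne.symm hca) (by simp [hp, had]), act_le_of_desc haq hq, hlt⟩
  · have hcd : ¬ E.Desc i c := fun hd => hcs (hc.eq_act hp hd)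
    rcases lt_trichotomy (E.label ρ) (E.label τ) with hρτ | hρτ | hρτ
    · obtain ⟨σ, hσ⟩ := cover_act_of_not_desc hcd
      exact ⟨σ, E.act i c, hσ, act_le_of_desc hcq hq, label_simple_up_lt hc.1 hρ.1 hσ.1 hρτ⟩
    · exact absurd (hρ.eq_of_label hc hρτ).symm hcs
    · have had : ¬ E.Desc i a := fun hd => by
        have := ha.eq_act hp hd
        subst this
        rw [E.edge_root hρ.1 ha.1] at hρτ
        exact lt_asymm hlt hρτ
      obtain ⟨ω, w, k1, k2, k3⟩ := h1 c τ a α hc (le_act_of_not_desc hcq hcd) ha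
        (le_act_of_not_desc haq had) hlt
      exact ⟨ω, w, k1, le_trans k2 (act_le hq), k3⟩

lemma atomSwap_step_desc {i : ι} {p q : W} (hq : E.Desc i q) (hp : E.Desc i p)
    (hb : ∀ w, E.le w q → E.Basic p w) (h1 : E.AtomSwap p (E.act i q))
    (h2 : E.AtomSwap (E.act i p) (E.act i q)) : E.AtomSwap p q := by
  intro c τ a₀ α₀ hc hcq ha₀ haq₀ hlt₀
  by_contra hcon
  have hcg : E.GoodAtom p q c τ := ⟨hc, hcq, fun ω w k1 k2 => not_lt.1 fun k3 =>
    hcon ⟨ω, w, k1, k2, k3⟩⟩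
  obtain ⟨a, α, ha, haq, hmin⟩ := exists_min_atom (hb q (le_refl q)).finite ha₀ haq₀
  have hlt : E.label α < E.label τ := (hmin _ _ ha₀ haq₀).trans_lt hlt₀
  have hag : E.GoodAtom p q a α := goodAtom_of_min hb ha haq hmin
  obtain ⟨ρ, hρ⟩ := cover_act_of_desc hp
  have hne : ∀ {x ξ}, E.Cover p ξ x → x ≠ E.act i p := fun {x ξ} h hx => by
    have := h.2
    have := rk_act_of_desc hp
    subst hx; omega
  have trans : ∀ {x ξ}, E.Cover p ξ x → E.Desc i x → E.Cover (E.act i p) ξ (E.act i x) :=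
    fun {x ξ} h hx => h.act (hne h) (by simp [hp, hx])
  have claimT : ∀ {x ξ}, E.GoodAtom p q x ξ → E.Desc i x → ¬ E.le x (E.act i q) →
      E.GoodAtom (E.act i p) (E.act i q) (E.act i x) ξ := by
    intro x ξ hx hxd hxq
    refine ⟨trans hx.1 hxd, act_le_act_of_desc hx.2.1 hxd, fun ω w k1 k2 => ?_⟩
    have hwx : w ≠ x := fun h => hxq (h ▸ k2)
    have hwd : ¬ E.Desc i w := fun hd => by
      have := k1.eq_act (not_desc_act hxd) hd
      rw [E.act_act] at this
      exact hwx this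
    have k3 := k1.act (i := i) (by rwa [E.act_act]) (by simp [hwd, not_desc_act hxd])
    rw [E.act_act] at k3
    exact hx.2.2 ω _ k3 (act_le_of_desc (le_trans k2 (act_le hq)) hq)
  have goodAsc : ∀ {x ξ}, E.GoodAtom p q x ξ → ¬ E.Desc i x → E.label ρ ≤ E.label ξ := by
    intro x ξ hx hxd
    by_contra hn
    obtain ⟨σ, hσ⟩ := cover_act_of_not_desc hxd
    exact absurd (label_simple_down_lt hx.1.1 hρ.1 hσ.1 (not_le.1 hn))
      (not_lt.2 (hx.2.2 _ _ hσ (act_le_of_desc hx.2.1 hq)))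
  have final : E.le c (E.act i q) → E.label ρ ≤ E.label τ → False := by
    intro hcq' hρτ
    have hcg' : E.GoodAtom p (E.act i q) c τ :=
      ⟨hc, hcq', fun ω w k1 k2 => hcg.2.2 ω w k1 (le_trans k2 (act_le hq))⟩
    have haq' : ¬ E.le a (E.act i q) := fun h => absurd hlt (not_lt.2 (h1.min hcg' ha h))
    have had : E.Desc i a := by
      by_contra hn
      exact haq' (le_act_of_not_desc haq hn)
    have hpg : E.GoodAtom (E.act i p) (E.act i q) p ρ :=
      ⟨hρ, le_trans hc.le hcq', fun ω w k1 k2 => hρτ.trans (h1.min hcg' k1 k2)⟩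
    have hag' := claimT hag had haq'
    have e := hpg.1.eq_of_label hag'.1
      (_root_.le_antisymm (h2.min hpg hag'.1 hag'.2.1) (h2.min hag' hpg.1 hpg.2.1))
    exact hne ha (by rw [e, E.act_act])
  by_cases hcd : E.Desc i c
  · by_cases hcq' : E.le c (E.act i q)
    · by_cases hρτ : E.label ρ ≤ E.label τ
      · exact final hcq' hρτ
      have hcg' : E.GoodAtom p (E.act i q) c τ :=
        ⟨hc, hcq', fun ω w k1 k2 => hcg.2.2 ω w k1 (le_trans k2 (act_le hq))⟩
      have haq' : ¬ E.le a (E.act i q) := fun h => absurd hlt (not_lt.2 (h1.min hcg' ha h))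
      have had : E.Desc i a := by
        by_contra hn
        exact haq' (le_act_of_not_desc haq hn)
      have hag' := claimT hag had haq'
      obtain ⟨ω, u, k1, k2, k3⟩ := h2 (E.act i c) τ (E.act i a) α (trans hc hcd)
        (act_le_act_of_desc hcq hcd) hag'.1 hag'.2.1 hlt
      by_cases huc : u = c
      · subst huc
        have hs : E.edge (E.act i u) ω (E.act i (E.act i u)) := by rw [E.act_act]; exact k1.1
        have := label_simple_up_gt (i := i) (trans hc hcd).1 (by rw [E.act_act]; exact hρ.1) hs
          (not_le.1 hρτ)
        exact lt_asymm this k3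
      · have hud : ¬ E.Desc i u := fun hd => by
          have := k1.eq_act (not_desc_act hcd) hd
          rw [E.act_act] at this
          exact huc this
        have k4 := k1.act (i := i) (by rwa [E.act_act]) (by simp [hud, not_desc_act hcd])
        rw [E.act_act] at k4
        exact absurd k3 (not_lt.2 (hcg.2.2 ω _ k4
          (act_le_of_desc (le_trans k2 (act_le hq)) hq)))
    · have hvg := claimT hcg hcd hcq'
      by_cases had : E.Desc i a
      · exact absurd hlt (not_lt.2 (h2.min hvg (trans ha had) (act_le_act_of_desc haq had)))
      · have k1 := h2.min hvg hρ (le_trans ha.le (le_act_of_not_desc haq had))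
        exact absurd hlt (not_lt.2 (k1.trans (goodAsc hag had)))
  · exact final (le_act_of_not_desc hcq hcd) (goodAsc hcg hcd)

/-- Goodness propagates along a descent of the top element. -/
theorem good_step {i : ι} {D : Set W} (hD : ∀ p ∈ D, E.act i p ∈ D) {y : W}
    (h : ∀ p ∈ D, ∀ q, E.le q (E.act i y) → E.Good p q) :
    ∀ p ∈ D, ∀ q, E.le q y → E.Good p q := by
  have hqs : ∀ q, E.le q y → E.Desc i q → E.le (E.act i q) (E.act i y) :=
    fun q hq hd => act_le_act_of_desc hq hd
  have hb : ∀ p ∈ D, ∀ q, E.le q y → E.Basic p q := by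
    intro p hp q hq
    by_cases hd : E.Desc i q
    · exact basic_step hd (h p hp _ (hqs q hq hd)).toBasic
        (h _ (hD p hp) _ (hqs q hq hd)).toBasic
    · exact (h p hp q (le_act_of_not_desc hq hd)).toBasic
  intro p hp q hq
  refine ⟨hb p hp q hq, ?_⟩
  by_cases hd : E.Desc i q
  · have h1 := (h p hp _ (hqs q hq hd)).atomSwap
    by_cases hpd : E.Desc i p
    · exact atomSwap_step_desc hd hpd (fun w hw => hb p hp w (le_trans hw hq)) h1
        (h _ (hD p hp) _ (hqs q hq hd)).atomSwap
    · exact atomSwap_step_asc hd hpd h1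
  · exact (h p hp q (le_act_of_not_desc hq hd)).atomSwap

end EdgeSystem

namespace EdgeSystem
open Relation
variable {ι W V Λ : Type*} [AddCommGroup V] [Module ℝ V] [LinearOrder Λ]
variable {E : EdgeSystem ι W V Λ}

lemma dual_cover {p a q} : E.dual.Cover p a q ↔ E.Cover q (-a) p := by
  show (E.edge q (-a) p ∧ - E.rk q = - E.rk p + 1) ↔ (E.edge q (-a) p ∧ E.rk p = E.rk q + 1)
  refine and_congr_right fun _ => ?_
  omega

lemma dual_cover_neg {p a q} : E.dual.Cover p (-a) q ↔ E.Cover q a p := by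
  rw [dual_cover, neg_neg]

lemma dual_label_neg (a : V) : E.dual.label (-a) = OrderDual.toDual (E.label a) := by
  show OrderDual.toDual (E.label (- -a)) = _
  rw [neg_neg]

lemma dual_le {p q : W} : E.dual.le p q ↔ E.le q p := by
  have : (fun p q => ∃ a, E.dual.edge p a q) = Function.swap (fun p q => ∃ a, E.edge p a q) := by
    ext p q
    exact ⟨fun ⟨a, h⟩ => ⟨-a, h⟩, fun ⟨a, h⟩ => ⟨-a, by show E.edge q (- -a) p; rwa [neg_neg]⟩⟩
  unfold le
  rw [this, reflTransGen_swap]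

lemma dual_sat {p q : W} (h : ReflTransGen (fun p q => ∃ a, E.Cover p a q) p q) :
    ReflTransGen (fun p q => ∃ a, E.dual.Cover p a q) q p := by
  rw [← reflTransGen_swap] at h
  exact ReflTransGen.mono (fun x y ⟨a, ha⟩ => ⟨-a, dual_cover_neg.2 ha⟩) _ _ h

lemma of_dual_sat {p q : W} (h : ReflTransGen (fun p q => ∃ a, E.dual.Cover p a q) p q) :
    ReflTransGen (fun p q => ∃ a, E.Cover p a q) q p := by
  rw [← reflTransGen_swap] at h
  exact ReflTransGen.mono (fun x y ⟨a, ha⟩ => ⟨-a, dual_cover.1 ha⟩) _ _ h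

lemma Diamond.dual {p q : W} (h : E.Diamond p q) : E.dual.Diamond q p := by
  obtain ⟨c, d, a₁, a₂, b₁, b₂, hcd, h1, h2, h3, h4, hrel, hall⟩ := h
  exact ⟨c, d, -a₂, -a₁, -b₂, -b₁, hcd, dual_cover_neg.2 h2, dual_cover_neg.2 h1,
    dual_cover_neg.2 h4, dual_cover_neg.2 h3, hrel.dual,
    fun e a a' k1 k2 => hall e _ _ (dual_cover.1 k2) (dual_cover.1 k1)⟩

lemma Basic.dual {p q : W} (h : E.Basic p q) : E.dual.Basic q p where
  finite := by simpa only [dual_le, and_comm] using h.finite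
  sat hle := dual_sat (h.sat (dual_le.1 hle))
  diamond hle hr := (h.diamond (dual_le.1 hle) (by
    have : - E.rk p = - E.rk q + 2 := hr
    omega)).dual

lemma Rel.of_dual {a₁ a₂ b₁ b₂} (h : E.dual.Rel a₁ a₂ b₁ b₂) :
    E.Rel (-a₂) (-a₁) (-b₂) (-b₁) := by
  obtain ⟨x, y, hb, hb'⟩ := h
  have : E.dual.form a₁ a₂ = E.form (-a₂) (-a₁) := by
    show E.form a₁ a₂ = _
    simp [E.form_comm a₂ a₁]
  rw [this] at hb'
  refine ⟨-(x + E.form (-a₂) (-a₁) * y), y, ?_, ?_⟩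
  · rw [hb']; module
  · rw [hb]; module

lemma Diamond.of_dual {p q : W} (h : E.dual.Diamond p q) : E.Diamond q p := by
  obtain ⟨c, d, a₁, a₂, b₁, b₂, hcd, h1, h2, h3, h4, hrel, hall⟩ := h
  exact ⟨c, d, -a₂, -a₁, -b₂, -b₁, hcd, dual_cover.1 h2, dual_cover.1 h1,
    dual_cover.1 h4, dual_cover.1 h3, hrel.of_dual,
    fun e a a' k1 k2 => hall e _ _ (dual_cover_neg.2 k2) (dual_cover_neg.2 k1)⟩

lemma Basic.of_dual {p q : W} (h : E.dual.Basic p q) : E.Basic q p where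
  finite := by simpa only [dual_le, and_comm] using h.finite
  sat hle := of_dual_sat (h.sat (dual_le.2 hle))
  diamond hle hr := (h.diamond (dual_le.2 hle) (by
    show - E.rk q = - E.rk p + 2
    omega)).of_dual

lemma CoatomSwap.of_dual {p q : W} (h : E.dual.CoatomSwap p q) : E.AtomSwap q p := by
  intro c τ a α hc hcq ha haq hlt
  obtain ⟨ω, w, k1, k2, k3⟩ := h c (-τ) a (-α) (dual_cover_neg.2 hc) (dual_le.2 hcq)
    (dual_cover_neg.2 ha) (dual_le.2 haq) (by
      rw [dual_label_neg, dual_label_neg]; exact OrderDual.toDual_lt_toDual.2 hlt)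
  refine ⟨-ω, w, dual_cover.1 k1, dual_le.1 k2, ?_⟩
  rw [dual_label_neg] at k3
  exact OrderDual.toDual_lt_toDual.1 k3

section Coatom

variable (E) in
/-- The dual of `GoodAtom`. -/
def GoodCoatom (p q c : W) (τ : V) : Prop :=
  E.Cover c τ q ∧ E.le p c ∧ ∀ ω w, E.Cover w ω c → E.le p w → E.label ω ≤ E.label τ

lemma exists_max_goodCoatom {p q a : W} {α : V} (hf : {z | E.le p z ∧ E.le z q}.Finite)
    (hd : ∀ w, E.le p w → E.Basic w q) (ha : E.Cover a α q) (hpa : E.le p a) :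
    ∃ m μ, E.GoodCoatom p q m μ ∧ E.label α ≤ E.label μ := by
  obtain ⟨m, μ, h1, h2, h3⟩ := exists_min_atom (E := E.dual) (p := q) (q := p)
    (by simpa only [dual_le, and_comm] using hf) (dual_cover_neg.2 ha) (dual_le.2 hpa)
  have h4 := goodAtom_of_min (E := E.dual) (fun w hw => (hd w (dual_le.1 hw)).dual) h1 h2 h3
  refine ⟨m, -μ, ⟨dual_cover.1 h1, dual_le.1 h2, fun ω w k1 k2 => ?_⟩, ?_⟩
  · have := h4.2.2 _ _ (dual_cover_neg.2 k1) (dual_le.2 k2)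
    rw [dual_label_neg] at this
    exact this
  · have := h3 _ _ (dual_cover_neg.2 ha) (dual_le.2 hpa)
    rw [dual_label_neg] at this
    exact this

lemma exists_atom {p q : W} (h : E.Basic p q) (hle : E.le p q) (hne : p ≠ q) :
    ∃ a α, E.Cover p α a ∧ E.le a q := by
  rcases ReflTransGen.cases_head (h.sat hle) with h | ⟨a, ⟨α, hα⟩, ha⟩
  · exact absurd h hne
  · exact ⟨a, α, hα, ReflTransGen.mono (fun x y ⟨a, ha⟩ => ⟨a, ha.1⟩) _ _ ha⟩

lemma min_atom_le_goodCoatom (q : W) (n : ℕ) : ∀ p, (E.rk q - E.rk p).toNat = n →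
    (∀ p' q', E.le p p' → E.le q' q → E.Good p' q') → E.rk p + 2 ≤ E.rk q →
    ∀ m μ, E.Cover p μ m → E.le m q →
      (∀ b β, E.Cover p β b → E.le b q → E.label μ ≤ E.label β) →
    ∀ c τ, E.GoodCoatom p q c τ → E.le m c := by
  induction n using Nat.strong_induction_on with
  | _ n ih =>
  intro p hn H hr m μ hm hmq hmin c τ hc
  have hcr := hc.1.2
  obtain ⟨a, α, ha, hac⟩ := exists_atom (H p c (le_refl p) hc.1.le).toBasic hc.2.1
    (by rintro rfl; omega)
  obtain ⟨k, κ, hk, hkc, hkmin⟩ := exists_min_atom (H p c (le_refl p) hc.1.le).finite ha hac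
  have hkg : E.GoodAtom p c k κ := goodAtom_of_min
    (fun w hw => (H p w (le_refl p) (le_trans hw hc.1.le)).toBasic) hk hkc hkmin
  have hkq : E.le k q := le_trans hkc hc.1.le
  have hkg' : E.GoodAtom p q k κ := by
    refine ⟨hk, hkq, fun ω x hx hxq => not_lt.1 fun hlt => ?_⟩
    have hkr := hk.2
    by_cases hkc' : k = c
    · subst hkc'
      have hxr := hx.2
      have : x = q := eq_of_le_of_rk hxq (by omega)
      subst this
      rw [E.edge_root hx.1 hc.1.1] at hlt
      exact absurd hlt (not_lt.2 (hc.2.2 _ _ hk (le_refl p)))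
    · have hlt' := rk_lt_of_le_ne hkc hkc'
      obtain ⟨l, ν, hl, hlq, hlmin⟩ :=
        exists_min_atom (H k q hk.le (le_refl q)).finite hx hxq
      have hlc := ih _ (by omega) k rfl (fun p' q' h1 h2 => H p' q' (le_trans hk.le h1) h2)
        (by omega) l ν hl hlq hlmin c τ ⟨hc.1, hkc, fun ω w k1 k2 =>
          hc.2.2 ω w k1 (le_trans hk.le k2)⟩
      exact absurd ((hlmin _ _ hx hxq).trans_lt hlt) (not_lt.2 (hkg.2.2 _ _ hl hlc))
  have := (H p q (le_refl p) (le_refl q)).atomSwap.min hkg' hm hmq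
  rw [hm.eq_of_label hk (_root_.le_antisymm (hmin _ _ hk hkq) this)]
  exact hkc

lemma coatomSwap_aux (q : W) (n : ℕ) : ∀ p, (E.rk q - E.rk p).toNat = n →
    (∀ p' q', E.le p p' → E.le q' q → E.Good p' q') → E.CoatomSwap p q := by
  induction n using Nat.strong_induction_on with
  | _ n ih =>
  intro p hn H c τ a₀ α₀ hc hpc ha₀ hpa₀ hlt₀
  by_contra hcon
  have hcg : E.GoodCoatom p q c τ := ⟨hc, hpc, fun ω w k1 k2 => not_lt.1 fun k3 =>
    hcon ⟨ω, w, k1, k2, k3⟩⟩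
  obtain ⟨a, α, hag, hα⟩ := exists_max_goodCoatom (H p q (le_refl p) (le_refl q)).finite
    (fun w hw => (H w q hw (le_refl q)).toBasic) ha₀ hpa₀
  have hlt := hlt₀.trans_le hα
  have hcr := hc.2
  have har := hag.1.2
  have hpr := rk_le hpc
  by_cases hr : E.rk q = E.rk p + 1
  · have h1 : p = c := eq_of_le_of_rk hpc (by omega)
    have h2 : p = a := eq_of_le_of_rk hag.2.1 (by omega)
    subst h1; subst h2
    rw [E.edge_root hc.1 hag.1.1] at hlt
    exact lt_irrefl _ hlt
  · obtain ⟨b, β, hb, hbq⟩ := exists_atom (H p q (le_refl p) (le_refl q)).toBasic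
      (le_trans hpc hc.le) (by rintro rfl; omega)
    obtain ⟨m, μ, hm, hmq, hmin⟩ := exists_min_atom (H p q (le_refl p) (le_refl q)).finite hb hbq
    have k1 := min_atom_le_goodCoatom q n p hn H (by omega) m μ hm hmq hmin c τ hcg
    have k2 := min_atom_le_goodCoatom q n p hn H (by omega) m μ hm hmq hmin a α hag
    have hmr := hm.2
    obtain ⟨ω, w, j1, j2, j3⟩ := ih _ (by omega) m rfl
      (fun p' q' h1 h2 => H p' q' (le_trans hm.le h1) h2) c τ a α hc k1 hag.1 k2 hlt
    exact absurd j3 (not_lt.2 (hcg.2.2 _ _ j1 (le_trans hm.le j2)))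

theorem coatomSwap_of_good {p q : W} (H : ∀ p' q', E.le p p' → E.le q' q → E.Good p' q') :
    E.CoatomSwap p q := coatomSwap_aux q _ p rfl H

theorem good_of_dual {p q : W} (H : ∀ p' q', E.le p p' → E.le q' q → E.dual.Good q' p') :
    E.Good p q where
  toBasic := (H p q (le_refl p) (le_refl q)).toBasic.of_dual
  atomSwap := (coatomSwap_of_good fun p' q' h1 h2 =>
    H q' p' (dual_le.1 h2) (dual_le.1 h1)).of_dual

end Coatom

end EdgeSystem

namespace CoxeterMatrix

variable {B : Type*} (M : CoxeterMatrix B)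

/-- The canonical symmetric bilinear form, normalised so that simple roots have square length 2. -/
noncomputable def geomForm : LinearMap.BilinForm ℝ (B →₀ ℝ) :=
  Finsupp.linearCombination ℝ fun i => Finsupp.linearCombination ℝ fun j =>
    -2 * Real.cos (Real.pi / M i j)

/-- The simple root of index `i`. -/
noncomputable def simpleRoot (i : B) : B →₀ ℝ := Finsupp.single i 1

/-- The reflection in `a`. -/
noncomputable def geomRefl (a : B →₀ ℝ) : Module.End ℝ (B →₀ ℝ) :=
  LinearMap.id - (M.geomForm.flip a).smulRight a

lemma geomRefl_apply (a v : B →₀ ℝ) : M.geomRefl a v = v - M.geomForm v a • a := by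
  simp [geomRefl]

lemma geomForm_simple (i j : B) : M.geomForm (simpleRoot i) (simpleRoot j) =
    -2 * Real.cos (Real.pi / M i j) := by
  simp [geomForm, simpleRoot]

lemma geomForm_simple_self (i : B) : M.geomForm (simpleRoot i) (simpleRoot i) = 2 := by
  rw [geomForm_simple, M.diagonal]; simp

lemma geomForm_comm (v w : B →₀ ℝ) : M.geomForm v w = M.geomForm w v := by
  induction v using Finsupp.induction_linear with
  | zero => simp
  | add v v' h h' => simp [h, h']
  | single i x =>
    induction w using Finsupp.induction_linear with
    | zero => simp
    | add v v' h h' => simp [h, h']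
    | single j y => simp [geomForm, M.symmetric j i]; ring

lemma geomRefl_form (a v w : B →₀ ℝ) (ha : M.geomForm a a = 2) :
    M.geomForm (M.geomRefl a v) (M.geomRefl a w) = M.geomForm v w := by
  simp [geomRefl_apply, ha, M.geomForm_comm a w]; ring

lemma geomRefl_self (a : B →₀ ℝ) (ha : M.geomForm a a = 2) : M.geomRefl a a = -a := by
  rw [geomRefl_apply, ha]; module

lemma geomRefl_sq (a : B →₀ ℝ) (ha : M.geomForm a a = 2) : M.geomRefl a * M.geomRefl a = 1 := by
  ext1 x
  ext1
  simp only [Module.End.mul_eq_comp, LinearMap.comp_apply, geomRefl_apply, map_sub, map_smul,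
    ha, Module.End.one_apply]
  module

lemma geomRefl_simple_combination (i j : B) (x y : ℝ) :
    M.geomRefl (simpleRoot i) (x • simpleRoot i + y • simpleRoot j) =
      (2 * Real.cos (Real.pi / M i j) * y - x) • simpleRoot i + y • simpleRoot j := by
  rw [geomRefl_apply]
  simp only [map_add, map_smul, LinearMap.add_apply, LinearMap.smul_apply, geomForm_simple_self,
    geomForm_simple, smul_eq_mul, M.symmetric j i]
  module

lemma geomRefl_mul_sin (i j : B) (n : ℝ) :
    (M.geomRefl (simpleRoot i) * M.geomRefl (simpleRoot j))
      (Real.sin ((n + 1) * (Real.pi / M i j)) • simpleRoot i +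
        Real.sin (n * (Real.pi / M i j)) • simpleRoot j) =
      Real.sin ((n + 2 + 1) * (Real.pi / M i j)) • simpleRoot i +
        Real.sin ((n + 2) * (Real.pi / M i j)) • simpleRoot j := by
  have sin_rec : ∀ x : ℝ, 2 * Real.cos (Real.pi / M i j) * Real.sin ((x + 1) * (Real.pi / M i j)) -
      Real.sin (x * (Real.pi / M i j)) = Real.sin ((x + 2) * (Real.pi / M i j)) := by
    intro x
    rw [show (x + 2) * (Real.pi / M i j) = (x + 1) * (Real.pi / M i j) + Real.pi / M i j by ring,
      show x * (Real.pi / M i j) = (x + 1) * (Real.pi / M i j) - Real.pi / M i j by ring,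
      Real.sin_add, Real.sin_sub]
    ring
  rw [Module.End.mul_apply, add_comm, geomRefl_simple_combination, M.symmetric j i, sin_rec, add_comm,
    geomRefl_simple_combination]
  have := sin_rec (n + 1)
  rw [show n + 1 + 1 = n + 2 by ring, show n + 1 + 2 = n + 2 + 1 by ring] at this
  rw [this]

lemma geomRefl_mul_pow (i j : B) :
    (M.geomRefl (simpleRoot i) * M.geomRefl (simpleRoot j)) ^ M i j = 1 := by
  by_cases hij : i = j
  · subst hij
    rw [M.geomRefl_sq _ (M.geomForm_simple_self i), one_pow]
  by_cases hm : M i j = 0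
  · rw [hm, pow_zero]
  have hm1 : M i j ≠ 1 := M.off_diagonal i j hij
  have hm2 : 2 ≤ M i j := by omega
  set T := M.geomRefl (simpleRoot i) * M.geomRefl (simpleRoot j) with hT
  set θ := Real.pi / M i j with hθ
  have hmθ : M i j * θ = Real.pi := by
    rw [hθ]; field_simp
  have hs : 0 < Real.sin θ := by
    have : (2 : ℝ) ≤ M i j := by exact_mod_cast hm2
    refine Real.sin_pos_of_pos_of_lt_pi (by positivity) ?_
    rw [hθ, div_lt_iff₀ (by positivity)]
    nlinarith [Real.pi_pos]
  have hpow : ∀ (k : ℕ) (n : ℝ), (T ^ k) (Real.sin ((n + 1) * θ) • simpleRoot i +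
      Real.sin (n * θ) • simpleRoot j) = Real.sin ((n + 2 * k + 1) * θ) • simpleRoot i +
        Real.sin ((n + 2 * k) * θ) • simpleRoot j := by
    intro k
    induction k with
    | zero => intro n; simp
    | succ k ih =>
      intro n
      rw [pow_succ, Module.End.mul_apply, M.geomRefl_mul_sin i j n, ih]
      push_cast
      ring_nf
  have hper : ∀ n : ℝ, (T ^ M i j) (Real.sin ((n + 1) * θ) • simpleRoot i +
      Real.sin (n * θ) • simpleRoot j) = Real.sin ((n + 1) * θ) • simpleRoot i +
      Real.sin (n * θ) • simpleRoot j := by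
    intro n
    rw [hpow, show (n + 2 * (M i j : ℝ) + 1) * θ = (n + 1) * θ + 2 * (M i j * θ) by ring,
      show (n + 2 * (M i j : ℝ)) * θ = n * θ + 2 * (M i j * θ) by ring, hmθ,
      Real.sin_add_two_pi, Real.sin_add_two_pi]
  have hi : (T ^ M i j) (simpleRoot i) = simpleRoot i := by
    have := hper 0
    simp only [zero_add, one_mul, zero_mul, Real.sin_zero, zero_smul, add_zero, map_smul] at this
    exact smul_right_injective _ hs.ne' this
  have hj : (T ^ M i j) (simpleRoot j) = simpleRoot j := by
    have := hper (-1)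
    simp only [neg_add_cancel, neg_mul, one_mul, zero_mul, Real.sin_zero, zero_smul, zero_add,
      map_smul, Real.sin_neg] at this
    exact smul_right_injective _ (neg_ne_zero.2 hs.ne') this
  have hfix : ∀ v, M.geomForm v (simpleRoot i) = 0 → M.geomForm v (simpleRoot j) = 0 →
      (T ^ M i j) v = v := by
    intro v h1 h2
    have hTv : T v = v := by
      rw [hT, Module.End.mul_apply, geomRefl_apply, geomRefl_apply, h2]; simp [h1]
    generalize M i j = k
    induction k with
    | zero => simp
    | succ k ih => rw [pow_succ, Module.End.mul_apply, hTv, ih]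
  refine LinearMap.ext fun v => ?_
  set c := Real.cos θ with hc
  set x := (M.geomForm v (simpleRoot i) + c * M.geomForm v (simpleRoot j)) /
    (2 * Real.sin θ ^ 2) with hx
  set y := (M.geomForm v (simpleRoot j) + c * M.geomForm v (simpleRoot i)) /
    (2 * Real.sin θ ^ 2) with hy
  have hsc : Real.sin θ ^ 2 = 1 - c ^ 2 := Real.sin_sq θ
  have hsc' : (1 - c ^ 2) ≠ 0 := by rw [← hsc]; positivity
  have h0 : (T ^ M i j) (v - x • simpleRoot i - y • simpleRoot j) =
      v - x • simpleRoot i - y • simpleRoot j := by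
    apply hfix
    · simp only [map_sub, map_smul, LinearMap.sub_apply, LinearMap.smul_apply,
        geomForm_simple_self, geomForm_simple, M.symmetric j i, smul_eq_mul, ← hθ, ← hc]
      rw [hx, hy, hsc]
      field_simp
      ring
    · simp only [map_sub, map_smul, LinearMap.sub_apply, LinearMap.smul_apply,
        geomForm_simple_self, geomForm_simple, smul_eq_mul, ← hθ, ← hc]
      rw [hx, hy, hsc]
      field_simp
      ring
  have hv : v = (v - x • simpleRoot i - y • simpleRoot j) + x • simpleRoot i +
    y • simpleRoot j := by abel
  rw [hv, map_add, map_add, h0, map_smul, map_smul, hi, hj]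
  rfl

end CoxeterMatrix

namespace CoxeterSystem

open CoxeterMatrix

variable {B : Type*} {M : CoxeterMatrix B} {W : Type*} [Group W] (cs : CoxeterSystem M W)

/-- The geometric representation. -/
noncomputable def geomRep : W →* Module.End ℝ (B →₀ ℝ) :=
  cs.lift ⟨fun i => M.geomRefl (simpleRoot i), M.geomRefl_mul_pow⟩

lemma geomRep_simple (i : B) : cs.geomRep (cs.simple i) = M.geomRefl (simpleRoot i) :=
  cs.lift_apply_simple M.geomRefl_mul_pow i

lemma geomRep_mul_apply (w w' : W) (v : B →₀ ℝ) :
    cs.geomRep (w * w') v = cs.geomRep w (cs.geomRep w' v) := by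
  rw [map_mul, Module.End.mul_apply]

lemma geomRep_one_apply (v : B →₀ ℝ) : cs.geomRep 1 v = v := by
  rw [map_one, Module.End.one_apply]

lemma geomRep_inv_apply_self (w : W) (v : B →₀ ℝ) : cs.geomRep w⁻¹ (cs.geomRep w v) = v := by
  rw [← geomRep_mul_apply, inv_mul_cancel, geomRep_one_apply]

lemma geomRep_apply_inv_self (w : W) (v : B →₀ ℝ) : cs.geomRep w (cs.geomRep w⁻¹ v) = v := by
  rw [← geomRep_mul_apply, mul_inv_cancel, geomRep_one_apply]

lemma geomForm_geomRep (w : W) (v v' : B →₀ ℝ) :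
    M.geomForm (cs.geomRep w v) (cs.geomRep w v') = M.geomForm v v' := by
  induction w using cs.simple_induction_left with
  | one => simp
  | mul_simple_left w i ih =>
    rw [geomRep_mul_apply, geomRep_mul_apply, geomRep_simple,
      M.geomRefl_form _ _ _ (M.geomForm_simple_self i), ih]

/-- The coefficients of the roots in a dihedral subsystem. -/
noncomputable def dihedralCoeff (c : ℝ) : ℕ → ℝ
  | 0 => 0
  | 1 => 1
  | n + 2 => c * dihedralCoeff c (n + 1) - dihedralCoeff c n

lemma dihedralCoeff_two (n : ℕ) : dihedralCoeff 2 n = n ∧ dihedralCoeff 2 (n + 1) = n + 1 := by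
  induction n with
  | zero => simp [dihedralCoeff]
  | succ n ih =>
    refine ⟨by rw [ih.2]; push_cast; ring, ?_⟩
    rw [dihedralCoeff, ih.1, ih.2]; push_cast; ring

lemma dihedralCoeff_mul_sin (θ : ℝ) (n : ℕ) :
    dihedralCoeff (2 * Real.cos θ) n * Real.sin θ = Real.sin (n * θ) ∧
    dihedralCoeff (2 * Real.cos θ) (n + 1) * Real.sin θ = Real.sin ((n + 1) * θ) := by
  induction n with
  | zero => simp [dihedralCoeff]
  | succ n ih =>
    refine ⟨by rw [ih.2]; push_cast; ring_nf, ?_⟩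
    rw [dihedralCoeff, sub_mul, ih.1, mul_assoc, ih.2]
    push_cast
    rw [show ((n : ℝ) + 1 + 1) * θ = (n + 1) * θ + θ by ring,
      show (n : ℝ) * θ = (n + 1) * θ - θ by ring, Real.sin_add, Real.sin_sub]
    ring

lemma dihedralCoeff_nonneg {m n : ℕ} (h1 : m ≠ 1) (h : m ≠ 0 → n ≤ m) :
    0 ≤ dihedralCoeff (2 * Real.cos (Real.pi / m)) n := by
  by_cases hm : m = 0
  · subst hm
    simp [(dihedralCoeff_two n).1]
  have hm2 : (2 : ℝ) ≤ m := by exact_mod_cast (by omega : 2 ≤ m)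
  have hn : (n : ℝ) ≤ m := by exact_mod_cast h hm
  have hs : 0 < Real.sin (Real.pi / m) := by
    refine Real.sin_pos_of_pos_of_lt_pi (by positivity) ?_
    rw [div_lt_iff₀ (by positivity)]
    nlinarith [Real.pi_pos]
  have h2 : 0 ≤ Real.sin (n * (Real.pi / m)) := by
    refine Real.sin_nonneg_of_nonneg_of_le_pi (by positivity) ?_
    rw [← mul_div_assoc, div_le_iff₀ (by positivity)]
    nlinarith [Real.pi_pos]
  rw [← (dihedralCoeff_mul_sin _ n).1] at h2
  exact nonneg_of_mul_nonneg_left h2 hs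

lemma geomRep_alternatingWord (i j : B) (k : ℕ) :
    cs.geomRep (cs.wordProd (alternatingWord i j k)) (simpleRoot i) =
      (if Even k then dihedralCoeff (2 * Real.cos (Real.pi / M i j)) (k + 1)
        else dihedralCoeff (2 * Real.cos (Real.pi / M i j)) k) • simpleRoot i +
      (if Even k then dihedralCoeff (2 * Real.cos (Real.pi / M i j)) k
        else dihedralCoeff (2 * Real.cos (Real.pi / M i j)) (k + 1)) • simpleRoot j := by
  induction k with
  | zero => simp [alternatingWord, dihedralCoeff]
  | succ k ih =>
    rw [alternatingWord_succ', wordProd_cons, geomRep_mul_apply, ih]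
    by_cases hk : Even k
    · have hk' : ¬ Even (k + 1) := by simpa [Nat.even_add_one] using hk
      simp only [hk, hk', if_true, if_false, geomRep_simple]
      rw [add_comm, geomRefl_simple_combination, M.symmetric j i, add_comm]
      rfl
    · have hk' : Even (k + 1) := by simpa [Nat.even_add_one] using hk
      simp only [hk, hk', if_true, if_false, geomRep_simple]
      rw [geomRefl_simple_combination]
      rfl

lemma simpleRoot_nonneg (i : B) : (0 : B →₀ ℝ) ≤ simpleRoot i := by
  simp [simpleRoot]

lemma simpleRoot_ne_zero (i : B) : (simpleRoot i : B →₀ ℝ) ≠ 0 := by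
  simp [simpleRoot]

theorem geomRep_nonneg (n : ℕ) : ∀ w : W, cs.length w = n → ∀ i, ¬ cs.IsRightDescent w i →
    0 ≤ cs.geomRep w (simpleRoot i) := by
  induction n using Nat.strong_induction_on with
  | _ n ih =>
  intro w hw i hi
  by_cases hw1 : w = 1
  · rw [hw1, geomRep_one_apply]; exact simpleRoot_nonneg i
  obtain ⟨j, hj⟩ := cs.exists_rightDescent_of_ne_one hw1
  have hij : i ≠ j := by rintro rfl; exact hi hj
  classical
  let P : ℕ → Prop := fun k => ∃ v, w = v * cs.wordProd (alternatingWord i j k) ∧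
    cs.length w = cs.length v + k
  have hP1 : P 1 := by
    refine ⟨w * cs.simple j, by simp [alternatingWord], ?_⟩
    rw [cs.isRightDescent_iff] at hj
    exact hj.symm
  have hwl : 1 ≤ cs.length w := Nat.one_le_iff_ne_zero.2 fun h => hw1 (cs.length_eq_zero_iff.1 h)
  set k := Nat.findGreatest P (cs.length w) with hk
  have hk1 : 1 ≤ k := Nat.le_findGreatest hwl hP1
  obtain ⟨v, hv, hvl⟩ : P k := Nat.findGreatest_spec hwl hP1
  have hmax : ¬ P (k + 1) := fun h => by
    have : k + 1 ≤ cs.length w := by obtain ⟨_, _, h⟩ := h; omega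
    have := Nat.le_findGreatest this h
    omega
  have hc : ¬ cs.IsRightDescent v (if Even k then j else i) := by
    intro hd
    rw [cs.isRightDescent_iff] at hd
    refine hmax ⟨v * cs.simple (if Even k then j else i), ?_, by omega⟩
    rw [alternatingWord_succ', wordProd_cons, mul_assoc, cs.simple_mul_simple_cancel_left]
    exact hv
  have hd : ¬ cs.IsRightDescent v (if Even k then i else j) := by
    intro hd
    rw [cs.isRightDescent_iff] at hd
    obtain ⟨l, hl⟩ : ∃ l, k = l + 1 := ⟨k - 1, by omega⟩
    have h1 : w = (v * cs.simple (if Even k then i else j)) *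
        cs.wordProd (alternatingWord i j l) := by
      rw [hv, hl, alternatingWord_succ', wordProd_cons]
      by_cases he : Even l <;> simp [he, Nat.even_add_one, mul_assoc]
    have h2 := cs.length_mul_le (v * cs.simple (if Even k then i else j))
      (cs.wordProd (alternatingWord i j l))
    rw [← h1] at h2
    have h3 := cs.length_wordProd_le (alternatingWord i j l)
    rw [length_alternatingWord] at h3
    omega
  have hvi : ¬ cs.IsRightDescent v i := by
    by_cases he : Even k
    · simpa [he] using hd
    · simpa [he] using hc
  have hvj : ¬ cs.IsRightDescent v j := by
    by_cases he : Even k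
    · simpa [he] using hc
    · simpa [he] using hd
  have hkM : M i j ≠ 0 → k + 1 ≤ M i j := by
    intro hM
    by_contra hlt
    have h1 := cs.not_isReduced_alternatingWord j i (m := k + 1)
      (by rwa [M.symmetric]) (by rw [M.symmetric j i]; omega)
    apply h1
    unfold IsReduced
    refine le_antisymm (cs.length_wordProd_le _) ?_
    have h2 : w * cs.simple i = v * cs.wordProd (alternatingWord j i (k + 1)) := by
      rw [alternatingWord_succ, wordProd_concat, hv, mul_assoc]
    have h3 := cs.length_mul_le v (cs.wordProd (alternatingWord j i (k + 1)))
    rw [← h2] at h3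
    rw [cs.not_isRightDescent_iff] at hi
    rw [length_alternatingWord]
    omega
  rw [hv, geomRep_mul_apply, geomRep_alternatingWord, map_add, map_smul, map_smul]
  have hM1 := M.off_diagonal i j hij
  have c1 := dihedralCoeff_nonneg (n := k) hM1 (fun h => by have := hkM h; omega)
  have c2 := dihedralCoeff_nonneg (n := k + 1) hM1 hkM
  have p1 := ih (cs.length v) (by omega) v rfl i hvi
  have p2 := ih (cs.length v) (by omega) v rfl j hvj
  refine add_nonneg (smul_nonneg ?_ p1) (smul_nonneg ?_ p2) <;> split_ifs <;> assumption

/-- `a` is a root with associated reflection `t`. -/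
def RootRefl (a : B →₀ ℝ) (t : W) : Prop :=
  ∃ w i, a = cs.geomRep w (simpleRoot i) ∧ t = w * cs.simple i * w⁻¹

variable {cs}

lemma rootRefl_simple (i : B) : cs.RootRefl (simpleRoot i) (cs.simple i) :=
  ⟨1, i, by simp, by simp⟩

lemma RootRefl.conj {a : B →₀ ℝ} {t : W} (h : cs.RootRefl a t) (w : W) :
    cs.RootRefl (cs.geomRep w a) (w * t * w⁻¹) := by
  obtain ⟨v, i, rfl, rfl⟩ := h
  exact ⟨w * v, i, by rw [geomRep_mul_apply], by group⟩

lemma RootRefl.neg {a : B →₀ ℝ} {t : W} (h : cs.RootRefl a t) : cs.RootRefl (-a) t := by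
  obtain ⟨v, i, rfl, rfl⟩ := h
  refine ⟨v * cs.simple i, i, ?_, by simp [mul_assoc]⟩
  rw [geomRep_mul_apply, geomRep_simple, M.geomRefl_self _ (M.geomForm_simple_self i), map_neg]

lemma RootRefl.form_self {a : B →₀ ℝ} {t : W} (h : cs.RootRefl a t) : M.geomForm a a = 2 := by
  obtain ⟨v, i, rfl, rfl⟩ := h
  rw [geomForm_geomRep, geomForm_simple_self]

lemma RootRefl.ne_zero {a : B →₀ ℝ} {t : W} (h : cs.RootRefl a t) : a ≠ 0 := by
  rintro rfl
  have := h.form_self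
  simp at this

lemma RootRefl.geomRep_apply {a : B →₀ ℝ} {t : W} (h : cs.RootRefl a t) (v : B →₀ ℝ) :
    cs.geomRep t v = v - M.geomForm v a • a := by
  obtain ⟨w, i, rfl, rfl⟩ := h
  rw [geomRep_mul_apply, geomRep_mul_apply, geomRep_simple, geomRefl_apply, map_sub, map_smul,
    geomRep_apply_inv_self]
  conv_lhs => rw [← cs.geomForm_geomRep w, geomRep_apply_inv_self]

lemma RootRefl.geomRep_self {a : B →₀ ℝ} {t : W} (h : cs.RootRefl a t) :
    cs.geomRep t a = -a := by
  rw [h.geomRep_apply, h.form_self]; module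

lemma RootRefl.mul_self {a : B →₀ ℝ} {t : W} (h : cs.RootRefl a t) : t * t = 1 := by
  obtain ⟨w, i, rfl, rfl⟩ := h
  simp [mul_assoc]

lemma RootRefl.inv {a : B →₀ ℝ} {t : W} (h : cs.RootRefl a t) : t⁻¹ = t :=
  inv_eq_of_mul_eq_one_left h.mul_self

lemma geomRep_simpleRoot_nonpos {w : W} {i : B} (h : cs.IsRightDescent w i) :
    cs.geomRep w (simpleRoot i) ≤ 0 := by
  have h1 := cs.geomRep_nonneg _ (w * cs.simple i) rfl i (by
    rwa [← cs.isRightDescent_iff_not_isRightDescent_mul])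
  rw [geomRep_mul_apply, geomRep_simple, M.geomRefl_self _ (M.geomForm_simple_self i),
    map_neg] at h1
  exact neg_nonneg.1 h1

lemma RootRefl.nonneg_or_nonpos {a : B →₀ ℝ} {t : W} (h : cs.RootRefl a t) : 0 ≤ a ∨ a ≤ 0 := by
  obtain ⟨w, i, rfl, rfl⟩ := h
  by_cases hd : cs.IsRightDescent w i
  · exact Or.inr (geomRep_simpleRoot_nonpos hd)
  · exact Or.inl (cs.geomRep_nonneg _ w rfl i hd)

lemma RootRefl.not_nonpos {a : B →₀ ℝ} {t : W} (h : cs.RootRefl a t) (ha : 0 ≤ a) : ¬ a ≤ 0 :=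
  fun h' => h.ne_zero (le_antisymm h' ha)

lemma RootRefl.nonneg_of_apply_pos {a : B →₀ ℝ} {t : W} (h : cs.RootRefl a t) {i : B}
    (hi : 0 < a i) : 0 ≤ a :=
  h.nonneg_or_nonpos.resolve_right fun h' => absurd (h' i) (not_le.2 hi)

lemma geomRep_injective : Function.Injective cs.geomRep := by
  rw [injective_iff_map_eq_one]
  intro w hw
  by_contra hw1
  obtain ⟨i, hi⟩ := cs.exists_rightDescent_of_ne_one hw1
  have := geomRep_simpleRoot_nonpos hi
  rw [hw, Module.End.one_apply] at this
  exact simpleRoot_ne_zero i (le_antisymm this (simpleRoot_nonneg i))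

lemma RootRefl.refl_unique {a : B →₀ ℝ} {t t' : W} (h : cs.RootRefl a t) (h' : cs.RootRefl a t') :
    t = t' :=
  geomRep_injective (LinearMap.ext fun v => by rw [h.geomRep_apply, h'.geomRep_apply])

lemma eq_of_smul_nonneg {a b : B →₀ ℝ} {t t' : W} (h : cs.RootRefl a t) (h' : cs.RootRefl b t')
    {c : ℝ} (hc : a = c • b) (hc0 : 0 ≤ c) : a = b := by
  have h1 := h.form_self
  rw [hc] at h1
  simp only [map_smul, LinearMap.smul_apply, h'.form_self, smul_eq_mul] at h1
  have : c = 1 := by nlinarith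
  rw [hc, this, one_smul]

lemma RootRefl.eq_or_neg {a b : B →₀ ℝ} {t : W} (h : cs.RootRefl a t) (h' : cs.RootRefl b t) :
    a = b ∨ a = -b := by
  have h1 := h.geomRep_self
  rw [h'.geomRep_apply] at h1
  have h2 : a = (M.geomForm a b / 2) • b := by
    have : (2 : ℝ) • a = M.geomForm a b • b := by
      rw [two_smul]
      nth_rw 2 [← neg_neg a]
      rw [← h1]; abel
    rw [div_eq_inv_mul, mul_smul, ← this, smul_smul]; norm_num
  rcases le_total 0 (M.geomForm a b / 2) with hc | hc
  · exact Or.inl (eq_of_smul_nonneg h h' h2 hc)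
  · refine Or.inr (eq_of_smul_nonneg h h'.neg (c := -(M.geomForm a b / 2)) ?_ (by linarith))
    nth_rw 1 [h2]; module

lemma RootRefl.eq_of_nonneg {a b : B →₀ ℝ} {t : W} (h : cs.RootRefl a t) (h' : cs.RootRefl b t)
    (ha : 0 ≤ a) (hb : 0 ≤ b) : a = b :=
  (h.eq_or_neg h').resolve_right fun e => h.not_nonpos ha (by rw [e]; exact neg_nonpos.2 hb)

lemma geomRep_simple_apply_of_ne {i j : B} (hij : j ≠ i) (v : B →₀ ℝ) :
    cs.geomRep (cs.simple i) v j = v j := by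
  rw [geomRep_simple, geomRefl_apply]
  simp [simpleRoot, Ne.symm hij]

lemma RootRefl.eq_simpleRoot {a : B →₀ ℝ} {t : W} (h : cs.RootRefl a t) (ha : 0 ≤ a) {i : B}
    (hs : ∀ j, j ≠ i → a j = 0) : a = simpleRoot i := by
  refine eq_of_smul_nonneg h (rootRefl_simple (cs := cs) i) (c := a i) ?_ (ha i)
  ext j
  by_cases hj : j = i
  · subst hj; simp [simpleRoot]
  · simp [simpleRoot, hs j hj, Ne.symm hj]

lemma RootRefl.geomRep_simple_nonneg {a : B →₀ ℝ} {t : W} (h : cs.RootRefl a t) (ha : 0 ≤ a)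
    {i : B} (hne : a ≠ simpleRoot i) : 0 ≤ cs.geomRep (cs.simple i) a := by
  by_contra hn
  apply hne
  refine h.eq_simpleRoot ha fun j hj => ?_
  by_contra h0
  refine hn ((h.conj (cs.simple i)).nonneg_of_apply_pos (i := j) ?_)
  rw [geomRep_simple_apply_of_ne hj]
  exact lt_of_le_of_ne (ha j) (Ne.symm h0)

theorem RootRefl.length_mul_lt_of_nonpos {a : B →₀ ℝ} {t : W} (h : cs.RootRefl a t) (ha : 0 ≤ a)
    {w : W} (hw : cs.geomRep w⁻¹ a ≤ 0) : cs.length (t * w) < cs.length w := by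
  obtain ⟨n, hn⟩ : ∃ n, cs.length w = n := ⟨_, rfl⟩
  induction n generalizing w a t with
  | zero =>
    rw [cs.length_eq_zero_iff] at hn
    subst hn
    rw [inv_one, geomRep_one_apply] at hw
    exact absurd hw (h.not_nonpos ha)
  | succ n ih =>
    have hw1 : w ≠ 1 := by rintro rfl; simp at hn
    obtain ⟨i, hi⟩ := cs.exists_leftDescent_of_ne_one hw1
    rw [cs.isLeftDescent_iff] at hi
    by_cases hai : a = simpleRoot i
    · rw [h.refl_unique (hai ▸ rootRefl_simple i)]
      omega
    · have h1 := h.geomRep_simple_nonneg ha hai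
      have h2 := h.conj (cs.simple i)
      have h3 := ih h2 h1 (w := cs.simple i * w) (by
        rw [← geomRep_mul_apply]; simpa [mul_assoc] using hw) (by omega)
      have h4 : t * w = cs.simple i * (cs.simple i * t * (cs.simple i)⁻¹ * (cs.simple i * w)) := by
        simp [mul_assoc]
      have h5 := cs.length_mul_le (cs.simple i)
        (cs.simple i * t * (cs.simple i)⁻¹ * (cs.simple i * w))
      rw [← h4, cs.length_simple] at h5
      omega

theorem RootRefl.length_lt_mul_of_nonneg {a : B →₀ ℝ} {t : W} (h : cs.RootRefl a t) (ha : 0 ≤ a)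
    {w : W} (hw : 0 ≤ cs.geomRep w⁻¹ a) : cs.length w < cs.length (t * w) := by
  have := h.length_mul_lt_of_nonpos ha (w := t * w) (by
    rw [mul_inv_rev, geomRep_mul_apply, h.inv, h.geomRep_self, map_neg]
    exact neg_nonpos.2 hw)
  rwa [← mul_assoc, h.mul_self, one_mul] at this

end CoxeterSystem

namespace CoxeterSystem

open CoxeterMatrix

variable {B W : Type*} [Group W] {M : CoxeterMatrix B} {cs : CoxeterSystem M W} {J : Set B}

lemma geomRep_apply_of_mem_closure {h : W} (hh : h ∈ Subgroup.closure (cs.simple '' J)) {i : B}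
    (hi : i ∉ J) (v : B →₀ ℝ) : cs.geomRep h v i = v i := by
  induction hh using Subgroup.closure_induction generalizing v with
  | mem x hx =>
    obtain ⟨j, hj, rfl⟩ := hx
    exact geomRep_simple_apply_of_ne (by rintro rfl; exact hi hj) v
  | one => rw [geomRep_one_apply]
  | mul x y _ _ hx hy => rw [geomRep_mul_apply, hx, hy]
  | inv x _ hx => rw [← hx, geomRep_apply_inv_self]

lemma geomForm_eq_sum (v a : B →₀ ℝ) :
    M.geomForm v a = a.sum fun j c => c * M.geomForm v (simpleRoot j) := by
  conv_lhs => rw [← Finsupp.sum_single a]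
  rw [Finsupp.sum, map_sum]
  refine Finset.sum_congr rfl fun j _ => ?_
  have : Finsupp.single j (a j) = a j • (simpleRoot j : B →₀ ℝ) := by simp [simpleRoot]
  rw [this, map_smul, smul_eq_mul]

lemma RootRefl.exists_form_pos {a : B →₀ ℝ} {t : W} (h : cs.RootRefl a t) (ha : 0 ≤ a) :
    ∃ j, 0 < a j ∧ 0 < M.geomForm a (simpleRoot j) := by
  by_contra! hn
  have h1 := h.form_self
  rw [geomForm_eq_sum] at h1
  have : (a.sum fun j c => c * M.geomForm a (simpleRoot j)) ≤ 0 :=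
    Finset.sum_nonpos fun j _ => by
      rcases (ha j).eq_or_lt with h0 | h0
      · rw [← h0]; simp
      · exact mul_nonpos_of_nonneg_of_nonpos h0.le (hn j h0)
  linarith

lemma geomRep_inv_simpleRoot_nonneg {w : W} {i : B}
    (h : cs.length w < cs.length (cs.simple i * w)) : 0 ≤ cs.geomRep w⁻¹ (simpleRoot i) := by
  refine cs.geomRep_nonneg _ w⁻¹ rfl i ?_
  rw [cs.not_isRightDescent_iff, ← cs.inv_simple i, ← mul_inv_rev, cs.length_inv, cs.length_inv]
  have := cs.length_simple_mul w i
  omega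

lemma RootRefl.mem_closure {a : B →₀ ℝ} {t : W} (h : cs.RootRefl a t) (ha : 0 ≤ a)
    (hJ : ∀ i, i ∉ J → a i = 0) : t ∈ Subgroup.closure (cs.simple '' J) := by
  obtain ⟨n, hn⟩ : ∃ n, cs.length t = n := ⟨_, rfl⟩
  induction n using Nat.strong_induction_on generalizing a t with
  | _ n ih =>
  obtain ⟨j, hj, hf⟩ := h.exists_form_pos ha
  have hjJ : j ∈ J := by
    by_contra hj'
    exact hj.ne' (hJ j hj')
  have hs : cs.simple j ∈ Subgroup.closure (cs.simple '' J) :=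
    Subgroup.subset_closure ⟨j, hjJ, rfl⟩
  by_cases haj : a = simpleRoot j
  · rwa [h.refl_unique (haj ▸ rootRefl_simple j)]
  obtain ⟨k, hkj, hk⟩ : ∃ k, k ≠ j ∧ 0 < a k := by
    by_contra! hn
    exact haj (h.eq_simpleRoot ha fun k hk => le_antisymm (hn k hk) (ha k))
  have hneg : cs.geomRep t (simpleRoot j) k < 0 := by
    rw [h.geomRep_apply, geomForm_comm]
    have h0 : (simpleRoot j : B →₀ ℝ) k = 0 := Finsupp.single_eq_of_ne hkj
    simp only [Finsupp.coe_sub, Pi.sub_apply, Finsupp.coe_smul, Pi.smul_apply, smul_eq_mul, h0]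
    nlinarith
  have h1 : cs.length (cs.simple j * t) < cs.length t := by
    refine (rootRefl_simple j).length_mul_lt_of_nonpos (simpleRoot_nonneg j) ?_
    rw [h.inv]
    refine ((rootRefl_simple j).conj t).nonneg_or_nonpos.resolve_left fun h0 => ?_
    exact absurd (h0 k) (not_le.2 hneg)
  have h2 : cs.length (cs.simple j * t * cs.simple j) < cs.length (cs.simple j * t) := by
    by_contra hd
    have := cs.geomRep_nonneg _ (cs.simple j * t) rfl j hd k
    rw [geomRep_mul_apply, geomRep_simple_apply_of_ne hkj] at this
    exact absurd this (not_le.2 hneg)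
  have h3 := ih (cs.length (cs.simple j * t * cs.simple j)) (by omega)
    (by simpa using h.conj (cs.simple j)) (h.geomRep_simple_nonneg ha haj)
    (fun i hi => by rw [geomRep_apply_of_mem_closure hs hi, hJ i hi]) rfl
  have h4 := mul_mem (mul_mem hs h3) hs
  simpa [mul_assoc] using h4

lemma geomRep_inv_nonneg_of_minimal {m : W}
    (hm : ∀ i ∈ J, cs.length (cs.simple i * m) > cs.length m) {a : B →₀ ℝ} (ha : 0 ≤ a)
    (hJ : ∀ i, i ∉ J → a i = 0) : 0 ≤ cs.geomRep m⁻¹ a := by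
  rw [← Finsupp.sum_single a, Finsupp.sum, map_sum]
  refine Finset.sum_nonneg fun j hj => ?_
  have : Finsupp.single j (a j) = a j • (simpleRoot j : B →₀ ℝ) := by simp [simpleRoot]
  rw [this, map_smul]
  refine smul_nonneg (ha j) (geomRep_inv_simpleRoot_nonneg (hm j ?_))
  by_contra h
  exact (Finsupp.mem_support_iff.1 hj) (hJ j h)

/-- The positive system obtained from the standard one by negating the roots supported
on `J`. -/
def TwistedPos (J : Set B) (a : B →₀ ℝ) : Prop :=
  (∃ i, i ∉ J ∧ 0 < a i) ∨ a ≤ 0 ∧ ∀ i, i ∉ J → a i = 0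

lemma RootRefl.twistedPos_or {a : B →₀ ℝ} {t : W} (h : cs.RootRefl a t) (J : Set B) :
    TwistedPos J a ∨ TwistedPos J (-a) := by
  by_cases hJ : ∀ i, i ∉ J → a i = 0
  · rcases h.nonneg_or_nonpos with h' | h'
    · exact Or.inr (Or.inr ⟨neg_nonpos.2 h', fun i hi => by simp [hJ i hi]⟩)
    · exact Or.inl (Or.inr ⟨h', hJ⟩)
  · push Not at hJ
    obtain ⟨i, hi, h0⟩ := hJ
    rcases lt_or_gt_of_ne h0 with h' | h'
    · exact Or.inr (Or.inl ⟨i, hi, by simpa using h'⟩)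
    · exact Or.inl (Or.inl ⟨i, hi, h'⟩)

lemma RootRefl.not_twistedPos_neg {a : B →₀ ℝ} {t : W} (h : cs.RootRefl a t)
    (ha : TwistedPos J a) : ¬ TwistedPos J (-a) := by
  rintro (⟨i, hi, h1⟩ | ⟨h1, h2⟩)
  · rcases ha with ⟨j, hj, h3⟩ | ⟨h3, h4⟩
    · exact absurd (h.neg.nonneg_of_apply_pos h1 j) (by simpa using h3)
    · rw [Finsupp.neg_apply, h4 i hi] at h1; simp at h1
  · rcases ha with ⟨j, hj, h3⟩ | ⟨h3, h4⟩
    · have := h2 j hj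
      rw [Finsupp.neg_apply] at this; linarith
    · exact h.ne_zero (le_antisymm h3 (neg_nonpos.1 h1))

end CoxeterSystem

section SlopeLabel

variable {B : Type*} [LinearOrder B]

lemma toLex_smul_pos_iff {c : ℝ} (hc : 0 < c) (x : B →₀ ℝ) :
    0 < toLex (c • x) ↔ 0 < toLex x := by
  have key : ∀ {c : ℝ} (_ : 0 < c) (x : B →₀ ℝ), 0 < toLex x → 0 < toLex (c • x) := by
    intro c hc x h
    rw [Finsupp.Lex.lt_iff] at h ⊢
    obtain ⟨i, h1, h2⟩ := h
    refine ⟨i, fun j hj => ?_, ?_⟩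
    · have := h1 j hj
      simp only [Finsupp.coe_zero, Pi.zero_apply, ofLex_toLex, ofLex_zero, Finsupp.coe_smul,
        Pi.smul_apply, smul_eq_mul] at this ⊢
      rw [← this, mul_zero]
    · simp only [Finsupp.coe_zero, Pi.zero_apply, ofLex_toLex, ofLex_zero, Finsupp.coe_smul,
        Pi.smul_apply, smul_eq_mul] at h2 ⊢
      positivity
  refine ⟨fun h => ?_, key hc x⟩
  have := key (inv_pos.2 hc) _ h
  rwa [smul_smul, inv_mul_cancel₀ hc.ne', one_smul] at this

lemma toLex_lt_iff_sub_pos (x y : B →₀ ℝ) : toLex x < toLex y ↔ 0 < toLex (y - x) := by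
  rw [toLex_sub, sub_pos]

variable (f g : (B →₀ ℝ) →ₗ[ℝ] ℝ)

/-- The slope of a vector with respect to the lexicographic pair of functionals `(f, -g)`. -/
noncomputable def slopeLabel (v : B →₀ ℝ) : Bool ×ₗ Lex (B →₀ ℝ) :=
  toLex (if f v = 0 then (true, toLex ((g v)⁻¹ • v)) else (false, toLex (-((f v)⁻¹ • v))))

/-- Vectors which are positive for the lexicographic pair of functionals `(f, -g)`. -/
def SlopePos (v : B →₀ ℝ) : Prop := 0 < f v ∨ f v = 0 ∧ g v < 0 ∧ 0 < toLex (-v)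

variable {f g}

lemma slopeLabel_lt_iff {u v : B →₀ ℝ} (hu : SlopePos f g u) (hv : SlopePos f g v) :
    slopeLabel f g u < slopeLabel f g v ↔ 0 < toLex (f v • u - f u • v) ∨
      f v • u - f u • v = 0 ∧ 0 < toLex (g u • v - g v • u) := by
  unfold slopeLabel
  rcases hu with hu | ⟨hu, hu1, hu2⟩ <;> rcases hv with hv | ⟨hv, hv1, hv2⟩
  · rw [if_neg hu.ne', if_neg hv.ne', Prod.Lex.toLex_lt_toLex]
    simp only [lt_self_iff_false, false_or, true_and]
    rw [toLex_lt_iff_sub_pos, ← toLex_smul_pos_iff (mul_pos hu hv)]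
    have : (f u * f v) • (-((f v)⁻¹ • v) - -((f u)⁻¹ • u)) = f v • u - f u • v := by
      rw [smul_sub, smul_neg, smul_neg, smul_smul, smul_smul]
      rw [mul_assoc, mul_inv_cancel₀ hv.ne', mul_comm (f u) (f v), mul_assoc,
        mul_inv_cancel₀ hu.ne']
      module
    rw [this]
    refine ⟨Or.inl, fun h => h.resolve_right ?_⟩
    rintro ⟨h1, h2⟩
    have h3 : u = (f u * (f v)⁻¹) • v := by
      have : (f v)⁻¹ • (f v • u) = (f v)⁻¹ • (f u • v) := by rw [sub_eq_zero.1 h1]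
      rw [smul_smul, inv_mul_cancel₀ hv.ne', one_smul, smul_smul] at this
      rw [mul_comm, ← this]
    have h4 : g u • v - g v • u = 0 := by
      rw [h3]; simp only [map_smul, smul_eq_mul]; module
    rw [h4] at h2
    exact lt_irrefl _ h2
  · rw [if_neg hu.ne', if_pos hv, Prod.Lex.toLex_lt_toLex]
    simp only [Bool.false_lt_true, true_or, true_iff]
    left
    rw [hv, zero_smul, zero_sub, ← smul_neg, toLex_smul_pos_iff hu]
    exact hv2
  · rw [if_pos hu, if_neg hv.ne', Prod.Lex.toLex_lt_toLex]
    rw [hu, zero_smul, sub_zero]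
    have h1 : ¬ 0 < toLex (f v • u) := by
      rw [toLex_smul_pos_iff hv]
      rw [toLex_neg, neg_pos] at hu2
      exact hu2.not_gt
    have h2 : f v • u ≠ 0 := by
      intro h
      rw [← toLex_smul_pos_iff hv, smul_neg, h] at hu2
      simp at hu2
    simp only [h1, h2, false_and, or_false, iff_false]
    simp
  · rw [if_pos hu, if_pos hv, Prod.Lex.toLex_lt_toLex, hu, hv]
    simp only [lt_self_iff_false, false_or, true_and, zero_smul, sub_zero, toLex_zero]
    rw [toLex_lt_iff_sub_pos, ← toLex_smul_pos_iff (mul_pos_of_neg_of_neg hu1 hv1)]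
    have : (g u * g v) • ((g v)⁻¹ • v - (g u)⁻¹ • u) = g u • v - g v • u := by
      rw [smul_sub, smul_smul, smul_smul, mul_assoc, mul_inv_cancel₀ hv1.ne,
        mul_comm (g u) (g v), mul_assoc, mul_inv_cancel₀ hu1.ne]
      module
    rw [this]

lemma slopeLabel_orient {u v u' v' : B →₀ ℝ} (hu : SlopePos f g u) (hv : SlopePos f g v)
    (hu' : SlopePos f g u') (hv' : SlopePos f g v') {x y z w : ℝ}
    (h1 : u' = x • u + y • v) (h2 : v' = z • u + w • v) (h3 : 0 < x * w - y * z)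
    (h : slopeLabel f g u < slopeLabel f g v) : slopeLabel f g u' < slopeLabel f g v' := by
  rw [slopeLabel_lt_iff hu hv] at h
  rw [slopeLabel_lt_iff hu' hv']
  have e1 : f v' • u' - f u' • v' = (x * w - y * z) • (f v • u - f u • v) := by
    rw [h1, h2]; simp only [map_add, map_smul, smul_eq_mul]; module
  have e2 : g u' • v' - g v' • u' = (x * w - y * z) • (g u • v - g v • u) := by
    rw [h1, h2]; simp only [map_add, map_smul, smul_eq_mul]; module
  rw [e1, e2, toLex_smul_pos_iff h3, toLex_smul_pos_iff h3, smul_eq_zero_iff_right h3.ne']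
  exact h

lemma exists_smul_of_slopeLabel_eq {u v : B →₀ ℝ} (hu : SlopePos f g u) (hv : SlopePos f g v)
    (h : slopeLabel f g u = slopeLabel f g v) : ∃ c : ℝ, 0 ≤ c ∧ u = c • v := by
  unfold slopeLabel at h
  rcases hu with hu | ⟨hu, hu1, hu2⟩ <;> rcases hv with hv | ⟨hv, hv1, hv2⟩
  · rw [if_neg hu.ne', if_neg hv.ne'] at h
    have h1 : (f u)⁻¹ • u = (f v)⁻¹ • v :=
      neg_injective (toLex.injective (congrArg Prod.snd (toLex.injective h)))
    refine ⟨f u * (f v)⁻¹, by positivity, ?_⟩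
    rw [mul_smul, ← h1, smul_smul, mul_inv_cancel₀ hu.ne', one_smul]
  · rw [if_neg hu.ne', if_pos hv] at h
    exact absurd (congrArg Prod.fst (toLex.injective h)) (by simp)
  · rw [if_pos hu, if_neg hv.ne'] at h
    exact absurd (congrArg Prod.fst (toLex.injective h)) (by simp)
  · rw [if_pos hu, if_pos hv] at h
    have h1 : (g u)⁻¹ • u = (g v)⁻¹ • v :=
      toLex.injective (congrArg Prod.snd (toLex.injective h))
    refine ⟨g u * (g v)⁻¹, (mul_pos_of_neg_of_neg hu1 (inv_lt_zero.2 hv1)).le, ?_⟩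
    rw [mul_smul, ← h1, smul_smul, mul_inv_cancel₀ hu1.ne, one_smul]

end SlopeLabel

namespace CoxeterSystem

variable {B W : Type*} [Group W] {M : CoxeterMatrix B} {cs : CoxeterSystem M W}

/-- The sum of the coordinates lying in `A`. -/
noncomputable def coordSum (A : Set B) : (B →₀ ℝ) →ₗ[ℝ] ℝ :=
  Finsupp.linearCombination ℝ (A.indicator 1)

lemma coordSum_apply (A : Set B) (v : B →₀ ℝ) :
    coordSum A v = ∑ i ∈ v.support, v i * A.indicator 1 i := rfl

lemma coordSum_pos {A : Set B} {v : B →₀ ℝ} (hv : 0 ≤ v) {i : B} (hi : i ∈ A) (h : 0 < v i) :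
    0 < coordSum A v := by
  rw [coordSum_apply]
  refine Finset.sum_pos' (fun j _ => mul_nonneg (hv j) (Set.indicator_nonneg (by simp) j))
    ⟨i, by simpa using h.ne', ?_⟩
  simpa [Set.indicator_of_mem hi] using h

lemma coordSum_eq_zero {A : Set B} {v : B →₀ ℝ} (h : ∀ i ∈ A, v i = 0) : coordSum A v = 0 := by
  rw [coordSum_apply]
  refine Finset.sum_eq_zero fun i _ => ?_
  by_cases hi : i ∈ A
  · rw [h i hi, zero_mul]
  · rw [Set.indicator_of_notMem hi, mul_zero]

lemma RootRefl.slopePos [LinearOrder B] {J : Set B} {a : B →₀ ℝ} {t : W} (h : cs.RootRefl a t)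
    (ha : TwistedPos J a) : SlopePos (coordSum Jᶜ) (coordSum J) a := by
  rcases ha with ⟨i, hi, h1⟩ | ⟨h1, h2⟩
  · exact Or.inl (coordSum_pos (h.nonneg_of_apply_pos h1) hi h1)
  · refine Or.inr ⟨coordSum_eq_zero h2, ?_, ?_⟩
    · obtain ⟨i, hi⟩ : ∃ i, a i ≠ 0 := by
        by_contra! h0
        exact h.ne_zero (Finsupp.ext h0)
      have hiJ : i ∈ J := by
        by_contra h'
        exact hi (h2 i h')
      have := coordSum_pos (A := J) (neg_nonneg.2 h1) hiJ (i := i)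
        (by simpa using lt_of_le_of_ne (h1 i) hi)
      rw [map_neg] at this
      linarith
    · have h3 : toLex (0 : B →₀ ℝ) ≤ toLex (-a) := Finsupp.toLex_monotone (neg_nonneg.2 h1)
      exact lt_of_le_of_ne h3 fun e => h.neg.ne_zero (toLex.injective e).symm

end CoxeterSystem

namespace CoxeterSystem

open CoxeterMatrix

variable {B W : Type*} [Group W] {M : CoxeterMatrix B}

/-- The maps `wJ` and `Jw` give the factorization `w = wJ w * Jw w` with respect to the
parabolic subgroup generated by `J`. -/
structure IsParabolicFactorization (cs : CoxeterSystem M W) (J : Set B) (wJ Jw : W → W) :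
    Prop where
  mem : ∀ w, wJ w ∈ Subgroup.closure (cs.simple '' J)
  min : ∀ w, ∀ i ∈ J, cs.length (cs.simple i * Jw w) > cs.length (Jw w)
  fac : ∀ w, w = wJ w * Jw w
  len : ∀ w, cs.length w = cs.length (wJ w) + cs.length (Jw w)
  uniq : ∀ w a b, a ∈ Subgroup.closure (cs.simple '' J) →
    (∀ i ∈ J, cs.length (cs.simple i * b) > cs.length b) → w = a * b → a = wJ w ∧ b = Jw w

namespace IsParabolicFactorization

variable {cs : CoxeterSystem M W} {J : Set B} {wJ Jw : W → W}
  (F : cs.IsParabolicFactorization J wJ Jw)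
include F

lemma length_mul {h m : W} (hh : h ∈ Subgroup.closure (cs.simple '' J))
    (hm : ∀ i ∈ J, cs.length (cs.simple i * m) > cs.length m) :
    cs.length (h * m) = cs.length h + cs.length m := by
  obtain ⟨h1, h2⟩ := F.uniq (h * m) h m hh hm rfl
  have := F.len (h * m)
  rwa [← h1, ← h2] at this

lemma right_cases (w : W) (i : B) :
    (Jw (w * cs.simple i) = Jw w * cs.simple i ∧ wJ (w * cs.simple i) = wJ w) ∨
      ∃ j ∈ J, Jw w * cs.simple i = cs.simple j * Jw w ∧ Jw (w * cs.simple i) = Jw w ∧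
        wJ (w * cs.simple i) = wJ w * cs.simple j := by
  by_cases hm : ∀ j ∈ J, cs.length (cs.simple j * (Jw w * cs.simple i)) >
      cs.length (Jw w * cs.simple i)
  · left
    obtain ⟨h1, h2⟩ := F.uniq (w * cs.simple i) (wJ w) (Jw w * cs.simple i) (F.mem w) hm (by
      conv_lhs => rw [F.fac w]
      rw [mul_assoc])
    exact ⟨h2.symm, h1.symm⟩
  · right
    push Not at hm
    obtain ⟨j, hj, hl⟩ := hm
    have hlt : cs.length (cs.simple j * (Jw w * cs.simple i)) < cs.length (Jw w * cs.simple i) := by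
      have := cs.length_simple_mul (Jw w * cs.simple i) j
      omega
    have h1 : 0 ≤ cs.geomRep (Jw w)⁻¹ (simpleRoot j) :=
      geomRep_inv_simpleRoot_nonneg (F.min w j hj)
    have hroot := (rootRefl_simple (cs := cs) j).conj (Jw w)⁻¹
    have h2 : cs.geomRep (Jw w)⁻¹ (simpleRoot j) = simpleRoot i := by
      by_contra hne
      have h3 := hroot.geomRep_simple_nonneg h1 hne
      have h4 := (rootRefl_simple (cs := cs) j).length_lt_mul_of_nonneg (simpleRoot_nonneg j)
        (w := Jw w * cs.simple i) (by
          rw [mul_inv_rev, geomRep_mul_apply, cs.inv_simple]; exact h3)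
      omega
    have h3 : cs.simple i = (Jw w)⁻¹ * cs.simple j * Jw w := by
      rw [h2] at hroot
      simpa using (rootRefl_simple i).refl_unique hroot
    have h4 : Jw w * cs.simple i = cs.simple j * Jw w := by rw [h3]; group
    obtain ⟨h5, h6⟩ := F.uniq (w * cs.simple i) (wJ w * cs.simple j) (Jw w)
      (mul_mem (F.mem w) (Subgroup.subset_closure ⟨j, hj, rfl⟩)) (F.min w) (by
        conv_lhs => rw [F.fac w]
        rw [mul_assoc, h4, mul_assoc])
    exact ⟨j, hj, h4, h6.symm, h5.symm⟩

end IsParabolicFactorization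

/-- An edge of the `J`-twisted Bruhat graph, labelled by a root. -/
def TwistedEdge (cs : CoxeterSystem M W) (J : Set B) (p : W) (a : B →₀ ℝ) (q : W) : Prop :=
  ∃ t, cs.RootRefl a t ∧ q = t * p ∧ TwistedPos J a ∧ 0 ≤ cs.geomRep p⁻¹ a

variable {cs : CoxeterSystem M W} {J : Set B}

lemma twistedEdge_right_simple {p : W} {i : B}
    (h : TwistedPos J (cs.geomRep p (simpleRoot i))) :
    cs.TwistedEdge J p (cs.geomRep p (simpleRoot i)) (p * cs.simple i) :=
  ⟨p * cs.simple i * p⁻¹, ⟨p, i, rfl, rfl⟩, by group, h, by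
    rw [geomRep_inv_apply_self]; exact simpleRoot_nonneg i⟩

lemma twistedEdge_or (p : W) (i : B) :
    cs.TwistedEdge J p (cs.geomRep p (simpleRoot i)) (p * cs.simple i) ∨
      cs.TwistedEdge J (p * cs.simple i) (-cs.geomRep p (simpleRoot i)) p := by
  have h : cs.RootRefl (cs.geomRep p (simpleRoot i)) (p * cs.simple i * p⁻¹) := ⟨p, i, rfl, rfl⟩
  rcases h.twistedPos_or J with h | h
  · exact Or.inl (twistedEdge_right_simple h)
  · have h1 : -cs.geomRep p (simpleRoot i) = cs.geomRep (p * cs.simple i) (simpleRoot i) := by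
      rw [geomRep_mul_apply, geomRep_simple, M.geomRefl_self _ (M.geomForm_simple_self i), map_neg]
    rw [h1] at h ⊢
    have := twistedEdge_right_simple h
    rw [cs.simple_mul_simple_cancel_right] at this
    exact Or.inr this

lemma TwistedEdge.label_unique {p q : W} {a b : B →₀ ℝ} (h : cs.TwistedEdge J p a q)
    (h' : cs.TwistedEdge J p b q) : a = b := by
  obtain ⟨t, ht, rfl, hp, -⟩ := h
  obtain ⟨t', ht', he, hp', -⟩ := h'
  rw [mul_left_inj] at he
  subst he
  refine (ht.eq_or_neg ht').resolve_right ?_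
  rintro rfl
  exact ht'.not_twistedPos_neg hp' hp

lemma TwistedEdge.label_simple {p : W} {b : B →₀ ℝ} {i : B}
    (h : cs.TwistedEdge J p b (p * cs.simple i)) : b = cs.geomRep p (simpleRoot i) := by
  obtain ⟨t, ht, he, -, h0⟩ := h
  have h1 := ht.conj p⁻¹
  have h2 : p⁻¹ * t * p⁻¹⁻¹ = cs.simple i := by
    rw [inv_inv, mul_assoc, ← he]; group
  rw [h2] at h1
  rw [← h1.eq_of_nonneg (rootRefl_simple i) h0 (simpleRoot_nonneg i), geomRep_apply_inv_self]

lemma TwistedEdge.mul_simple {p q : W} {a : B →₀ ℝ} (h : cs.TwistedEdge J p a q) {i : B}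
    (hne : q ≠ p * cs.simple i) : cs.TwistedEdge J (p * cs.simple i) a (q * cs.simple i) := by
  obtain ⟨t, ht, rfl, hp, h0⟩ := h
  refine ⟨t, ht, by rw [mul_assoc], hp, ?_⟩
  rw [mul_inv_rev, geomRep_mul_apply, cs.inv_simple]
  refine (ht.conj p⁻¹).geomRep_simple_nonneg h0 fun e => hne ?_
  have h1 := ht.conj p⁻¹
  rw [e] at h1
  rw [← h1.refl_unique (rootRefl_simple i)]
  group

lemma IsParabolicFactorization.twistedEdge_lt {wJ Jw : W → W}
    (F : cs.IsParabolicFactorization J wJ Jw) {p q : W} {a : B →₀ ℝ}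
    (h : cs.TwistedEdge J p a q) : (cs.length (Jw p) : ℤ) - cs.length (wJ p) <
      cs.length (Jw q) - cs.length (wJ q) := by
  obtain ⟨t, ht, rfl, hp, h0⟩ := h
  set m := Jw p with hm
  set k := wJ p with hk
  have hpf : p = k * m := F.fac p
  have h0' : 0 ≤ cs.geomRep m⁻¹ (cs.geomRep k⁻¹ a) := by
    rwa [hpf, mul_inv_rev, geomRep_mul_apply] at h0
  have hkm : k⁻¹ ∈ Subgroup.closure (cs.simple '' J) := inv_mem (F.mem p)
  rcases hp with ⟨i, hi, hai⟩ | ⟨ha, hJ⟩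
  · have hb : 0 < cs.geomRep k⁻¹ a i := by rwa [geomRep_apply_of_mem_closure hkm hi]
    have hbt := ht.conj k⁻¹
    set b := cs.geomRep k⁻¹ a with hbdef
    set t' := k⁻¹ * t * k⁻¹⁻¹ with ht'
    set v := wJ (t' * m) with hv
    have hvm : v⁻¹ ∈ Subgroup.closure (cs.simple '' J) := inv_mem (F.mem _)
    obtain ⟨e1, e2⟩ := F.uniq (t * p) (k * v) (Jw (t' * m)) (mul_mem (F.mem p) (F.mem _))
      (F.min _) (by rw [mul_assoc, ← F.fac, hpf, ht']; group)
    rw [← e1, ← e2]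
    have hct := hbt.conj v⁻¹
    have h1 := hct.length_lt_mul_of_nonneg
      (hct.nonneg_of_apply_pos (i := i) (by rwa [geomRep_apply_of_mem_closure hvm hi]))
      (w := v⁻¹ * m) (by
        rw [mul_inv_rev, geomRep_mul_apply, geomRep_inv_apply_self]
        exact h0')
    have h2 : v⁻¹ * t' * v⁻¹⁻¹ * (v⁻¹ * m) = Jw (t' * m) := by
      have := F.fac (t' * m)
      rw [← hv] at this
      rw [inv_inv, mul_assoc, mul_inv_cancel_left, mul_assoc]
      exact inv_mul_eq_iff_eq_mul.2 this
    rw [h2, F.length_mul (m := m) hvm (F.min p), cs.length_inv] at h1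
    have h3 := cs.length_mul_le k v
    omega
  · have htm : t ∈ Subgroup.closure (cs.simple '' J) :=
      ht.neg.mem_closure (neg_nonneg.2 ha) fun i hi => by simp [hJ i hi]
    obtain ⟨e1, e2⟩ := F.uniq (t * p) (t * k) m (mul_mem htm (F.mem p)) (F.min p)
      (by rw [hpf, mul_assoc])
    rw [← e1, ← e2]
    have h1 : cs.length (t * k) < cs.length k := by
      refine ht.neg.length_mul_lt_of_nonpos (neg_nonneg.2 ha) ?_
      rw [map_neg, neg_nonpos]
      refine (ht.conj k⁻¹).nonneg_or_nonpos.resolve_right fun hneg => ?_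
      have h2 := geomRep_inv_nonneg_of_minimal (F.min p) (neg_nonneg.2 hneg) fun i hi => by
        rw [Finsupp.neg_apply, geomRep_apply_of_mem_closure hkm hi, hJ i hi, neg_zero]
      rw [map_neg, neg_nonneg] at h2
      exact ((ht.conj k⁻¹).conj m⁻¹).not_nonpos h0' h2
    omega

/-- The `J`-twisted Bruhat graph of a Coxeter group as an edge system. -/
noncomputable def twistedSystem [LinearOrder B] {wJ Jw : W → W}
    (F : cs.IsParabolicFactorization J wJ Jw) :
    EdgeSystem B W (B →₀ ℝ) (Bool ×ₗ Lex (B →₀ ℝ)) where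
  act i p := p * cs.simple i
  rk p := (cs.length (Jw p) : ℤ) - cs.length (wJ p)
  edge := cs.TwistedEdge J
  form := M.geomForm
  label := slopeLabel (coordSum Jᶜ) (coordSum J)
  act_act i p := cs.simple_mul_simple_cancel_right i
  rk_act i p := by
    rcases F.right_cases p i with ⟨h1, h2⟩ | ⟨j, -, -, h1, h2⟩
    · have := cs.length_mul_simple (Jw p) i
      rw [h1, h2]; omega
    · have := cs.length_mul_simple (wJ p) j
      rw [h1, h2]; omega
  rk_lt h := F.twistedEdge_lt h
  edge_fun h h' := by
    obtain ⟨t, ht, rfl, -⟩ := h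
    obtain ⟨t', ht', rfl, -⟩ := h'
    rw [ht.refl_unique ht']
  edge_cofun h h' := by
    obtain ⟨t, ht, rfl, -⟩ := h
    obtain ⟨t', ht', h1, -⟩ := h'
    rw [ht.refl_unique ht'] at h1
    exact mul_left_cancel h1
  edge_root h h' := h.label_unique h'
  edge_simple {i p} h := by
    rcases twistedEdge_or (cs := cs) (J := J) p i with h' | h'
    · exact ⟨_, h'⟩
    · have := F.twistedEdge_lt h'
      omega
  edge_act i h hne := h.mul_simple hne
  form_comm := M.geomForm_comm
  form_self h := by
    obtain ⟨t, ht, -⟩ := h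
    exact ht.form_self
  simple_up h h1 h2 := by
    rw [h1.label_simple, h2.label_simple]
    obtain ⟨t, ht, rfl, -⟩ := h
    rw [geomRep_mul_apply, ht.geomRep_apply]
  simple_down {i p a q b b'} h1 h h2 := by
    have h3 := TwistedEdge.label_simple (p := p * cs.simple i) (i := i) (b := b)
      (by rwa [cs.simple_mul_simple_cancel_right])
    rw [h2.label_simple, h3]
    obtain ⟨t, ht, rfl, -⟩ := h
    rw [geomRep_mul_apply, geomRep_mul_apply, geomRep_simple,
      M.geomRefl_self _ (M.geomForm_simple_self i), ht.geomRep_apply]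
    simp only [map_neg, LinearMap.neg_apply]
    module
  label_inj h h' he := by
    obtain ⟨t, ht, -, hp, -⟩ := h
    obtain ⟨t', ht', -, hp', -⟩ := h'
    obtain ⟨c, hc, e⟩ := exists_smul_of_slopeLabel_eq (ht.slopePos hp) (ht'.slopePos hp') he
    exact eq_of_smul_nonneg ht ht' e hc
  label_orient h1 h2 h3 h4 x y z w e1 e2 hd hl := by
    obtain ⟨_, _, _, ht1, -, hp1, -⟩ := h1
    obtain ⟨_, _, _, ht2, -, hp2, -⟩ := h2
    obtain ⟨_, _, _, ht3, -, hp3, -⟩ := h3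
    obtain ⟨_, _, _, ht4, -, hp4, -⟩ := h4
    exact slopeLabel_orient (ht1.slopePos hp1) (ht2.slopePos hp2) (ht3.slopePos hp3)
      (ht4.slopePos hp4) e1 e2 hd hl

end CoxeterSystem

namespace EdgeSystem

variable {ι W V Λ : Type*} [AddCommGroup V] [Module ℝ V] [LinearOrder Λ]
  {E : EdgeSystem ι W V Λ}

lemma act_le_act_of_not_desc {i p q} (h : E.le p q) (hq : ¬ E.Desc i q) :
    E.le (E.act i p) (E.act i q) :=
  (lift_left h).elim (fun h => le_trans h (le_act hq)) id

lemma good_of_not_le {p q : W} (h : ¬ E.le p q) : E.Good p q where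
  finite := by
    convert Set.finite_empty
    ext z
    simp only [Set.mem_ofPred_eq, Set.mem_empty_iff_false, iff_false]
    exact fun hz => h (le_trans hz.1 hz.2)
  sat h' := absurd h' h
  diamond h' := absurd h' h
  atomSwap _ _ _ _ hc hcq := absurd (le_trans hc.le hcq) h

lemma good_refl (p : W) : E.Good p p where
  finite := by
    refine (Set.finite_singleton p).subset fun z hz => ?_
    exact le_antisymm hz.2 hz.1
  sat _ := Relation.ReflTransGen.refl
  diamond _ h := by omega
  atomSwap _ _ _ _ hc hcq := by
    have := rk_le hcq
    have := hc.2
    omega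

end EdgeSystem

namespace CoxeterSystem

open CoxeterMatrix

variable {B W : Type*} [Group W] {M : CoxeterMatrix B} {cs : CoxeterSystem M W} {J : Set B}

lemma TwistedEdge.mem_left {p q : W} {a : B →₀ ℝ} (h : cs.TwistedEdge J p a q)
    (hq : q ∈ Subgroup.closure (cs.simple '' J)) :
    p ∈ Subgroup.closure (cs.simple '' J) ∧ a ≤ 0 := by
  obtain ⟨t, ht, rfl, hp, h0⟩ := h
  rcases hp with ⟨i, hi, hai⟩ | ⟨ha, hJ⟩
  · have h1 : cs.geomRep (t * p)⁻¹ a ≤ 0 := by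
      rw [mul_inv_rev, geomRep_mul_apply, ht.inv, ht.geomRep_self, map_neg]
      exact neg_nonpos.2 h0
    have h2 := h1 i
    rw [geomRep_apply_of_mem_closure (inv_mem hq) hi] at h2
    exact absurd h2 (not_le.2 hai)
  · have htm : t ∈ Subgroup.closure (cs.simple '' J) :=
      ht.neg.mem_closure (neg_nonneg.2 ha) fun i hi => by simp [hJ i hi]
    exact ⟨(Subgroup.mul_mem_cancel_left _ htm).1 hq, ha⟩

lemma simple_mem_closure {j : B} (hj : j ∈ J) : cs.simple j ∈ Subgroup.closure (cs.simple '' J) :=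
  Subgroup.subset_closure ⟨j, hj, rfl⟩

lemma exists_right_descent_of_mem {x : W} (hx : x ∈ Subgroup.closure (cs.simple '' J))
    (h1 : x ≠ 1) : ∃ j ∈ J, cs.length (x * cs.simple j) < cs.length x := by
  obtain ⟨i, hi⟩ := cs.exists_rightDescent_of_ne_one h1
  refine ⟨i, ?_, hi⟩
  by_contra hJ
  have h2 := geomRep_simpleRoot_nonpos hi i
  rw [geomRep_apply_of_mem_closure hx hJ] at h2
  simp [simpleRoot] at h2
  linarith

namespace IsParabolicFactorization

variable {wJ Jw : W → W} (F : cs.IsParabolicFactorization J wJ Jw)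
include F

lemma right_of_descent {y : W} {i : B} (hi : cs.IsRightDescent (Jw y) i) :
    Jw (y * cs.simple i) = Jw y * cs.simple i ∧ wJ (y * cs.simple i) = wJ y := by
  rcases F.right_cases y i with h | ⟨j, hj, h, -⟩
  · exact h
  · have h1 := F.min y j hj
    rw [← h] at h1
    exact absurd hi (by unfold IsRightDescent; omega)

lemma of_mul {h m : W} (hh : h ∈ Subgroup.closure (cs.simple '' J))
    (hm : ∀ i ∈ J, cs.length (cs.simple i * m) > cs.length m) :
    wJ (h * m) = h ∧ Jw (h * m) = m := by
  obtain ⟨h1, h2⟩ := F.uniq _ h m hh hm rfl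
  exact ⟨h1.symm, h2.symm⟩

lemma of_mem {y : W} (hy : y ∈ Subgroup.closure (cs.simple '' J)) : wJ y = y ∧ Jw y = 1 := by
  obtain ⟨h1, h2⟩ := F.uniq y y 1 hy (fun i _ => by simp) (by simp)
  exact ⟨h1.symm, h2.symm⟩

lemma mem_of_Jw_eq_one {y : W} (hy : Jw y = 1) : y ∈ Subgroup.closure (cs.simple '' J) := by
  rw [F.fac y, hy, mul_one]
  exact F.mem y

variable [LinearOrder B]

lemma mem_of_le {p q : W} (h : (twistedSystem F).le p q)
    (hq : q ∈ Subgroup.closure (cs.simple '' J)) : p ∈ Subgroup.closure (cs.simple '' J) := by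
  induction h using Relation.ReflTransGen.head_induction_on with
  | refl => exact hq
  | head h _ ih =>
    obtain ⟨a, ha⟩ := h
    exact (TwistedEdge.mem_left ha ih).1

lemma rk_eq_of_mem {x : W} (hx : x ∈ Subgroup.closure (cs.simple '' J)) :
    (twistedSystem F).rk x = - (cs.length x : ℤ) := by
  obtain ⟨h1, h2⟩ := F.of_mem hx
  show (cs.length (Jw x) : ℤ) - cs.length (wJ x) = _
  rw [h1, h2]; simp

lemma dual_good_of_mem (n : ℕ) : ∀ x ∈ Subgroup.closure (cs.simple '' J), cs.length x = n →
    ∀ q ∈ Subgroup.closure (cs.simple '' J), ∀ p, (twistedSystem F).dual.le p x →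
      (twistedSystem F).dual.Good q p := by
  induction n with
  | zero =>
    intro x _ hn q hq p hp
    rw [cs.length_eq_zero_iff] at hn
    subst hn
    by_cases hqp : (twistedSystem F).dual.le q p
    swap
    · exact EdgeSystem.good_of_not_le hqp
    have h1 : ∀ z ∈ Subgroup.closure (cs.simple '' J), (twistedSystem F).dual.le z 1 → z = 1 := by
      intro z hz hle
      refine (EdgeSystem.eq_of_le_of_rk (EdgeSystem.dual_le.1 hle) ?_).symm
      rw [F.rk_eq_of_mem hz, F.rk_eq_of_mem (one_mem _), cs.length_one]
      omega
    rw [h1 p (F.mem_of_le (EdgeSystem.dual_le.1 hqp) hq) hp, h1 q hq (EdgeSystem.le_trans hqp hp)]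
    exact EdgeSystem.good_refl 1
  | succ n ih =>
    intro x hx hn
    obtain ⟨j, hj, hl⟩ := exists_right_descent_of_mem hx (by rintro rfl; simp at hn)
    have hx' := mul_mem hx (simple_mem_closure hj)
    have h2 := ih (x * cs.simple j) hx' (by have := cs.length_mul_simple x j; omega)
    exact EdgeSystem.good_step (E := (twistedSystem F).dual) (i := j)
      (D := {w | w ∈ Subgroup.closure (cs.simple '' J)})
      (fun p hp => mul_mem hp (simple_mem_closure hj)) h2

lemma good_of_mem {p q : W} (hq : q ∈ Subgroup.closure (cs.simple '' J)) :
    (twistedSystem F).Good p q := by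
  by_cases hpq : (twistedSystem F).le p q
  swap
  · exact EdgeSystem.good_of_not_le hpq
  refine EdgeSystem.good_of_dual fun p' q' hp hq' => ?_
  exact F.dual_good_of_mem _ p (F.mem_of_le hpq hq) rfl q' (F.mem_of_le hq' hq) p'
    (EdgeSystem.dual_le.2 hp)

theorem good (p q : W) : (twistedSystem F).Good p q := by
  suffices h : ∀ n, ∀ y, cs.length (Jw y) = n → ∀ p ∈ (Set.univ : Set W),
      ∀ q, (twistedSystem F).le q y → (twistedSystem F).Good p q from
    h _ q rfl p trivial q (EdgeSystem.le_refl q)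
  intro n
  induction n with
  | zero =>
    intro y hn p _ q hq
    rw [cs.length_eq_zero_iff] at hn
    exact F.good_of_mem (F.mem_of_le hq (F.mem_of_Jw_eq_one hn))
  | succ n ih =>
    intro y hn
    obtain ⟨i, hi⟩ := cs.exists_rightDescent_of_ne_one (w := Jw y)
      (by intro h; rw [h] at hn; simp at hn)
    refine EdgeSystem.good_step (i := i) (D := Set.univ) (fun _ _ => Set.mem_univ _) (ih (y * cs.simple i) ?_)
    rw [(F.right_of_descent hi).1]
    have := (cs.isRightDescent_iff).1 hi
    omega

end IsParabolicFactorization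

end CoxeterSystem

namespace CoxeterSystem

open CoxeterMatrix

variable {B W : Type*} [Group W] {M : CoxeterMatrix B} {cs : CoxeterSystem M W}

lemma isParabolicFactorization_empty (cs : CoxeterSystem M W) :
    cs.IsParabolicFactorization ∅ (fun _ => 1) id where
  mem _ := one_mem _
  min _ _ h := absurd h (Set.notMem_empty _)
  fac w := by simp
  len w := by simp
  uniq w a b ha _ h := by
    rw [Set.image_empty, Subgroup.closure_empty, Subgroup.mem_bot] at ha
    subst ha
    simp [h]

lemma IsReduced.concat_iff {ω : List B} {i : B} : cs.IsReduced (ω ++ [i]) ↔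
    cs.IsReduced ω ∧ ¬ cs.IsRightDescent (cs.wordProd ω) i := by
  unfold IsReduced
  have h1 := cs.length_wordProd_le ω
  have h2 := cs.length_mul_simple (cs.wordProd ω) i
  rw [cs.not_isRightDescent_iff, wordProd_append, wordProd_singleton, List.length_append,
    List.length_singleton]
  omega

variable [LinearOrder B]

/-- The Bruhat graph as an edge system. -/
noncomputable def bruhatSystem (cs : CoxeterSystem M W) :
    EdgeSystem B W (B →₀ ℝ) (Bool ×ₗ Lex (B →₀ ℝ)) :=
  twistedSystem cs.isParabolicFactorization_empty

lemma bruhatSystem_rk (w : W) : cs.bruhatSystem.rk w = cs.length w := by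
  show (cs.length w : ℤ) - cs.length 1 = _
  simp

lemma bruhatSystem_act (i : B) (w : W) : cs.bruhatSystem.act i w = w * cs.simple i := rfl

lemma bruhatSystem_desc {i : B} {w : W} : cs.bruhatSystem.Desc i w ↔ cs.IsRightDescent w i := by
  unfold EdgeSystem.Desc IsRightDescent
  rw [bruhatSystem_rk, bruhatSystem_rk, bruhatSystem_act]
  omega

theorem bruhatLE_iff {v w : W} : bruhatLE cs v w ↔ cs.bruhatSystem.le v w := by
  constructor
  · rintro ⟨ω, h1, rfl, ω', h2, h3, rfl⟩
    induction ω using List.reverseRecOn generalizing ω' with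
    | nil =>
      rw [List.sublist_nil.1 h2]
      exact EdgeSystem.le_refl _
    | append_singleton ω i ih =>
      obtain ⟨h4, h5⟩ := IsReduced.concat_iff.1 h1
      rw [← bruhatSystem_desc] at h5
      rw [wordProd_append, wordProd_singleton]
      rw [List.sublist_append_iff] at h2
      obtain ⟨l₁, l₂, rfl, h6, h7⟩ := h2
      rcases List.sublist_singleton.1 h7 with rfl | rfl
      · rw [List.append_nil] at h3 ⊢
        exact EdgeSystem.le_trans (ih h4 l₁ h6 h3) (EdgeSystem.le_act h5)
      · rw [wordProd_append, wordProd_singleton]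
        exact EdgeSystem.act_le_act_of_not_desc (ih h4 l₁ h6 (IsReduced.concat_iff.1 h3).1) h5
  · intro h
    obtain ⟨n, hn⟩ : ∃ n, cs.length w = n := ⟨_, rfl⟩
    induction n generalizing v w with
    | zero =>
      have h1 := EdgeSystem.rk_le h
      rw [bruhatSystem_rk, bruhatSystem_rk] at h1
      have hv : v = 1 := cs.length_eq_zero_iff.1 (by omega)
      have hw : w = 1 := cs.length_eq_zero_iff.1 hn
      subst hv hw
      exact ⟨[], by simp [IsReduced], by simp, [], List.Sublist.slnil, by simp [IsReduced], by simp⟩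
    | succ n ih =>
      obtain ⟨i, hi⟩ := cs.exists_rightDescent_of_ne_one (w := w) (by rintro rfl; simp at hn)
      have hni := (cs.isRightDescent_iff_not_isRightDescent_mul).1 hi
      have hl := cs.isRightDescent_iff.1 hi
      by_cases hv : cs.IsRightDescent v i
      · have hnv := (cs.isRightDescent_iff_not_isRightDescent_mul).1 hv
        obtain ⟨ω, h1, h2, ω', h3, h4, h5⟩ := ih
          (EdgeSystem.act_le_act_of_desc h (bruhatSystem_desc.2 hv)) (by
            rw [bruhatSystem_act]; omega)
        rw [bruhatSystem_act] at h2 h5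
        refine ⟨ω ++ [i], IsReduced.concat_iff.2 ⟨h1, by rwa [h2]⟩, ?_, ω' ++ [i],
          h3.append (List.Sublist.refl _), IsReduced.concat_iff.2 ⟨h4, by rwa [h5]⟩, ?_⟩
        · rw [wordProd_append, h2, wordProd_singleton, cs.simple_mul_simple_cancel_right]
        · rw [wordProd_append, h5, wordProd_singleton, cs.simple_mul_simple_cancel_right]
      · obtain ⟨ω, h1, h2, ω', h3, h4, h5⟩ := ih
          (EdgeSystem.le_act_of_not_desc h (mt bruhatSystem_desc.1 hv)) (by
            rw [bruhatSystem_act]; omega)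
        rw [bruhatSystem_act] at h2
        refine ⟨ω ++ [i], IsReduced.concat_iff.2 ⟨h1, by rwa [h2]⟩, ?_, ω',
          h3.trans (List.sublist_append_left _ _), h4, h5⟩
        rw [wordProd_append, h2, wordProd_singleton, cs.simple_mul_simple_cancel_right]

lemma bruhat_mem_of_edge {J : Set B} {x z : W} {b : B →₀ ℝ} (h : cs.bruhatSystem.edge x b z)
    (hz : z ∈ Subgroup.closure (cs.simple '' J)) :
    x ∈ Subgroup.closure (cs.simple '' J) ∧ ∀ m : W,
      (∀ i ∈ J, cs.length (cs.simple i * m) > cs.length m) →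
      cs.TwistedEdge J (z * m) (-b) (x * m) := by
  obtain ⟨t, ht, rfl, hp, h0⟩ := h
  have hb : 0 ≤ b := by
    rcases hp with ⟨i, -, hi⟩ | ⟨-, h⟩
    · exact ht.nonneg_of_apply_pos hi
    · exact absurd (Finsupp.ext fun i => h i (Set.notMem_empty i)) ht.ne_zero
  have h1 : 0 ≤ cs.geomRep (t * x)⁻¹ (-b) := by
    rwa [mul_inv_rev, geomRep_mul_apply, ht.inv, map_neg, ht.geomRep_self, neg_neg]
  have hJ : ∀ i, i ∉ J → b i = 0 := by
    intro i hi
    have h2 := h1 i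
    rw [geomRep_apply_of_mem_closure (inv_mem hz) hi] at h2
    exact le_antisymm (by simpa using h2) (hb i)
  have htm := ht.mem_closure hb hJ
  refine ⟨(Subgroup.mul_mem_cancel_left _ htm).1 hz, fun m hm => ⟨t, ht.neg, ?_, ?_, ?_⟩⟩
  · rw [← mul_assoc, ← mul_assoc, ht.mul_self, one_mul]
  · exact Or.inr ⟨neg_nonpos.2 hb, fun i hi => by simp [hJ i hi]⟩
  · rw [mul_inv_rev, geomRep_mul_apply]
    refine geomRep_inv_nonneg_of_minimal hm h1 fun i hi => ?_
    rw [geomRep_apply_of_mem_closure (inv_mem hz) hi]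
    simp [hJ i hi]

namespace IsParabolicFactorization

variable {J : Set B} {wJ Jw : W → W} (F : cs.IsParabolicFactorization J wJ Jw)
include F

lemma desc_of_descent {y : W} {i : B} (hi : cs.IsRightDescent (Jw y) i) :
    (twistedSystem F).Desc i y := by
  obtain ⟨h1, h2⟩ := F.right_of_descent hi
  show (cs.length (Jw (y * cs.simple i)) : ℤ) - cs.length (wJ (y * cs.simple i)) <
    (cs.length (Jw y) : ℤ) - cs.length (wJ y)
  rw [h1, h2]
  unfold IsRightDescent at hi
  omega

lemma twisted_le_mul_left {c y : W} (h : cs.bruhatSystem.le c (Jw y)) :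
    (twistedSystem F).le (wJ y * c) y := by
  obtain ⟨n, hn⟩ : ∃ n, cs.length (Jw y) = n := ⟨_, rfl⟩
  induction n generalizing c y with
  | zero =>
    have h1 := EdgeSystem.rk_le h
    rw [bruhatSystem_rk, bruhatSystem_rk] at h1
    have hc : c = 1 := cs.length_eq_zero_iff.1 (by omega)
    have hy : Jw y = 1 := cs.length_eq_zero_iff.1 hn
    have h2 := F.fac y
    rw [hy] at h2
    rw [hc, ← h2]
    exact EdgeSystem.le_refl _
  | succ n ih =>
    obtain ⟨i, hi⟩ := cs.exists_rightDescent_of_ne_one (w := Jw y)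
      (by intro h; rw [h] at hn; simp at hn)
    obtain ⟨h1, h2⟩ := F.right_of_descent hi
    have hl := cs.isRightDescent_iff.1 hi
    have hd := F.desc_of_descent hi
    by_cases hc : cs.bruhatSystem.Desc i c
    · have h3 := EdgeSystem.act_le_act_of_desc h hc
      rw [bruhatSystem_act, bruhatSystem_act, ← h1] at h3
      have h4 := ih h3 (by rw [h1]; omega)
      rw [h2, ← mul_assoc] at h4
      have h5 := EdgeSystem.act_le_act_of_not_desc h4 (EdgeSystem.not_desc_act hd)
      have e : ∀ z, (twistedSystem F).act i (z * cs.simple i) = z :=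
        fun z => cs.simple_mul_simple_cancel_right i
      rwa [e, e] at h5
    · have h3 := EdgeSystem.le_act_of_not_desc h hc
      rw [bruhatSystem_act, ← h1] at h3
      have h4 := ih h3 (by rw [h1]; omega)
      rw [h2] at h4
      exact EdgeSystem.le_trans h4 (EdgeSystem.act_le hd)

lemma twisted_le_of_bruhat_le {x k m : W} (h : cs.bruhatSystem.le x k)
    (hk : k ∈ Subgroup.closure (cs.simple '' J))
    (hm : ∀ i ∈ J, cs.length (cs.simple i * m) > cs.length m) :
    (twistedSystem F).le (k * m) (x * m) := by
  suffices x ∈ Subgroup.closure (cs.simple '' J) ∧ (twistedSystem F).le (k * m) (x * m) from this.2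
  induction h using Relation.ReflTransGen.head_induction_on with
  | refl => exact ⟨hk, EdgeSystem.le_refl _⟩
  | head h _ ih =>
    obtain ⟨b, hb⟩ := h
    obtain ⟨h1, h2⟩ := bruhat_mem_of_edge hb ih.1
    exact ⟨h1, EdgeSystem.le_trans ih.2 (EdgeSystem.le_of_edge (E := twistedSystem F) (h2 m hm))⟩

lemma bruhat_le_of_twisted_le {y x : W} (h : (twistedSystem F).le y x)
    (hx : x ∈ Subgroup.closure (cs.simple '' J)) : cs.bruhatSystem.le x y := by
  suffices y ∈ Subgroup.closure (cs.simple '' J) ∧ cs.bruhatSystem.le x y from this.2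
  induction h using Relation.ReflTransGen.head_induction_on with
  | refl => exact ⟨hx, EdgeSystem.le_refl _⟩
  | @head p q h _ ih =>
    obtain ⟨a, ha⟩ := h
    obtain ⟨h1, h2⟩ := TwistedEdge.mem_left ha ih.1
    refine ⟨h1, EdgeSystem.le_trans ih.2 (EdgeSystem.le_of_edge (a := -a) ?_)⟩
    obtain ⟨t, ht, rfl, -, h0⟩ := ha
    refine ⟨t, ht.neg, by rw [← mul_assoc, ht.mul_self, one_mul], Or.inl ?_, ?_⟩
    · by_contra! hn
      refine ht.ne_zero (le_antisymm h2 fun i => ?_)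
      have := hn i (Set.notMem_empty i)
      simpa using this
    · rwa [mul_inv_rev, geomRep_mul_apply, ht.inv, map_neg, ht.geomRep_self, neg_neg]

lemma twistedLE_of_le {y x : W} (h : (twistedSystem F).le y x) : twistedLE cs J wJ Jw y x := by
  unfold twistedLE
  simp only [bruhatLE_iff]
  obtain ⟨n, hn⟩ : ∃ n, cs.length (Jw x) = n := ⟨_, rfl⟩
  induction n generalizing x y with
  | zero =>
    have h1 : Jw x = 1 := cs.length_eq_zero_iff.1 hn
    have hx := F.mem_of_Jw_eq_one h1
    have hy := F.mem_of_le h hx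
    refine ⟨1, one_mem _, ?_, ?_⟩
    · rw [(F.of_mem hx).1, (F.of_mem hy).1, inv_one, mul_one]
      exact F.bruhat_le_of_twisted_le h hx
    · rw [h1, (F.of_mem hy).2, one_mul]
      exact EdgeSystem.le_refl _
  | succ n ih =>
    obtain ⟨i, hi⟩ := cs.exists_rightDescent_of_ne_one (w := Jw x)
      (by intro h; rw [h] at hn; simp at hn)
    obtain ⟨h1, h2⟩ := F.right_of_descent hi
    have hl := cs.isRightDescent_iff.1 hi
    have hlen : cs.length (Jw (x * cs.simple i)) = n := by rw [h1]; omega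
    have hup : ¬ cs.bruhatSystem.Desc i (Jw x * cs.simple i) := by
      rw [bruhatSystem_desc, ← cs.isRightDescent_iff_not_isRightDescent_mul]
      exact hi
    by_cases hy : (twistedSystem F).Desc i y
    · obtain ⟨u, hu, h3, h4⟩ := ih (EdgeSystem.act_le_act_of_desc h hy) hlen
      change cs.bruhatSystem.le (wJ (x * cs.simple i)) (wJ (y * cs.simple i) * u⁻¹) at h3
      change cs.bruhatSystem.le (u * Jw (y * cs.simple i)) (Jw (x * cs.simple i)) at h4
      rw [h2] at h3
      rw [h1] at h4
      have h5 := EdgeSystem.act_le_act_of_not_desc h4 hup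
      rw [bruhatSystem_act, bruhatSystem_act, cs.simple_mul_simple_cancel_right] at h5
      rcases F.right_cases y i with ⟨k1, k2⟩ | ⟨j, hj, k1, k2, k3⟩
      · rw [k2] at h3
        rw [k1, ← mul_assoc, cs.simple_mul_simple_cancel_right] at h5
        exact ⟨u, hu, h3, h5⟩
      · rw [k3] at h3
        rw [k2, mul_assoc, k1] at h5
        refine ⟨u * cs.simple j, mul_mem hu (simple_mem_closure hj), ?_, by rwa [mul_assoc]⟩
        rwa [mul_inv_rev, cs.inv_simple, ← mul_assoc]
    · obtain ⟨u, hu, h3, h4⟩ := ih (EdgeSystem.le_act_of_not_desc h hy) hlen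
      change cs.bruhatSystem.le (wJ (x * cs.simple i)) (wJ y * u⁻¹) at h3
      change cs.bruhatSystem.le (u * Jw y) (Jw (x * cs.simple i)) at h4
      rw [h2] at h3
      rw [h1] at h4
      refine ⟨u, hu, h3, EdgeSystem.le_trans h4 ?_⟩
      exact EdgeSystem.act_le (bruhatSystem_desc.2 hi)

theorem twistedLE_iff {y x : W} : twistedLE cs J wJ Jw y x ↔ (twistedSystem F).le y x := by
  refine ⟨?_, F.twistedLE_of_le⟩
  rintro ⟨u, hu, h1, h2⟩
  rw [bruhatLE_iff] at h1 h2
  have hk : wJ y * u⁻¹ ∈ Subgroup.closure (cs.simple '' J) := mul_mem (F.mem y) (inv_mem hu)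
  have h3 := F.twisted_le_of_bruhat_le h1 hk (F.min x)
  rw [← F.fac x] at h3
  refine EdgeSystem.le_trans ?_ h3
  obtain ⟨e1, e2⟩ := F.of_mul hk (F.min x)
  have h4 := F.twisted_le_mul_left (c := u * Jw y) (y := wJ y * u⁻¹ * Jw x) (by rwa [e2])
  rwa [e1, mul_assoc, inv_mul_cancel_left, ← F.fac y] at h4

end IsParabolicFactorization

end CoxeterSystem

/-- A ranked poset `s` (with respect to the relation `r`) whose covering pairs, read from the
top, carry labels satisfying local exchange conditions that imply lexicographic shellability
of all intervals. -/
structure LabelledPoset {α Λ : Type*} [LinearOrder Λ] (r : α → α → Prop) (s : Set α) (ρ : α → ℤ)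
    (lab : α → α → Λ) : Prop where
  refl : ∀ a ∈ s, r a a
  trans : ∀ a ∈ s, ∀ b ∈ s, ∀ c ∈ s, r a b → r b c → r a c
  rk_lt : ∀ a ∈ s, ∀ b ∈ s, r a b → a ≠ b → ρ a < ρ b
  coatom : ∀ a ∈ s, ∀ b ∈ s, r a b → a ≠ b → ∃ c ∈ s, r a c ∧ r c b ∧ ρ c + 1 = ρ b
  finite : ∀ a ∈ s, ∀ b ∈ s, (intervalIn r s a b).Finite
  thin : ∀ a ∈ s, ∀ b ∈ s, r a b → ρ b = ρ a + 2 → (intervalIn r s a b).ncard = 4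
  lab_inj : ∀ b ∈ s, ∀ c ∈ s, ∀ d ∈ s, r c b → r d b → ρ c + 1 = ρ b → ρ d + 1 = ρ b →
    lab b c = lab b d → c = d
  exchange : ∀ w ∈ s, ∀ c ∈ s, ∀ b ∈ s, r w c → r c b → ρ w + 1 = ρ c → ρ c + 1 = ρ b →
    ¬ lab b c < lab c w → ∃ d ∈ s, r w d ∧ r d b ∧ ρ d = ρ c ∧ lab b d < lab b c
  descent : ∀ z ∈ s, ∀ c ∈ s, ∀ d ∈ s, ∀ b ∈ s, r z c → r z d → r c b → r d b →
    ρ c + 1 = ρ b → ρ d + 1 = ρ b → lab b d < lab b c →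
    ∃ w ∈ s, r z w ∧ r w c ∧ ρ w + 1 = ρ c ∧ ¬ lab b c < lab c w

namespace LabelledPoset

variable {α Λ : Type*} [LinearOrder Λ] {r : α → α → Prop} {s : Set α} {ρ : α → ℤ}
  {lab : α → α → Λ}

/-- A chain in the interval between `x` and `y` meeting every rank. -/
structure FullChain (r : α → α → Prop) (s : Set α) (ρ : α → ℤ) (x y : α) (C : Set α) : Prop where
  subset : C ⊆ intervalIn r s x y
  chain : IsChain r C
  full : ∀ k : ℤ, ρ x ≤ k → k ≤ ρ y → ∃ a ∈ C, ρ a = k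

lemma FullChain.subset_s {x y : α} {C : Set α} (h : FullChain r s ρ x y C) : C ⊆ s :=
  fun _ ha => (h.subset ha).1

lemma maxChain_mem {I C : Set α} (h : MaxChainIn r I C) {c : α} (hc : c ∈ I)
    (hcomp : ∀ d ∈ C, c ≠ d → r c d ∨ r d c) : c ∈ C := by
  have := h.2 (insert c C) ⟨Set.insert_subset hc h.1.1, h.1.2.insert hcomp⟩
    (Set.subset_insert c C)
  rw [this]
  exact Set.mem_insert c C

variable (P : LabelledPoset r s ρ lab) {x y : α}
include P

lemma rk_le {a b : α} (ha : a ∈ s) (hb : b ∈ s) (h : r a b) : ρ a ≤ ρ b := by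
  by_cases hab : a = b
  · rw [hab]
  · exact (P.rk_lt a ha b hb h hab).le

lemma eq_of_rk_le {a b : α} (ha : a ∈ s) (hb : b ∈ s) (h : r a b) (hr : ρ b ≤ ρ a) : a = b := by
  by_contra hab
  have := P.rk_lt a ha b hb h hab
  omega

lemma chain_rel {C : Set α} (hs : C ⊆ s) (hC : IsChain r C) {a b : α} (ha : a ∈ C) (hb : b ∈ C)
    (h : ρ a ≤ ρ b) : r a b := by
  by_cases hab : a = b
  · rw [← hab]; exact P.refl a (hs ha)
  · rcases hC ha hb hab with h' | h'
    · exact h'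
    · rw [P.eq_of_rk_le (hs hb) (hs ha) h' h]
      exact P.refl a (hs ha)

lemma chain_inj {C : Set α} (hs : C ⊆ s) (hC : IsChain r C) {a b : α} (ha : a ∈ C) (hb : b ∈ C)
    (h : ρ a = ρ b) : a = b :=
  P.eq_of_rk_le (hs ha) (hs hb) (P.chain_rel hs hC ha hb h.le) h.ge

lemma rk_mem {C : Set α} (hx : x ∈ s) (hy : y ∈ s) (hC : C ⊆ intervalIn r s x y) {a : α}
    (ha : a ∈ C) : ρ x ≤ ρ a ∧ ρ a ≤ ρ y :=
  ⟨P.rk_le hx (hC ha).1 (hC ha).2.1, P.rk_le (hC ha).1 hy (hC ha).2.2⟩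

lemma maxChain_of_full {C : Set α} (hx : x ∈ s) (hy : y ∈ s) (h : FullChain r s ρ x y C) :
    MaxChainIn r (intervalIn r s x y) C := by
  refine ⟨⟨h.subset, h.chain⟩, fun C' hC' hsub => hsub.antisymm fun d hd => ?_⟩
  obtain ⟨h1, h2⟩ := P.rk_mem hx hy hC'.1 hd
  obtain ⟨a, ha, he⟩ := h.full _ h1 h2
  rw [← P.chain_inj (fun b hb => (hC'.1 hb).1) hC'.2 (hsub ha) hd he]
  exact ha

lemma full_of_maxChain {C : Set α} (hx : x ∈ s) (hy : y ∈ s) (hxy : r x y)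
    (h : MaxChainIn r (intervalIn r s x y) C) : FullChain r s ρ x y C := by
  refine ⟨h.1.1, h.1.2, ?_⟩
  have hs : C ⊆ s := fun a ha => (h.1.1 ha).1
  have hyC : y ∈ C := maxChain_mem h ⟨hy, hxy, P.refl y hy⟩
    fun d hd _ => Or.inr (h.1.1 hd).2.2
  have hxC : x ∈ C := maxChain_mem h ⟨hx, P.refl x hx, hxy⟩
    fun d hd _ => Or.inl (h.1.1 hd).2.1
  suffices ∀ n : ℕ, ρ x ≤ ρ y - n → ∃ a ∈ C, ρ a = ρ y - n by
    intro k h1 h2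
    obtain ⟨a, ha, he⟩ := this (ρ y - k).toNat (by omega)
    exact ⟨a, ha, by omega⟩
  intro n
  induction n with
  | zero => exact fun _ => ⟨y, hyC, by simp⟩
  | succ n ih =>
    intro hn
    obtain ⟨a, ha, hae⟩ := ih (by omega)
    have hfin : {d ∈ C | ρ d < ρ a}.Finite :=
      (P.finite x hx y hy).subset fun d hd => h.1.1 hd.1
    obtain ⟨b, ⟨hb, hba⟩, hbmax⟩ := Set.exists_max_image _ ρ hfin ⟨x, hxC, by omega⟩
    have hrba := P.chain_rel hs h.1.2 hb ha hba.le
    obtain ⟨c, hc, hbc, hca, hr⟩ := P.coatom b (hs hb) a (hs ha) hrba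
      (by rintro rfl; exact lt_irrefl _ hba)
    refine ⟨c, maxChain_mem h ⟨hc, ?_, ?_⟩ fun d hd _ => ?_, by push_cast; omega⟩
    · exact P.trans x hx b (hs hb) c hc (h.1.1 hb).2.1 hbc
    · exact P.trans c hc a (hs ha) y hy hca (h.1.1 ha).2.2
    · rcases le_or_gt (ρ a) (ρ d) with hd1 | hd1
      · exact Or.inl (P.trans c hc a (hs ha) d (hs hd) hca (P.chain_rel hs h.1.2 ha hd hd1))
      · exact Or.inr (P.trans d (hs hd) b (hs hb) c hc
          (P.chain_rel hs h.1.2 hd hb (hbmax d ⟨hd, hd1⟩)) hbc)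

lemma ncard_full {C : Set α} (hx : x ∈ s) (hy : y ∈ s) (h : FullChain r s ρ x y C) :
    C.ncard = (ρ y + 1 - ρ x).toNat := by
  have hs : C ⊆ s := fun a ha => (h.subset ha).1
  have h1 : ρ '' C = Set.Icc (ρ x) (ρ y) := by
    ext k
    constructor
    · rintro ⟨a, ha, rfl⟩
      exact P.rk_mem hx hy h.subset ha
    · rintro ⟨h1, h2⟩
      obtain ⟨a, ha, he⟩ := h.full k h1 h2
      exact ⟨a, ha, he⟩
  rw [← Set.InjOn.ncard_image (f := ρ) fun a ha b hb => P.chain_inj hs h.chain ha hb, h1,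
    Set.ncard_eq_toFinset_card', Set.toFinset_Icc, Int.card_Icc]

lemma exists_full (n : ℕ) : ∀ y ∈ s, ∀ x ∈ s, r x y → (ρ y - ρ x).toNat = n →
    ∃ C, FullChain r s ρ x y C := by
  induction n with
  | zero =>
    intro y hy x hx hxy hn
    have h1 := P.eq_of_rk_le hx hy hxy (by omega)
    subst h1
    refine ⟨{x}, ?_, Set.Subsingleton.isChain (by simp), fun k h1 h2 => ⟨x, rfl, by omega⟩⟩
    rintro _ rfl
    exact ⟨hx, hxy, hxy⟩
  | succ n ih =>
    intro y hy x hx hxy hn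
    obtain ⟨c, hc, hxc, hcy, hr⟩ := P.coatom x hx y hy hxy (by rintro rfl; simp at hn)
    obtain ⟨C, hC⟩ := ih c hc x hx hxc (by omega)
    have hle : ∀ d ∈ C, r d y := fun d hd =>
      P.trans d (hC.subset hd).1 c hc y hy (hC.subset hd).2.2 hcy
    refine ⟨insert y C, Set.insert_subset ⟨hy, hxy, P.refl y hy⟩ fun d hd =>
      ⟨(hC.subset hd).1, (hC.subset hd).2.1, hle d hd⟩,
      hC.chain.insert fun d hd _ => Or.inr (hle d hd), fun k h1 h2 => ?_⟩
    by_cases hk : k = ρ y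
    · exact ⟨y, Set.mem_insert y C, hk.symm⟩
    · obtain ⟨a, ha, he⟩ := hC.full k h1 (by omega)
      exact ⟨a, Set.mem_insert_of_mem y ha, he⟩

lemma intervalIn_intervalIn (hx : x ∈ s) (hy : y ∈ s) {a b : α} (ha : a ∈ intervalIn r s x y)
    (hb : b ∈ intervalIn r s x y) :
    intervalIn r (intervalIn r s x y) a b = intervalIn r s a b := by
  ext z
  constructor
  · rintro ⟨h1, h2⟩
    exact ⟨h1.1, h2⟩
  · rintro ⟨h1, h2, h3⟩
    exact ⟨⟨h1, P.trans x hx a ha.1 z h1 ha.2.1 h2, P.trans z h1 b hb.1 y hy h3 hb.2.2⟩, h2, h3⟩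

theorem gradedIn_interval (hx : x ∈ s) (hy : y ∈ s) (hxy : r x y) :
    GradedIn r (intervalIn r s x y) :=
  ⟨_, fun _ hC => P.ncard_full hx hy (P.full_of_maxChain hx hy hxy hC)⟩

theorem thinIn_interval (hx : x ∈ s) (hy : y ∈ s) : ThinIn r (intervalIn r s x y) := by
  intro a ha b hb hab h
  rw [P.intervalIn_intervalIn hx hy ha hb] at h ⊢
  obtain ⟨C, hC⟩ := P.exists_full _ b hb.1 a ha.1 hab rfl
  have h1 := h C (P.maxChain_of_full ha.1 hb.1 hC)
  rw [P.ncard_full ha.1 hb.1 hC] at h1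
  exact P.thin a ha.1 b hb.1 hab (by omega)

end LabelledPoset

namespace LabelledPoset

variable {α Λ : Type*} [LinearOrder Λ] {r : α → α → Prop} {s : Set α} {ρ : α → ℤ}
  {lab : α → α → Λ}

open Classical in
/-- The element of `C` lying `k` ranks below `y`. -/
noncomputable def level (ρ : α → ℤ) (y : α) (C : Set α) (k : ℕ) : α :=
  if h : ∃ a ∈ C, ρ a = ρ y - k then h.choose else y

/-- The sequence of labels along a chain, read from the top. -/
noncomputable def key (ρ : α → ℤ) (lab : α → α → Λ) (y : α) (n : ℕ) (C : Set α) :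
    Lex (Fin n → Λ) :=
  toLex fun k => lab (level ρ y C k) (level ρ y C (k + 1))

lemma level_spec {x y : α} {C : Set α} (h : FullChain r s ρ x y C) {k : ℕ}
    (hk : (k : ℤ) ≤ ρ y - ρ x) : level ρ y C k ∈ C ∧ ρ (level ρ y C k) = ρ y - k := by
  have h1 : ∃ a ∈ C, ρ a = ρ y - k := h.full _ (by omega) (by omega)
  unfold level
  rw [dif_pos h1]
  exact h1.choose_spec

lemma key_lt_iff {y : α} {n : ℕ} {C C' : Set α} : key ρ lab y n C < key ρ lab y n C' ↔
    ∃ i < n, (∀ j < i, lab (level ρ y C j) (level ρ y C (j + 1)) =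
      lab (level ρ y C' j) (level ρ y C' (j + 1))) ∧
      lab (level ρ y C i) (level ρ y C (i + 1)) < lab (level ρ y C' i) (level ρ y C' (i + 1)) := by
  constructor
  · rintro ⟨i, h1, h2⟩
    exact ⟨i, i.2, fun j hj => h1 ⟨j, hj.trans i.2⟩ hj, h2⟩
  · rintro ⟨i, hi, h1, h2⟩
    exact ⟨⟨i, hi⟩, fun j hj => h1 j hj, h2⟩

lemma exists_sorted_enum {β L : Type*} [LinearOrder L] {X : Set β} (hX : X.Finite) {f : β → L}
    (hf : Set.InjOn f X) : ∃ (t : ℕ) (c : Fin t → β), Function.Injective c ∧ (∀ i, c i ∈ X) ∧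
      (∀ d ∈ X, ∃ i, d = c i) ∧ ∀ i j, i < j ↔ f (c i) < f (c j) := by
  let _ : LinearOrder X := LinearOrder.lift' (fun a : X => f a) hf.injective
  let _ : Fintype X := hX.fintype
  let e := monoEquivOfFin X rfl
  refine ⟨Fintype.card X, fun i => e i, Subtype.val_injective.comp e.injective, fun i => (e i).2,
    fun d hd => ⟨e.symm ⟨d, hd⟩, by simp⟩, fun i j => ?_⟩
  exact e.lt_iff_lt.symm

variable (P : LabelledPoset r s ρ lab) {x y : α}
include P

lemma level_unique {C : Set α} (h : FullChain r s ρ x y C) {k : ℕ} (hk : (k : ℤ) ≤ ρ y - ρ x)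
    {a : α} (ha : a ∈ C) (hr : ρ a = ρ y - k) : level ρ y C k = a := by
  obtain ⟨h1, h2⟩ := level_spec h hk
  exact P.chain_inj h.subset_s h.chain h1 ha (h2.trans hr.symm)

lemma level_rel {C : Set α} (h : FullChain r s ρ x y C) {k l : ℕ} (hl : (l : ℤ) ≤ ρ y - ρ x)
    (hkl : k ≤ l) : r (level ρ y C l) (level ρ y C k) := by
  obtain ⟨h1, h2⟩ := level_spec h (k := k) (by omega)
  obtain ⟨h3, h4⟩ := level_spec h hl
  exact P.chain_rel h.subset_s h.chain h3 h1 (by omega)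

lemma level_eq_of_key_eq {C C' : Set α} (hy : y ∈ s) (h : FullChain r s ρ x y C)
    (h' : FullChain r s ρ x y C') {i : ℕ} (hi : (i : ℤ) ≤ ρ y - ρ x)
    (he : ∀ j < i, lab (level ρ y C j) (level ρ y C (j + 1)) =
      lab (level ρ y C' j) (level ρ y C' (j + 1))) :
    ∀ j ≤ i, level ρ y C j = level ρ y C' j := by
  intro j
  induction j with
  | zero =>
    intro _
    have key : ∀ D, FullChain r s ρ x y D → level ρ y D 0 = y := fun D hD => by
      obtain ⟨h1, h2⟩ := level_spec hD (k := 0) (by omega)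
      exact P.eq_of_rk_le (hD.subset_s h1) hy (hD.subset h1).2.2 (by simp [h2])
    rw [key C h, key C' h']
  | succ j ih =>
    intro hj
    have e := ih (by omega)
    obtain ⟨a1, a2⟩ := level_spec h (k := j) (by omega)
    obtain ⟨b1, b2⟩ := level_spec h (k := j + 1) (by omega)
    obtain ⟨c1, c2⟩ := level_spec h' (k := j + 1) (by omega)
    refine P.lab_inj _ (h.subset_s a1) _ (h.subset_s b1) _ (h'.subset_s c1)
      (P.level_rel h (by omega) (by omega)) ?_ (by push_cast at b2; omega)
      (by push_cast at c2; omega) ?_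
    · rw [e]
      exact P.level_rel h' (by omega) (by omega)
    · rw [he j (by omega), e]

lemma key_injOn (hx : x ∈ s) (hy : y ∈ s) :
    Set.InjOn (key ρ lab y (ρ y - ρ x).toNat) {C | FullChain r s ρ x y C} := by
  have aux : ∀ C C', FullChain r s ρ x y C → FullChain r s ρ x y C' →
      key ρ lab y (ρ y - ρ x).toNat C = key ρ lab y (ρ y - ρ x).toNat C' → C ⊆ C' := by
    intro C C' h h' he a ha
    obtain ⟨h1, h2⟩ := P.rk_mem hx hy h.subset ha
    have h3 := P.level_eq_of_key_eq hy h h' (i := (ρ y - ρ x).toNat) (by omega)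
      (fun j hj => congrFun he ⟨j, hj⟩) (ρ y - ρ a).toNat (by omega)
    rw [P.level_unique h (by omega) ha (by omega)] at h3
    rw [h3]
    exact (level_spec h' (by omega)).1
  exact fun C h C' h' he => (aux C C' h h' he).antisymm (aux C' C h' h he.symm)

/-- A chain with increasing labels starts with the coatom of smallest label. -/
lemma increasing_min {z : ℕ → α} {m : ℕ} {t : ℤ} (hz : ∀ k ≤ m, z k ∈ s ∧ ρ (z k) = t - k)
    (hr : ∀ k l, k ≤ l → l ≤ m → r (z l) (z k)) (d : ℕ) : ∀ i, i + (d + 1) = m →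
    (∀ k, i ≤ k → k + 2 ≤ m → lab (z k) (z (k + 1)) < lab (z (k + 1)) (z (k + 2))) →
    ∀ a ∈ s, r (z m) a → r a (z i) → ρ a + 1 = ρ (z i) →
    ¬ lab (z i) a < lab (z i) (z (i + 1)) := by
  induction d with
  | zero =>
    intro i hi _ a ha h1 h2 h3 hl
    have hm : m = i + 1 := by omega
    subst hm
    have h4 := hz (i + 1) (by omega)
    have h5 := hz i (by omega)
    have h6 := P.eq_of_rk_le h4.1 ha h1 (by push_cast at h4; omega)
    rw [h6] at hl
    exact lt_irrefl _ hl
  | succ d ih =>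
    intro i hi hinc a ha h1 h2 h3 hl
    have h4 := hz (i + 1) (by omega)
    have h5 := hz i (by omega)
    have h6 := hz m le_rfl
    obtain ⟨w, hw, w1, w2, w3, w4⟩ := P.descent (z m) h6.1 (z (i + 1)) h4.1 a ha (z i) h5.1
      (hr _ _ (by omega) le_rfl) h1 (hr _ _ (by omega) (by omega)) h2
      (by push_cast at h4; omega) h3 hl
    exact ih (i + 1) (by omega) (fun k hk => hinc k (by omega)) w hw w1 w2 w3
      ((not_lt.1 w4).trans_lt (hinc i le_rfl (by omega)))

lemma exists_swap {C C' : Set α} (hx : x ∈ s) (hy : y ∈ s) (h : FullChain r s ρ x y C)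
    (h' : FullChain r s ρ x y C')
    (hlt : key ρ lab y (ρ y - ρ x).toNat C' < key ρ lab y (ρ y - ρ x).toNat C) :
    ∃ D, FullChain r s ρ x y D ∧
      key ρ lab y (ρ y - ρ x).toNat D < key ρ lab y (ρ y - ρ x).toNat C ∧
      C' ∩ C ⊆ D ∩ C ∧ (D ∩ C).ncard = C.ncard - 1 := by
  obtain ⟨i, hi, he, hl⟩ := key_lt_iff.1 hlt
  have hagree := P.level_eq_of_key_eq hy h' h (i := i) (by omega) he
  set n := (ρ y - ρ x).toNat with hn
  have hspec : ∀ k ≤ n, level ρ y C k ∈ C ∧ ρ (level ρ y C k) = ρ y - k :=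
    fun k hk => level_spec h (by omega)
  have hspec' : ∀ k ≤ n, level ρ y C' k ∈ C' ∧ ρ (level ρ y C' k) = ρ y - k :=
    fun k hk => level_spec h' (by omega)
  have hrel : ∀ k l, k ≤ l → l ≤ n → r (level ρ y C l) (level ρ y C k) :=
    fun k l hkl hl => P.level_rel h (by omega) hkl
  have hex : ∃ m, i < m ∧ m ≤ n ∧ level ρ y C m = level ρ y C' m := by
    have hbot : ∀ D, FullChain r s ρ x y D → level ρ y D n = x := fun D hD => by
      obtain ⟨h1, h2⟩ := level_spec hD (k := n) (by omega)
      exact (P.eq_of_rk_le hx (hD.subset_s h1) (hD.subset h1).2.1 (by omega)).symm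
    exact ⟨n, hi, le_rfl, by rw [hbot C h, hbot C' h']⟩
  classical
  obtain ⟨him, hmn, hm⟩ := Nat.find_spec hex
  have hmin : ∀ k, i < k → k < Nat.find hex → level ρ y C k ≠ level ρ y C' k :=
    fun k h1 h2 h3 => Nat.find_min hex h2 ⟨h1, by omega, h3⟩
  set m := Nat.find hex
  obtain ⟨k, hik, hkm, hk⟩ : ∃ k, i ≤ k ∧ k + 2 ≤ m ∧
      ¬ lab (level ρ y C k) (level ρ y C (k + 1)) <
        lab (level ρ y C (k + 1)) (level ρ y C (k + 2)) := by
    by_contra! hcon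
    have h1 := hspec' (i + 1) (by omega)
    have h2 := hspec i (by omega)
    refine P.increasing_min (z := level ρ y C) (m := m) (t := ρ y)
      (fun k hk => ⟨h.subset_s (hspec k (by omega)).1, (hspec k (by omega)).2⟩)
      (fun k l hkl hl => hrel k l hkl (by omega)) (m - i - 1) i (by omega) hcon
      (level ρ y C' (i + 1)) (h'.subset_s h1.1) ?_ ?_ (by push_cast at h1; omega) ?_
    · rw [hm]
      exact P.level_rel h' (by omega) (by omega)
    · rw [← hagree i le_rfl]
      exact P.level_rel h' (by omega) (by omega)
    · rw [hagree i le_rfl] at hl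
      exact hl
  have hk0 := hspec k (by omega)
  have hk1 := hspec (k + 1) (by omega)
  have hk2 := hspec (k + 2) (by omega)
  push_cast at hk1 hk2
  obtain ⟨o, ho, o1, o2, o3, o4⟩ := P.exchange _ (h.subset_s hk2.1) _ (h.subset_s hk1.1) _
    (h.subset_s hk0.1) (hrel _ _ (by omega) (by omega)) (hrel _ _ (by omega) (by omega))
    (by omega) (by omega) hk
  set c := level ρ y C (k + 1) with hc
  have hoc : o ≠ c := by rintro rfl; exact lt_irrefl _ o4
  have hoC : o ∉ C := fun hoC => hoc (P.chain_inj h.subset_s h.chain hoC hk1.1 o3)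
  have hD : FullChain r s ρ x y (insert o (C \ {c})) := by
    refine ⟨Set.insert_subset ⟨ho, ?_, ?_⟩ (Set.sdiff_subset.trans h.subset),
      (h.chain.mono Set.sdiff_subset).insert fun e ⟨heC, hec⟩ _ => ?_, fun j h1 h2 => ?_⟩
    · exact P.trans _ hx _ (h.subset_s hk2.1) _ ho (h.subset hk2.1).2.1 o1
    · exact P.trans _ ho _ (h.subset_s hk0.1) _ hy o2 (h.subset hk0.1).2.2
    · rcases lt_trichotomy (ρ e) (ρ c) with h1 | h1 | h1
      · exact Or.inr (P.trans _ (h.subset_s heC) _ (h.subset_s hk2.1) _ ho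
          (P.chain_rel h.subset_s h.chain heC hk2.1 (by omega)) o1)
      · exact absurd (P.chain_inj h.subset_s h.chain heC hk1.1 h1) hec
      · exact Or.inl (P.trans _ ho _ (h.subset_s hk0.1) _ (h.subset_s heC) o2
          (P.chain_rel h.subset_s h.chain hk0.1 heC (by omega)))
    · obtain ⟨a, ha, hae⟩ := h.full j h1 h2
      by_cases hac : a = c
      · exact ⟨o, Set.mem_insert _ _, by rw [o3, ← hac, hae]⟩
      · exact ⟨a, Set.mem_insert_of_mem _ ⟨ha, hac⟩, hae⟩
  have hlev : ∀ j ≤ n, j ≠ k + 1 → level ρ y (insert o (C \ {c})) j = level ρ y C j := by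
    intro j hj hjk
    obtain ⟨j1, j2⟩ := hspec j hj
    refine P.level_unique hD (by omega) (Set.mem_insert_of_mem _ ⟨j1, fun hjc => hjk ?_⟩) j2
    have : ρ (level ρ y C j) = ρ c := by rw [hjc]
    omega
  have hlevo : level ρ y (insert o (C \ {c})) (k + 1) = o :=
    P.level_unique hD (by omega) (Set.mem_insert _ _) (by push_cast; omega)
  have hinter : insert o (C \ {c}) ∩ C = C \ {c} := by
    rw [Set.insert_inter_of_notMem hoC, Set.inter_eq_left]
    exact Set.sdiff_subset
  refine ⟨insert o (C \ {c}), hD, key_lt_iff.2 ⟨k, by omega, fun j hj => ?_, ?_⟩, ?_, ?_⟩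
  · rw [hlev j (by omega) (by omega), hlev (j + 1) (by omega) (by omega)]
  · rw [hlev k (by omega) (by omega), hlevo]
    exact o4
  · rw [hinter]
    rintro e ⟨he', heC⟩
    refine ⟨heC, ?_⟩
    rintro rfl
    exact hmin (k + 1) (by omega) (by omega)
      (P.level_unique h' (by omega) he' (by push_cast; omega)).symm
  · rw [hinter, Set.ncard_sdiff_singleton_of_mem hk1.1]

theorem shellableIn_interval (hx : x ∈ s) (hy : y ∈ s) (hxy : r x y) :
    ShellableIn r (intervalIn r s x y) := by
  have hfin : {C | FullChain r s ρ x y C}.Finite :=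
    (P.finite x hx y hy).finite_subsets.subset fun C hC => hC.subset
  obtain ⟨t, c, h1, h2, h3, h4⟩ := exists_sorted_enum hfin (P.key_injOn hx hy)
  refine ⟨t, c, h1, fun i => P.maxChain_of_full hx hy (h2 i),
    fun d hd => h3 d (P.full_of_maxChain hx hy hxy hd), fun i j hij => ?_⟩
  obtain ⟨D, hD, hlt, hsub, hcard⟩ := P.exists_swap hx hy (h2 j) (h2 i) ((h4 i j).1 hij)
  obtain ⟨k, rfl⟩ := h3 D hD
  exact ⟨k, (h4 k j).2 hlt, hsub, hcard⟩

end LabelledPoset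

namespace EdgeSystem

open Relation

variable {ι W V Λ : Type*} [AddCommGroup V] [Module ℝ V] [LinearOrder Λ]
  {E : EdgeSystem ι W V Λ}

lemma Diamond.exists_partner {p c w : W} {a₁ a₂ : V} (h : E.Diamond p w) (h1 : E.Cover p a₁ c)
    (h2 : E.Cover c a₂ w) : ∃ d b₁ b₂, c ≠ d ∧ E.Cover p b₁ d ∧ E.Cover d b₂ w ∧
      E.Rel a₁ a₂ b₁ b₂ := by
  obtain ⟨c', d', u₁, u₂, t₁, t₂, hne, k1, k2, k3, k4, hrel, hall⟩ := h
  rcases hall c a₁ a₂ h1 h2 with rfl | rfl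
  · rw [E.edge_root h1.1 k1.1, E.edge_root h2.1 k2.1]
    exact ⟨d', t₁, t₂, hne, k3, k4, hrel⟩
  · rw [E.edge_root h1.1 k3.1, E.edge_root h2.1 k4.1]
    exact ⟨c', u₁, u₂, hne.symm, k1, k2, hrel.symm k1.1 k2.1 k3.1⟩

lemma Rel.ne_label {p w c d : W} {a₁ a₂ b₁ b₂ : V} (hcd : c ≠ d) (h1 : E.Cover p a₁ c)
    (h2 : E.Cover c a₂ w) (h3 : E.Cover p b₁ d) (h4 : E.Cover d b₂ w) (h : E.Rel a₁ a₂ b₁ b₂) :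
    E.label a₁ ≠ E.label a₂ := by
  intro hl
  obtain rfl := E.label_inj h1.1 h2.1 hl
  obtain ⟨x, y, hb, hb'⟩ := h
  have hs := Rel.sq h1.1 h2.1 h3.1 hb
  rw [E.form_self h1.1] at hb' hs
  have hsq : (x + y) * (x + y) = 1 := by linarith
  rcases mul_self_eq_one_iff.1 hsq with e | e
  · have : b₁ = a₁ := by rw [hb, ← add_smul, e, one_smul]
    exact hcd (E.edge_fun h1.1 (this ▸ h3.1))
  · have : b₂ = a₁ := by
      rw [hb', ← sub_smul, show y - (x + 2 * y) = 1 by linarith, one_smul]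
    exact hcd (E.edge_cofun h2.1 (this ▸ h4.1))

lemma Diamond.exists_lt {p c w : W} {a₁ a₂ : V} (h : E.Diamond p w) (h1 : E.Cover p a₁ c)
    (h2 : E.Cover c a₂ w) (hl : ¬ E.label a₁ < E.label a₂) : ∃ d b₁ b₂, E.Cover p b₁ d ∧
      E.Cover d b₂ w ∧ E.label b₁ < E.label a₁ ∧ E.label a₂ < E.label b₂ := by
  obtain ⟨d, b₁, b₂, hne, h3, h4, hrel⟩ := h.exists_partner h1 h2
  have := Rel.of_gt hne h1 h2 h3 h4 hrel
    (lt_of_le_of_ne (not_lt.1 hl) (Rel.ne_label hne h1 h2 h3 h4 hrel).symm)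
  exact ⟨d, b₁, b₂, h3, h4, this.2⟩

lemma exists_coatom {p q : W} (h : E.Basic p q) (hle : E.le p q) (hne : p ≠ q) :
    ∃ a α, E.Cover a α q ∧ E.le p a := by
  rcases ReflTransGen.cases_tail (h.sat hle) with h | ⟨a, ha, α, hα⟩
  · exact absurd h.symm hne
  · exact ⟨a, α, hα, ReflTransGen.mono (fun x y ⟨a, ha⟩ => ⟨a, ha.1⟩) _ _ ha⟩

lemma ncard_quad {α : Type*} {a b c d : α} (h1 : a ≠ b) (h2 : a ≠ c) (h3 : a ≠ d) (h4 : b ≠ c)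
    (h5 : b ≠ d) (h6 : c ≠ d) : ({a, b, c, d} : Set α).ncard = 4 := by
  rw [Set.ncard_def, Set.encard_eq_four.2 ⟨a, b, c, d, h1, h2, h3, h4, h5, h6, rfl⟩]
  rfl

variable (E) in
/-- The closed interval `[p, q]` in the reachability order. -/
def interval (p q : W) : Set W := {z | E.le p z ∧ E.le z q}

lemma interval_zero {p q : W} (h : E.le p q) (hr : E.rk q = E.rk p) :
    (E.interval p q).ncard = 1 := by
  obtain rfl := eq_of_le_of_rk h hr.le
  have : E.interval p p = {p} := by
    ext z
    exact ⟨fun hz => (le_antisymm hz.1 hz.2).symm, by rintro rfl; exact ⟨h, h⟩⟩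
  rw [this, Set.ncard_singleton]

lemma interval_one_eq {p q : W} (h : E.le p q) (hr : E.rk q = E.rk p + 1) :
    E.interval p q = {p, q} := by
  ext z
  constructor
  · intro hz
    have h1 := rk_le hz.1
    have h2 := rk_le hz.2
    by_cases hzr : E.rk z ≤ E.rk p
    · exact Or.inl (eq_of_le_of_rk hz.1 hzr).symm
    · exact Or.inr (eq_of_le_of_rk hz.2 (by omega))
  · rintro (rfl | rfl)
    · exact ⟨le_refl _, h⟩
    · exact ⟨h, le_refl _⟩

lemma interval_one {p q : W} (h : E.le p q) (hr : E.rk q = E.rk p + 1) :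
    (E.interval p q).ncard = 2 := by
  rw [interval_one_eq h hr, Set.ncard_pair]
  rintro rfl
  omega

lemma interval_two {p q : W} (h : E.le p q) (hr : E.rk q = E.rk p + 2) (hd : E.Diamond p q) :
    (E.interval p q).ncard = 4 := by
  obtain ⟨c, d, a₁, a₂, b₁, b₂, hne, k1, k2, k3, k4, -, hall⟩ := hd
  have : E.interval p q = {p, c, d, q} := by
    ext z
    constructor
    · intro hz
      have h1 := rk_le hz.1
      have h2 := rk_le hz.2
      by_cases hz1 : E.rk z ≤ E.rk p
      · exact Or.inl (eq_of_le_of_rk hz.1 hz1).symm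
      by_cases hz2 : E.rk q ≤ E.rk z
      · exact Or.inr (Or.inr (Or.inr (eq_of_le_of_rk hz.2 hz2)))
      · obtain ⟨a, ha⟩ := exists_edge_of_le hz.1 (by omega)
        obtain ⟨a', ha'⟩ := exists_edge_of_le hz.2 (by omega)
        rcases hall z a a' ha ha' with rfl | rfl <;> simp
    · rintro (rfl | rfl | rfl | rfl)
      · exact ⟨le_refl _, h⟩
      · exact ⟨k1.le, k2.le⟩
      · exact ⟨k3.le, k4.le⟩
      · exact ⟨h, le_refl _⟩
  have e1 := k1.2
  have e2 := k3.2
  rw [this]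
  refine ncard_quad ?_ ?_ ?_ hne ?_ ?_ <;> rintro rfl <;> omega

end EdgeSystem

namespace EdgeSystem

open Relation

/-- Labels for the covering pairs of the poset of intervals: lower ends first, then the
minimum, then upper ends in reversed order. -/
abbrev HatLabel (Λ : Type*) := Λ ⊕ₗ (Unit ⊕ₗ Λᵒᵈ)

namespace HatLabel

variable {Λ : Type*}

/-- The label of a change of the lower end. -/
def up (a : Λ) : HatLabel Λ := toLex (Sum.inl a)

/-- The label of a step to the minimum. -/
def mid : HatLabel Λ := toLex (Sum.inr (toLex (Sum.inl ())))

/-- The label of a change of the upper end. -/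
def down (a : Λ) : HatLabel Λ := toLex (Sum.inr (toLex (Sum.inr (OrderDual.toDual a))))

lemma up_injective : Function.Injective (up : Λ → HatLabel Λ) :=
  fun _ _ h => Sum.inl_injective (toLex.injective h)

lemma down_injective : Function.Injective (down : Λ → HatLabel Λ) := fun _ _ h =>
  OrderDual.toDual.injective (Sum.inr_injective (toLex.injective (Sum.inr_injective
    (toLex.injective h))))

variable [LinearOrder Λ]

lemma up_lt_up {a b : Λ} : up a < up b ↔ a < b := Sum.Lex.inl_lt_inl_iff

lemma down_lt_down {a b : Λ} : down a < down b ↔ b < a :=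
  Sum.Lex.inr_lt_inr_iff.trans (Sum.Lex.inr_lt_inr_iff.trans OrderDual.toDual_lt_toDual)

lemma up_lt_mid (a : Λ) : up a < mid := Sum.Lex.inl_lt_inr _ _

lemma up_lt_down (a b : Λ) : up a < down b := Sum.Lex.inl_lt_inr _ _

lemma mid_lt_down (b : Λ) : mid < down b := Sum.Lex.inr_lt_inr_iff.2 (Sum.Lex.inl_lt_inr _ _)

end HatLabel

open HatLabel

variable {ι W V Λ : Type*} [AddCommGroup V] [Module ℝ V] [LinearOrder Λ]
  (E : EdgeSystem ι W V Λ)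

/-- The rank function of the poset of intervals with a minimum adjoined. -/
def hatRk : Option (W × W) → ℤ
  | none => 0
  | some p => E.rk p.2 - E.rk p.1 + 1

open Classical in
/-- The label of an edge in terms of its end points. -/
noncomputable def edgeLabel (p q : W) : Λ :=
  E.label (if h : ∃ a, E.edge p a q then h.choose else 0)

open Classical in
/-- The labelling of the covering pairs of the poset of intervals with a minimum adjoined. -/
noncomputable def hatLab : Option (W × W) → Option (W × W) → HatLabel Λ
  | some p, some q => if q.2 = p.2 then up (E.edgeLabel p.1 q.1) else down (E.edgeLabel q.2 p.2)
  | _, _ => mid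

variable {E}

lemma edgeLabel_eq {p q : W} {a : V} (h : E.edge p a q) : E.edgeLabel p q = E.label a := by
  have hex : ∃ a, E.edge p a q := ⟨a, h⟩
  unfold edgeLabel
  rw [dif_pos hex, E.edge_root hex.choose_spec h]

lemma hatLab_up {v w p : W} {a : V} (h : E.Cover v a p) :
    E.hatLab (some (v, w)) (some (p, w)) = up (E.label a) := by
  simp [hatLab, edgeLabel_eq h.1]

lemma hatLab_down {v w q : W} {a : V} (h : E.Cover q a w) :
    E.hatLab (some (v, w)) (some (v, q)) = down (E.label a) := by
  have hne : q ≠ w := by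
    rintro rfl
    have := h.2
    omega
  simp [hatLab, edgeLabel_eq h.1, hne]

lemma some_mem_hat {tle : W → W → Prop} {v w : W} :
    some (v, w) ∈ hatCarrier tle ↔ tle v w := by
  constructor
  · rintro (h | ⟨v', w', h, h'⟩)
    · simp at h
    · simp only [Option.some.injEq, Prod.mk.injEq] at h
      rwa [h.1, h.2]
  · exact fun h => Or.inr ⟨v, w, rfl, h⟩

lemma none_mem_hat {tle : W → W → Prop} : none ∈ hatCarrier tle := Or.inl rfl

lemma eq_none_of_hatRel {tle : W → W → Prop} {c : Option (W × W)} (h : hatRel tle c none) :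
    c = none := by
  cases c
  · rfl
  · exact h.elim

lemma hatRk_none_lt {v w : W} (h : E.le v w) : E.hatRk none < E.hatRk (some (v, w)) := by
  have := rk_le h
  simp only [hatRk]
  omega

lemma hatRk_up {v w p : W} {a : V} (h : E.Cover v a p) :
    E.hatRk (some (p, w)) + 1 = E.hatRk (some (v, w)) := by
  have := h.2
  simp only [hatRk]
  omega

lemma hatRk_down {v w q : W} {a : V} (h : E.Cover q a w) :
    E.hatRk (some (v, q)) + 1 = E.hatRk (some (v, w)) := by
  have := h.2
  simp only [hatRk]
  omega

/-- Classification of the coatoms below an interval. -/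
lemma hat_coatom_cases {v w : W} {c : Option (W × W)} (hc : c ∈ hatCarrier E.le)
    (h : hatRel E.le c (some (v, w))) (hvw : E.le v w)
    (hr : E.hatRk c + 1 = E.hatRk (some (v, w))) :
    (c = none ∧ v = w) ∨ (∃ p a, c = some (p, w) ∧ E.Cover v a p ∧ E.le p w) ∨
      ∃ q a, c = some (v, q) ∧ E.Cover q a w ∧ E.le v q := by
  rcases c with _ | ⟨p, q⟩
  · refine Or.inl ⟨rfl, eq_of_le_of_rk hvw ?_⟩
    simp only [hatRk] at hr
    omega
  · have hpq := some_mem_hat.1 hc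
    obtain ⟨h1, -, h2⟩ := h
    simp only at h1 h2
    have := rk_le h1
    have := rk_le h2
    simp only [hatRk] at hr
    rcases eq_or_lt_of_le (rk_le h2) with he | he
    · obtain rfl := eq_of_le_of_rk h2 he.ge
      obtain ⟨a, ha⟩ := exists_edge_of_le h1 (by omega)
      exact Or.inr (Or.inl ⟨p, a, rfl, ha, hpq⟩)
    · obtain rfl := eq_of_le_of_rk h1 (by omega)
      obtain ⟨a, ha⟩ := exists_edge_of_le h2 (by omega)
      exact Or.inr (Or.inr ⟨q, a, rfl, ha, hpq⟩)

lemma hatRel_trans {a b c : Option (W × W)} (h1 : hatRel E.le a b) (h2 : hatRel E.le b c) :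
    hatRel E.le a c := by
  rcases a with _ | p
  · trivial
  rcases b with _ | q
  · exact h1.elim
  rcases c with _ | s
  · exact h2.elim
  exact ⟨le_trans h2.1 h1.1, h1.2.1, le_trans h1.2.2 h2.2.2⟩

lemma hat_rk_lt {a b : Option (W × W)} (hb : b ∈ hatCarrier E.le) (h : hatRel E.le a b)
    (hne : a ≠ b) : E.hatRk a < E.hatRk b := by
  rcases b with _ | ⟨v, w⟩
  · exact absurd (eq_none_of_hatRel h) hne
  rcases a with _ | ⟨p, q⟩
  · exact hatRk_none_lt (some_mem_hat.1 hb)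
  obtain ⟨h1, -, h2⟩ := h
  simp only at h1 h2
  have h3 := rk_le h1
  have h4 := rk_le h2
  by_contra hlt
  simp only [hatRk] at hlt
  exact hne (by rw [eq_of_le_of_rk h1 (by omega), eq_of_le_of_rk h2 (by omega)])

lemma hat_interval_some {p q v w : W} (hpq : E.le p q) :
    intervalIn (hatRel E.le) (hatCarrier E.le) (some (p, q)) (some (v, w)) =
      some '' (E.interval v p ×ˢ E.interval q w) := by
  ext z
  constructor
  · rintro ⟨hz, h1, h2⟩
    rcases z with _ | ⟨a, b⟩
    · exact h1.elim
    · exact ⟨(a, b), ⟨⟨h2.1, h1.1⟩, ⟨h1.2.2, h2.2.2⟩⟩, rfl⟩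
  · rintro ⟨⟨a, b⟩, ⟨⟨h1, h2⟩, ⟨h3, h4⟩⟩, rfl⟩
    have hab : E.le a b := le_trans h2 (le_trans hpq h3)
    exact ⟨some_mem_hat.2 hab, ⟨h2, hpq, h3⟩, ⟨h1, hab, h4⟩⟩

lemma hat_ncard_some {p q v w : W} (hpq : E.le p q) :
    (intervalIn (hatRel E.le) (hatCarrier E.le) (some (p, q)) (some (v, w))).ncard =
      (E.interval v p).ncard * (E.interval q w).ncard := by
  rw [hat_interval_some hpq, Set.ncard_image_of_injective _ (Option.some_injective _),
    Set.ncard_prod]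

lemma hat_ncard_none {v w : W} (hvw : E.le v w) (hr : E.rk w = E.rk v + 1) :
    (intervalIn (hatRel E.le) (hatCarrier E.le) none (some (v, w))).ncard = 4 := by
  have hne : v ≠ w := by
    rintro rfl
    omega
  have : intervalIn (hatRel E.le) (hatCarrier E.le) none (some (v, w)) =
      {none, some (v, v), some (w, w), some (v, w)} := by
    ext z
    constructor
    · rintro ⟨hz, -, h2⟩
      rcases z with _ | ⟨a, b⟩
      · simp
      · have ha : a ∈ E.interval v w := ⟨h2.1, le_trans h2.2.1 h2.2.2⟩
        have hb : b ∈ E.interval v w := ⟨le_trans h2.1 h2.2.1, h2.2.2⟩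
        rw [interval_one_eq hvw hr] at ha hb
        have hab := rk_le h2.2.1
        simp only at hab
        rcases ha with rfl | rfl <;> rcases hb with rfl | rfl
        · simp
        · simp
        · omega
        · simp
    · rintro (rfl | rfl | rfl | rfl)
      · exact ⟨none_mem_hat, trivial, trivial⟩
      · exact ⟨some_mem_hat.2 (le_refl v), trivial, le_refl v, le_refl v, hvw⟩
      · exact ⟨some_mem_hat.2 (le_refl w), trivial, hvw, le_refl w, le_refl w⟩
      · exact ⟨some_mem_hat.2 hvw, trivial, le_refl v, hvw, le_refl w⟩
  rw [this]
  refine ncard_quad ?_ ?_ ?_ ?_ ?_ ?_ <;> simp [hne, hne.symm]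

lemma hat_thin (G : ∀ p q, E.Good p q) {a b : Option (W × W)} (ha : a ∈ hatCarrier E.le)
    (hb : b ∈ hatCarrier E.le) (h : hatRel E.le a b) (hr : E.hatRk b = E.hatRk a + 2) :
    (intervalIn (hatRel E.le) (hatCarrier E.le) a b).ncard = 4 := by
  rcases b with _ | ⟨v, w⟩
  · rw [eq_none_of_hatRel h] at hr
    omega
  have hvw := some_mem_hat.1 hb
  rcases a with _ | ⟨p, q⟩
  · simp only [hatRk] at hr
    exact hat_ncard_none hvw (by omega)
  obtain ⟨h1, hpq, h2⟩ := h
  simp only at h1 hpq h2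
  have h3 := rk_le h1
  have h4 := rk_le h2
  simp only [hatRk] at hr
  rw [hat_ncard_some hpq]
  obtain hd | hd | hd : E.rk p = E.rk v ∨ E.rk p = E.rk v + 1 ∨ E.rk p = E.rk v + 2 := by omega
  · rw [interval_zero h1 hd, interval_two h2 (by omega) ((G _ _).diamond h2 (by omega))]
  · rw [interval_one h1 hd, interval_one h2 (by omega)]
  · rw [interval_two h1 hd ((G _ _).diamond h1 hd), interval_zero h2 (by omega)]

lemma hat_finite (G : ∀ p q, E.Good p q) (a : Option (W × W)) (b : Option (W × W)) :
    (intervalIn (hatRel E.le) (hatCarrier E.le) a b).Finite := by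
  rcases b with _ | ⟨v, w⟩
  · exact (Set.finite_singleton none).subset fun z hz => eq_none_of_hatRel hz.2.2
  · refine (((((G v w).finite.prod (G v w).finite).image some)).insert none).subset ?_
    rintro (_ | ⟨p, q⟩) ⟨-, -, h2⟩
    · exact Set.mem_insert _ _
    · exact Or.inr ⟨(p, q), ⟨⟨h2.1, le_trans h2.2.1 h2.2.2⟩, ⟨le_trans h2.1 h2.2.1, h2.2.2⟩⟩, rfl⟩

lemma hat_exists_coatom (G : ∀ p q, E.Good p q) {a b : Option (W × W)} (ha : a ∈ hatCarrier E.le)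
    (hb : b ∈ hatCarrier E.le) (h : hatRel E.le a b) (hne : a ≠ b) :
    ∃ c ∈ hatCarrier E.le, hatRel E.le a c ∧ hatRel E.le c b ∧ E.hatRk c + 1 = E.hatRk b := by
  rcases b with _ | ⟨v, w⟩
  · exact absurd (eq_none_of_hatRel h) hne
  have hvw := some_mem_hat.1 hb
  rcases a with _ | ⟨p, q⟩
  · by_cases he : v = w
    · subst he
      exact ⟨none, none_mem_hat, trivial, trivial, by simp [hatRk]⟩
    · obtain ⟨p, α, hα, hp⟩ := exists_atom (G v w).toBasic hvw he
      exact ⟨some (p, w), some_mem_hat.2 hp, trivial, ⟨hα.le, hp, le_refl w⟩, hatRk_up hα⟩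
  obtain ⟨h1, hpq, h2⟩ := h
  simp only at h1 hpq h2
  by_cases he : v = p
  · subst he
    have hqw : q ≠ w := by
      rintro rfl
      exact hne rfl
    obtain ⟨c, α, hα, hc⟩ := exists_coatom (G q w).toBasic h2 hqw
    have hvc := le_trans hpq hc
    exact ⟨some (v, c), some_mem_hat.2 hvc, ⟨le_refl v, hpq, hc⟩, ⟨le_refl v, hvc, hα.le⟩,
      hatRk_down hα⟩
  · obtain ⟨c, α, hα, hc⟩ := exists_atom (G v p).toBasic h1 he
    have hcw := le_trans hc (le_trans hpq h2)
    exact ⟨some (c, w), some_mem_hat.2 hcw, ⟨hc, hpq, h2⟩, ⟨hα.le, hcw, le_refl w⟩, hatRk_up hα⟩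

lemma hat_lab_inj {b c d : Option (W × W)} (hb : b ∈ hatCarrier E.le) (hc : c ∈ hatCarrier E.le)
    (hd : d ∈ hatCarrier E.le) (hcb : hatRel E.le c b) (hdb : hatRel E.le d b)
    (hcr : E.hatRk c + 1 = E.hatRk b) (hdr : E.hatRk d + 1 = E.hatRk b)
    (hl : E.hatLab b c = E.hatLab b d) : c = d := by
  rcases b with _ | ⟨v, w⟩
  · rw [eq_none_of_hatRel hcb, eq_none_of_hatRel hdb]
  have hvw := some_mem_hat.1 hb
  rcases hat_coatom_cases hc hcb hvw hcr with ⟨rfl, h1⟩ | ⟨p, a, rfl, h1, -⟩ | ⟨q, a, rfl, h1, -⟩ <;>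
  rcases hat_coatom_cases hd hdb hvw hdr with ⟨rfl, h2⟩ | ⟨p', a', rfl, h2, -⟩ | ⟨q', a', rfl, h2, -⟩
  · rfl
  · rw [hatLab_up h2] at hl
    exact absurd hl (up_lt_mid _).ne'
  · rw [hatLab_down h2] at hl
    exact absurd hl (mid_lt_down _).ne
  · rw [hatLab_up h1] at hl
    exact absurd hl (up_lt_mid _).ne
  · rw [hatLab_up h1, hatLab_up h2] at hl
    obtain rfl := E.label_inj h1.1 h2.1 (up_injective hl)
    rw [E.edge_fun h1.1 h2.1]
  · rw [hatLab_up h1, hatLab_down h2] at hl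
    exact absurd hl (up_lt_down _ _).ne
  · rw [hatLab_down h1] at hl
    exact absurd hl (mid_lt_down _).ne'
  · rw [hatLab_down h1, hatLab_up h2] at hl
    exact absurd hl (up_lt_down _ _).ne'
  · rw [hatLab_down h1, hatLab_down h2] at hl
    obtain rfl := E.label_inj h1.1 h2.1 (down_injective hl)
    rw [E.edge_cofun h1.1 h2.1]

lemma hat_exchange (G : ∀ p q, E.Good p q) {e c b : Option (W × W)} (he : e ∈ hatCarrier E.le)
    (hc : c ∈ hatCarrier E.le) (hb : b ∈ hatCarrier E.le) (hec : hatRel E.le e c)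
    (hcb : hatRel E.le c b) (her : E.hatRk e + 1 = E.hatRk c) (hcr : E.hatRk c + 1 = E.hatRk b)
    (hl : ¬ E.hatLab b c < E.hatLab c e) : ∃ d ∈ hatCarrier E.le, hatRel E.le e d ∧
      hatRel E.le d b ∧ E.hatRk d = E.hatRk c ∧ E.hatLab b d < E.hatLab b c := by
  rcases b with _ | ⟨v, w⟩
  · rw [eq_none_of_hatRel hcb] at hcr
    omega
  have hvw := some_mem_hat.1 hb
  rcases hat_coatom_cases hc hcb hvw hcr with ⟨rfl, -⟩ | ⟨p, a, rfl, h1, hpw⟩ | ⟨q, a, rfl, h1, hvq⟩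
  · rw [eq_none_of_hatRel hec] at her
    omega
  · rw [hatLab_up h1] at hl
    rcases hat_coatom_cases he hec hpw her with ⟨rfl, -⟩ | ⟨p', a', rfl, h2, h3⟩ |
      ⟨q, a', rfl, h2, h3⟩
    · exact absurd (up_lt_mid _) hl
    · rw [hatLab_up h2, up_lt_up] at hl
      have hr : E.rk p' = E.rk v + 2 := by
        have := h1.2
        have := h2.2
        omega
      obtain ⟨d, b₁, b₂, k1, k2, k3, -⟩ :=
        ((G v p').diamond (le_trans h1.le h2.le) hr).exists_lt h1 h2 hl
      have hdw := le_trans k2.le h3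
      refine ⟨some (d, w), some_mem_hat.2 hdw, ⟨k2.le, h3, le_refl w⟩, ⟨k1.le, hdw, le_refl w⟩,
        ?_, ?_⟩
      · have := hatRk_up (w := w) k1
        omega
      · rw [hatLab_up k1, hatLab_up h1]
        exact up_lt_up.2 k3
    · rw [hatLab_down h2] at hl
      exact absurd (up_lt_down _ _) hl
  · rw [hatLab_down h1] at hl
    rcases hat_coatom_cases he hec hvq her with ⟨rfl, rfl⟩ | ⟨p, a', rfl, h2, h3⟩ |
      ⟨q', a', rfl, h2, h3⟩
    · refine ⟨some (w, w), some_mem_hat.2 (le_refl w), trivial, ⟨hvw, le_refl w, le_refl w⟩, ?_, ?_⟩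
      · have := hatRk_up (w := w) h1
        omega
      · rw [hatLab_up h1, hatLab_down h1]
        exact up_lt_down _ _
    · have hpw := le_trans h3 h1.le
      refine ⟨some (p, w), some_mem_hat.2 hpw, ⟨le_refl p, h3, h1.le⟩, ⟨h2.le, hpw, le_refl w⟩,
        ?_, ?_⟩
      · have := hatRk_up (w := w) h2
        omega
      · rw [hatLab_up h2, hatLab_down h1]
        exact up_lt_down _ _
    · rw [hatLab_down h2, down_lt_down] at hl
      have hr : E.rk w = E.rk q' + 2 := by
        have := h1.2
        have := h2.2
        omega
      obtain ⟨d, b₁, b₂, k1, k2, -, k3⟩ :=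
        ((G q' w).diamond (le_trans h2.le h1.le) hr).exists_lt h2 h1 hl
      have hvd := le_trans h3 k1.le
      refine ⟨some (v, d), some_mem_hat.2 hvd, ⟨le_refl v, h3, k1.le⟩, ⟨le_refl v, hvd, k2.le⟩,
        ?_, ?_⟩
      · have := hatRk_down (v := v) k2
        omega
      · rw [hatLab_down k2, hatLab_down h1]
        exact down_lt_down.2 k3

lemma hat_descent (G : ∀ p q, E.Good p q) {z c d b : Option (W × W)} (hz : z ∈ hatCarrier E.le)
    (hc : c ∈ hatCarrier E.le) (hd : d ∈ hatCarrier E.le) (hb : b ∈ hatCarrier E.le)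
    (hzc : hatRel E.le z c) (hzd : hatRel E.le z d) (hcb : hatRel E.le c b)
    (hdb : hatRel E.le d b) (hcr : E.hatRk c + 1 = E.hatRk b) (hdr : E.hatRk d + 1 = E.hatRk b)
    (hl : E.hatLab b d < E.hatLab b c) : ∃ e ∈ hatCarrier E.le, hatRel E.le z e ∧
      hatRel E.le e c ∧ E.hatRk e + 1 = E.hatRk c ∧ ¬ E.hatLab b c < E.hatLab c e := by
  rcases b with _ | ⟨v, w⟩
  · rw [eq_none_of_hatRel hcb] at hcr
    omega
  have hvw := some_mem_hat.1 hb
  rcases hat_coatom_cases hc hcb hvw hcr with ⟨rfl, rfl⟩ | ⟨p, a, rfl, h1, hpw⟩ |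
    ⟨q, a, rfl, h1, hvq⟩
  · rcases hat_coatom_cases hd hdb hvw hdr with ⟨rfl, -⟩ | ⟨p', a', rfl, h2, h3⟩ |
      ⟨q', a', rfl, h2, h3⟩
    · exact absurd hl (lt_irrefl _)
    · have := h2.2
      have := rk_le h3
      omega
    · have := h2.2
      have := rk_le h3
      omega
  · rw [hatLab_up h1] at hl ⊢
    rcases hat_coatom_cases hd hdb hvw hdr with ⟨rfl, -⟩ | ⟨p', a', rfl, h2, h3⟩ |
      ⟨q', a', rfl, h2, h3⟩
    · exact absurd hl (up_lt_mid _).not_gt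
    · rw [hatLab_up h2, up_lt_up] at hl
      obtain ⟨u, hpu, hpu', huw, hzu⟩ : ∃ u, E.le p u ∧ E.le p' u ∧ E.le u w ∧
          ∀ x, E.le x u → hatRel E.le z (some (x, w)) := by
        rcases z with _ | ⟨z₁, z₂⟩
        · exact ⟨w, hpw, h3, le_refl w, fun _ _ => trivial⟩
        · exact ⟨z₁, hzc.1, hzd.1, le_trans hzc.2.1 hzc.2.2, fun x hx => ⟨hx, hzc.2.1, hzc.2.2⟩⟩
      obtain ⟨ω, x, k1, k2, k3⟩ := (G v u).atomSwap p a p' a' h1 hpu h2 hpu' hl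
      have hxw := le_trans k2 huw
      refine ⟨some (x, w), some_mem_hat.2 hxw, hzu x k2, ⟨k1.le, hxw, le_refl w⟩, hatRk_up k1, ?_⟩
      rw [hatLab_up k1]
      exact (up_lt_up.2 k3).not_gt
    · rw [hatLab_down h2] at hl
      exact absurd hl (up_lt_down _ _).not_gt
  · rw [hatLab_down h1] at hl ⊢
    rcases hat_coatom_cases hd hdb hvw hdr with ⟨rfl, rfl⟩ | ⟨p', a', rfl, h2, h3⟩ |
      ⟨q', a', rfl, h2, h3⟩
    · have := h1.2
      have := rk_le hvq
      omega
    · by_cases hvq' : v = q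
      · subst hvq'
        rcases z with _ | ⟨z₁, z₂⟩
        · refine ⟨none, none_mem_hat, trivial, trivial, by simp [hatRk], ?_⟩
          exact (mid_lt_down _).not_gt
        · have := rk_le hzd.1
          have := rk_le hzc.2.1
          have := rk_le hzc.2.2
          have := h2.2
          simp only at *
          omega
      · rcases z with _ | ⟨z₁, z₂⟩
        · obtain ⟨x, α, k1, k2⟩ := exists_atom (G v q).toBasic hvq hvq'
          refine ⟨some (x, q), some_mem_hat.2 k2, trivial, ⟨k1.le, k2, le_refl q⟩, hatRk_up k1, ?_⟩
          rw [hatLab_up k1]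
          exact (up_lt_down _ _).not_gt
        · have hpq : E.le p' q := le_trans hzd.1 (le_trans hzc.2.1 hzc.2.2)
          refine ⟨some (p', q), some_mem_hat.2 hpq, ⟨hzd.1, hzc.2.1, hzc.2.2⟩,
            ⟨h2.le, hpq, le_refl q⟩, hatRk_up h2, ?_⟩
          rw [hatLab_up h2]
          exact (up_lt_down _ _).not_gt
    · rw [hatLab_down h2, down_lt_down] at hl
      obtain ⟨u, huq, huq', hvu, hzu⟩ : ∃ u, E.le u q ∧ E.le u q' ∧ E.le v u ∧
          ∀ x, E.le u x → hatRel E.le z (some (v, x)) := by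
        rcases z with _ | ⟨z₁, z₂⟩
        · exact ⟨v, hvq, h3, le_refl v, fun _ _ => trivial⟩
        · exact ⟨z₂, hzc.2.2, hzd.2.2, le_trans hzc.1 hzc.2.1, fun x hx => ⟨hzc.1, hzc.2.1, hx⟩⟩
      obtain ⟨ω, x, k1, k2, k3⟩ := coatomSwap_of_good (p := u) (q := w) (fun p' q' _ _ => G p' q')
        q a q' a' h1 huq h2 huq' hl
      have hvx := le_trans hvu k2
      refine ⟨some (v, x), some_mem_hat.2 hvx, hzu x k2, ⟨le_refl v, hvx, k1.le⟩, hatRk_down k1, ?_⟩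
      rw [hatLab_down k1]
      exact (down_lt_down.2 k3).not_gt

/-- The poset of intervals of an edge system with good intervals, with a minimum adjoined,
carries a shelling labelling. -/
theorem labelledPoset (G : ∀ p q, E.Good p q) :
    LabelledPoset (hatRel E.le) (hatCarrier E.le) E.hatRk E.hatLab where
  refl := by
    rintro (_ | ⟨v, w⟩) h
    · trivial
    · exact ⟨le_refl v, some_mem_hat.1 h, le_refl w⟩
  trans _ _ _ _ _ _ := hatRel_trans
  rk_lt _ _ _ := hat_rk_lt
  coatom _ ha _ := hat_exists_coatom G ha
  finite a _ b _ := hat_finite G a b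
  thin _ ha _ := hat_thin G ha
  lab_inj _ hb _ hc _ := hat_lab_inj hb hc
  exchange _ he _ hc _ := hat_exchange G he hc
  descent _ hz _ hc _ hd _ := hat_descent G hz hc hd

end EdgeSystem

/-- Every closed interval of the poset `ᴶQ̂ = ᴶQ ⊔ {0̂}` (where
`ᴶQ = {(v, w) : v ᴶ≤ w}` with `(v', w') ⪯ (v, w)` iff `v ᴶ≤ v' ᴶ≤ w' ᴶ≤ w`, and `0̂` is
an adjoined minimum) is graded, thin, and shellable. -/
theorem JQhat_intervals_graded_thin_shellable
    {B : Type*} {M : CoxeterMatrix B} {W : Type*} [Group W] (cs : CoxeterSystem M W)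
    (J : Set B) (wJ Jw : W → W)
    (hmem : ∀ w : W, wJ w ∈ Subgroup.closure (cs.simple '' J))
    (hmin : ∀ w : W, ∀ i ∈ J, cs.length (cs.simple i * Jw w) > cs.length (Jw w))
    (hfac : ∀ w : W, w = wJ w * Jw w)
    (hlen : ∀ w : W, cs.length w = cs.length (wJ w) + cs.length (Jw w))
    (huniq : ∀ w a b : W, a ∈ Subgroup.closure (cs.simple '' J) →
      (∀ i ∈ J, cs.length (cs.simple i * b) > cs.length b) → w = a * b →
      a = wJ w ∧ b = Jw w) :
    ∀ x ∈ hatCarrier (twistedLE cs J wJ Jw), ∀ y ∈ hatCarrier (twistedLE cs J wJ Jw),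
      hatRel (twistedLE cs J wJ Jw) x y →
        GradedIn (hatRel (twistedLE cs J wJ Jw))
            (intervalIn (hatRel (twistedLE cs J wJ Jw))
              (hatCarrier (twistedLE cs J wJ Jw)) x y) ∧
        ThinIn (hatRel (twistedLE cs J wJ Jw))
            (intervalIn (hatRel (twistedLE cs J wJ Jw))
              (hatCarrier (twistedLE cs J wJ Jw)) x y) ∧
        ShellableIn (hatRel (twistedLE cs J wJ Jw))
            (intervalIn (hatRel (twistedLE cs J wJ Jw))
              (hatCarrier (twistedLE cs J wJ Jw)) x y) := by
  have F : cs.IsParabolicFactorization J wJ Jw := ⟨hmem, hmin, hfac, hlen, huniq⟩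
  classical
  let _ : LinearOrder B := linearOrderOfSTO WellOrderingRel
  have hle : twistedLE cs J wJ Jw = (CoxeterSystem.twistedSystem F).le := by
    ext y x
    exact F.twistedLE_iff
  rw [hle]
  intro x hx y hy hxy
  have P := EdgeSystem.labelledPoset F.good
  exact ⟨P.gradedIn_interval hx hy hxy, P.thinIn_interval hx hy, P.shellableIn_interval hx hy hxy⟩
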